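/- With the standing assumptions, suppose in addition that U = αβα₁ and V = β₁α₂β₂, where α, α₁, α₂ are nontrivial elements of A and β, β₁, β₂ are nontrivial elements of B. Then G is nontrivial. -/

import Mathlib

open Monoid

/-- The free-product length of an element of an indexed free product: the number of letters
in its unique reduced expression as an alternating product of nontrivial elements of the
factors (the identity has length `0`). -/
noncomputable def CoprodI.length {ι : Type*} {G : ι → Type*} [∀ i, Group (G i)]
    (w : Monoid.CoprodI G) : ℕ :=
  letI := Classical.decEq ι
  letI : ∀ i, DecidableEq (G i) := fun i => Classical.decEq (G i)
  (Monoid.CoprodI.Word.equiv w).toList.length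

/-- The first two factors `A = G 0`, `B = G 1` of a triple of groups, as a family over
`Fin 2`; their free product `Monoid.CoprodI (subFamily G)` is the free product `A*B`. -/
def subFamily (G : Fin 3 → Type*) : Fin 2 → Type _ := fun i => G i.castSucc

instance (G : Fin 3 → Type*) [∀ i, Group (G i)] (i : Fin 2) : Group (subFamily G i) :=
  inferInstanceAs (Group (G i.castSucc))

/-- The canonical embedding of the free product `A*B` into the free product `A*B*C`. -/
def CoprodI.embed (G : Fin 3 → Type*) [∀ i, Group (G i)] :
    Monoid.CoprodI (subFamily G) →* Monoid.CoprodI G :=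
  Monoid.CoprodI.lift fun i => (Monoid.CoprodI.of : G i.castSucc →* Monoid.CoprodI G)



namespace P59
open Function

universe u v w

/-! ### Amalgams -/

/-- A two-element family of groups. -/
def Fam (K1 K2 : Type u) : Bool → Type u
  | true => K1
  | false => K2

instance Fam.group (K1 K2 : Type u) [Group K1] [Group K2] : ∀ i, Group (Fam K1 K2 i)
  | true => inferInstanceAs (Group K1)
  | false => inferInstanceAs (Group K2)

/-- Two maps as a map into the family. -/
def famMap {H K1 K2 : Type u} [Group H] [Group K1] [Group K2] (f1 : H →* K1) (f2 : H →* K2) :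
    ∀ i, H →* Fam K1 K2 i
  | true => f1
  | false => f2

section
open Monoid Monoid.PushoutI
variable {ι : Type*} {H : Type*} {G : ι → Type*} [∀ i, Group (G i)] [Group H]
  (φ : ∀ i, H →* G i)

/-- Reduced products whose first letter has index `i`. -/
def startSet (i : ι) : Set (PushoutI φ) :=
  {k | ∃ (j : ι) (w : CoprodI.NeWord G i j), (∀ g ∈ w.toList, g.2 ∉ (φ g.1).range) ∧
    k = ofCoprodI w.prod}

variable {φ}

theorem inv_letters {i j : ι} (w : CoprodI.NeWord G i j)
    (h : ∀ g ∈ w.toList, g.2 ∉ (φ g.1).range) : ∀ g ∈ w.inv.toList, g.2 ∉ (φ g.1).range := by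
  induction w with
  | singleton x hx =>
    intro g hg
    simp only [CoprodI.NeWord.inv, CoprodI.NeWord.toList, List.mem_singleton] at hg
    subst hg
    have := h ⟨_, x⟩ (by simp [CoprodI.NeWord.toList])
    simpa using this
  | append w1 hne w2 ih1 ih2 =>
    intro g hg
    simp only [CoprodI.NeWord.inv, CoprodI.NeWord.toList, List.mem_append] at hg h
    rcases hg with hg | hg
    · exact ih2 (fun g hg => h g (Or.inr hg)) g hg
    · exact ih1 (fun g hg => h g (Or.inl hg)) g hg

theorem not_base_of_letters (hφ : ∀ i, Injective (φ i)) {i j : ι} (w : CoprodI.NeWord G i j)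
    (h : ∀ g ∈ w.toList, g.2 ∉ (φ g.1).range) : ofCoprodI (φ := φ) w.prod ∉ (base φ).range := by
  intro hb
  have := Reduced.eq_empty_of_mem_range (φ := φ) hφ (w := w.toWord) h hb
  have h2 : w.toWord.toList = [] := by rw [this]; rfl
  exact w.toList_ne_nil h2

theorem startSet_disjoint (hφ : ∀ i, Injective (φ i)) {i j : ι} (hij : i ≠ j)
    {k : PushoutI φ} (h1 : k ∈ startSet φ i) (h2 : k ∈ startSet φ j) : False := by
  obtain ⟨_, w1, hw1, rfl⟩ := h1
  obtain ⟨_, w2, hw2, h⟩ := h2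
  refine not_base_of_letters hφ (w1.inv.append hij w2) ?_ ?_
  · intro g hg
    simp only [CoprodI.NeWord.toList, List.mem_append] at hg
    rcases hg with hg | hg
    · exact inv_letters w1 hw1 g hg
    · exact hw2 g hg
  · simp [← h, map_inv]

theorem of_mem_startSet {i : ι} {k : G i} (hk : k ∉ (φ i).range) :
    of (φ := φ) i k ∈ startSet φ i := by
  refine ⟨i, .singleton k (fun h => hk (h ▸ one_mem _)), ?_, by simp⟩
  intro g hg
  simp only [CoprodI.NeWord.toList, List.mem_singleton] at hg
  subst hg; exact hk

theorem of_mul_mem_startSet {i j : ι} (hij : i ≠ j) {k : G i} (hk : k ∉ (φ i).range)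
    {s : PushoutI φ} (hs : s ∈ startSet φ j) : of (φ := φ) i k * s ∈ startSet φ i := by
  obtain ⟨l, w, hw, rfl⟩ := hs
  refine ⟨l, (CoprodI.NeWord.singleton k (fun h => hk (h ▸ one_mem _))).append hij w, ?_, by simp⟩
  intro g hg
  simp only [CoprodI.NeWord.toList, List.singleton_append, List.mem_cons] at hg
  rcases hg with rfl | hg
  · exact hk
  · exact hw g hg

end

/-- Amalgam of two groups over a common image. -/
theorem glue {F : Type w} {K1 K2 : Type u} [Group F] [Group K1] [Group K2]
    (f1 : F →* K1) (f2 : F →* K2) (hker : f1.ker = f2.ker) :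
    ∃ (K : Type u) (_ : Group K) (i1 : K1 →* K) (i2 : K2 →* K) (S1 S2 : Set K),
      Injective i1 ∧ Injective i2 ∧ (∀ x, i1 (f1 x) = i2 (f2 x)) ∧
      (∀ k, k ∉ f1.range → i1 k ∈ S1) ∧ (∀ k, k ∉ f2.range → i2 k ∈ S2) ∧
      (∀ k, k ∉ f1.range → ∀ s ∈ S2, i1 k * s ∈ S1) ∧
      (∀ k, k ∉ f2.range → ∀ s ∈ S1, i2 k * s ∈ S2) ∧
      (∀ x, i1 (f1 x) ∉ S1) ∧ (∀ x, i1 (f1 x) ∉ S2) ∧ (∀ s, s ∈ S1 → s ∈ S2 → False) := by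
  classical
  let e : f1.range →* K2 :=
    (QuotientGroup.lift f1.ker f2 (fun x hx => by rw [hker] at hx; exact hx)).comp
      (QuotientGroup.quotientKerEquivRange f1).symm.toMonoidHom
  have he : ∀ x, e ⟨f1 x, x, rfl⟩ = f2 x := by
    intro x
    have : (QuotientGroup.quotientKerEquivRange f1).symm ⟨f1 x, x, rfl⟩ = (x : F ⧸ f1.ker) := by
      rw [MulEquiv.symm_apply_eq]; rfl
    simp only [e, MonoidHom.comp_apply, MulEquiv.toMonoidHom_eq_coe, MonoidHom.coe_coe, this]
    rfl
  have hinj : Injective e := by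
    rw [injective_iff_map_eq_one]
    rintro ⟨_, x, rfl⟩ h
    rw [he] at h
    have : x ∈ f1.ker := by rw [hker]; exact h
    exact Subtype.ext this
  have hrange : e.range = f2.range := by
    ext k; constructor
    · rintro ⟨⟨_, x, rfl⟩, rfl⟩; exact ⟨x, (he x).symm⟩
    · rintro ⟨x, rfl⟩; exact ⟨_, he x⟩
  let φ := famMap (f1.range.subtype) e
  have hφ : ∀ i, Injective (φ i) := by
    rintro (_ | _)
    · exact hinj
    · exact Subtype.val_injective
  have hr1 : (φ true).range = f1.range := by
    show (f1.range.subtype).range = _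
    simp
  have hr2 : (φ false).range = f2.range := hrange
  have hbase : ∀ x, (Monoid.PushoutI.of (φ := φ) true : K1 →* _) (f1 x) =
      Monoid.PushoutI.base φ ⟨f1 x, x, rfl⟩ := fun x =>
    Monoid.PushoutI.of_apply_eq_base φ true (⟨f1 x, x, rfl⟩ : f1.range)
  have hnb : ∀ i x, Monoid.PushoutI.base φ x ∉ startSet φ i := by
    rintro i x ⟨_, w, hw, h⟩
    exact not_base_of_letters hφ w hw ⟨x, h⟩
  refine ⟨Monoid.PushoutI φ, inferInstance, Monoid.PushoutI.of (φ := φ) true,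
    Monoid.PushoutI.of (φ := φ) false, startSet φ true, startSet φ false,
    Monoid.PushoutI.of_injective hφ true, Monoid.PushoutI.of_injective hφ false, ?_,
    fun k hk => of_mem_startSet (i := true) (by rw [hr1]; exact hk),
    fun k hk => of_mem_startSet (i := false) (by rw [hr2]; exact hk),
    fun k hk s hs => of_mul_mem_startSet (i := true) (j := false) (by simp) (by rw [hr1]; exact hk) hs,
    fun k hk s hs => of_mul_mem_startSet (i := false) (j := true) (by simp) (by rw [hr2]; exact hk) hs,
    fun x h => hnb true _ (Eq.mp (congrArg (· ∈ startSet φ true) (hbase x)) h),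
    fun x h => hnb false _ (Eq.mp (congrArg (· ∈ startSet φ false) (hbase x)) h),
    fun s h1 h2 => startSet_disjoint hφ (by simp) h1 h2⟩
  intro x
  have h2 : (Monoid.PushoutI.of (φ := φ) false : K2 →* _) (e ⟨f1 x, x, rfl⟩) =
      Monoid.PushoutI.base φ ⟨f1 x, x, rfl⟩ :=
    Monoid.PushoutI.of_apply_eq_base φ false (⟨f1 x, x, rfl⟩ : f1.range)
  exact (hbase x).trans (h2.symm.trans (congrArg _ (he x)))

/-- Gluing along cyclic subgroups. -/
theorem glue_cyclic {K1 K2 : Type u} [Group K1] [Group K2] (g1 : K1) (g2 : K2)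
    (ho : orderOf g1 = orderOf g2) :
    ∃ (K : Type u) (_ : Group K) (i1 : K1 →* K) (i2 : K2 →* K) (S1 S2 : Set K),
      Injective i1 ∧ Injective i2 ∧ i1 g1 = i2 g2 ∧
      (∀ k, k ∉ Subgroup.zpowers g1 → i1 k ∈ S1) ∧ (∀ k, k ∉ Subgroup.zpowers g2 → i2 k ∈ S2) ∧
      (∀ k, k ∉ Subgroup.zpowers g1 → ∀ s ∈ S2, i1 k * s ∈ S1) ∧
      (∀ k, k ∉ Subgroup.zpowers g2 → ∀ s ∈ S1, i2 k * s ∈ S2) ∧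
      (∀ n : ℤ, i1 (g1 ^ n) ∉ S1) ∧ (∀ n : ℤ, i1 (g1 ^ n) ∉ S2) ∧
      (∀ s, s ∈ S1 → s ∈ S2 → False) := by
  have hker : (zpowersHom K1 g1).ker = (zpowersHom K2 g2).ker := by
    ext x
    simp only [MonoidHom.mem_ker, zpowersHom_apply, ← orderOf_dvd_iff_zpow_eq_one, ho]
  have hr : ∀ {K : Type u} [Group K] (g : K), (zpowersHom K g).range = Subgroup.zpowers g := by
    intro K _ g; ext k
    simp only [MonoidHom.mem_range, zpowersHom_apply, Subgroup.mem_zpowers_iff]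
    exact ⟨fun ⟨x, h⟩ => ⟨x.toAdd, h⟩, fun ⟨x, h⟩ => ⟨Multiplicative.ofAdd x, h⟩⟩
  obtain ⟨K, hK, i1, i2, S1, S2, h1, h2, h3, h4, h5, h6, h7, h8, h9, h10⟩ := glue _ _ hker
  rw [hr] at h4 h5 h6 h7
  refine ⟨K, hK, i1, i2, S1, S2, h1, h2, ?_, h4, h5, h6, h7, ?_, ?_, h10⟩
  · simpa using h3 (Multiplicative.ofAdd 1)
  · intro n; simpa using h8 (Multiplicative.ofAdd n)
  · intro n; simpa using h9 (Multiplicative.ofAdd n)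

/-- Free products with ping-pong sets. -/
theorem free_prod (K1 K2 : Type u) [Group K1] [Group K2] :
    ∃ (K : Type u) (_ : Group K) (i1 : K1 →* K) (i2 : K2 →* K) (S1 S2 : Set K),
      Injective i1 ∧ Injective i2 ∧
      (∀ k, k ≠ 1 → i1 k ∈ S1) ∧ (∀ k, k ≠ 1 → i2 k ∈ S2) ∧
      (∀ k, k ≠ 1 → ∀ s ∈ S2, i1 k * s ∈ S1) ∧
      (∀ k, k ≠ 1 → ∀ s ∈ S1, i2 k * s ∈ S2) ∧
      1 ∉ S1 ∧ 1 ∉ S2 ∧ (∀ s, s ∈ S1 → s ∈ S2 → False) := by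
  obtain ⟨K, hK, i1, i2, S1, S2, h1, h2, h3, h4, h5, h6, h7, h8, h9, h10⟩ :=
    glue_cyclic (1 : K1) (1 : K2) (by simp)
  simp only [Subgroup.zpowers_one_eq_bot, Subgroup.mem_bot] at h4 h5 h6 h7
  exact ⟨K, hK, i1, i2, S1, S2, h1, h2, h4, h5, h6, h7, by simpa using h8 0, by simpa using h9 0, h10⟩

/-! ### Free families -/

/-- The cyclic group homomorphism determined by an element of order dividing `n`. -/
noncomputable def cyc {K : Type*} [Group K] (n : ℕ) (g : K) (h : g ^ n = 1) :
    Multiplicative (ZMod n) →* K :=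
  AddMonoidHom.toMultiplicativeLeft
    (ZMod.lift n ⟨zmultiplesHom (Additive K) (Additive.ofMul g), by
      simp [← ofMul_pow, h]⟩)

theorem cyc_apply {K : Type*} [Group K] (n : ℕ) (g : K) (h : g ^ n = 1) (k : ℤ) :
    cyc n g h (Multiplicative.ofAdd (k : ZMod n)) = g ^ k := by
  simp [cyc]

/-- A family of elements generating the free product of the cyclic groups they generate. -/
def Fr {ι : Type} {K : Type*} [Group K] (q : ι → ℕ) (g : ι → K) : Prop :=
  ∃ h : ∀ i, g i ^ q i = 1, Injective (Monoid.CoprodI.lift fun i => cyc (q i) (g i) (h i))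

theorem fr_of_pingpong {ι : Type} {K : Type*} [Group K] {q : ι → ℕ} {g : ι → K}
    (ho : ∀ i, orderOf (g i) = q i) (X : ι → Set K)
    (h1 : ∀ i, 1 ∉ X i)
    (hp : ∀ i (n : ℤ), g i ^ n ≠ 1 → g i ^ n ∈ X i)
    (hpp : ∀ i (n : ℤ), g i ^ n ≠ 1 → ∀ j, j ≠ i → ∀ s ∈ X j, g i ^ n * s ∈ X i) : Fr q g := by
  classical
  refine ⟨fun i => by rw [← ho]; exact pow_orderOf_eq_one _, ?_⟩
  rw [injective_iff_map_eq_one]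
  set f := Monoid.CoprodI.lift fun i => cyc (q i) (g i) (by rw [← ho]; exact pow_orderOf_eq_one _)
    with hf
  have key : ∀ i (x : Multiplicative (ZMod (q i))), x ≠ 1 →
      ∃ n : ℤ, f (Monoid.CoprodI.of x) = g i ^ n ∧ g i ^ n ≠ 1 := by
    intro i x hx
    obtain ⟨k, hk⟩ := ZMod.intCast_surjective x.toAdd
    have hxk : x = Multiplicative.ofAdd (k : ZMod (q i)) := by rw [hk]; rfl
    refine ⟨k, by rw [hf, hxk, Monoid.CoprodI.lift_of, cyc_apply], ?_⟩
    intro h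
    apply hx
    rw [← orderOf_dvd_iff_zpow_eq_one, ho] at h
    rw [hxk, (ZMod.intCast_zmod_eq_zero_iff_dvd k (q i)).2 h]
    rfl
  have main : ∀ {i j} (w : Monoid.CoprodI.NeWord (fun i => Multiplicative (ZMod (q i))) i j),
      f w.prod ∈ X i ∧ ∀ k, k ≠ j → ∀ s ∈ X k, f w.prod * s ∈ X i := by
    intro i j w
    induction w with
    | singleton x hx =>
      obtain ⟨n, hn, hn1⟩ := key _ x hx
      rw [Monoid.CoprodI.NeWord.prod_singleton, hn]
      exact ⟨hp _ n hn1, fun k hk s hs => hpp _ n hn1 k hk s hs⟩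
    | append w1 hne w2 ih1 ih2 =>
      simp only [Monoid.CoprodI.NeWord.append_prod, map_mul]
      refine ⟨ih1.2 _ hne.symm _ ih2.1, fun k hk s hs => ?_⟩
      rw [mul_assoc]
      exact ih1.2 _ hne.symm _ (ih2.2 k hk s hs)
  intro x hx
  by_contra hne
  obtain ⟨i, j, w, hw⟩ := Monoid.CoprodI.NeWord.of_word (Monoid.CoprodI.Word.equiv x) (by
    intro h
    apply hne
    have := congrArg Monoid.CoprodI.Word.equiv.symm h
    rw [Equiv.symm_apply_apply] at this
    exact this.trans Monoid.CoprodI.Word.prod_empty)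
  have hx' : w.prod = x := by
    show w.toWord.prod = x
    rw [hw]
    exact Monoid.CoprodI.Word.equiv.symm_apply_apply x
  have := (main w).1
  rw [hx', hx] at this
  exact h1 _ this

/-- Gluing along free families. -/
theorem glue_fr {ι : Type} {K1 K2 : Type u} [Group K1] [Group K2] {q : ι → ℕ} {g1 : ι → K1}
    {g2 : ι → K2} (h1 : Fr q g1) (h2 : Fr q g2) :
    ∃ (K : Type u) (_ : Group K) (i1 : K1 →* K) (i2 : K2 →* K),
      Injective i1 ∧ Injective i2 ∧ ∀ i, i1 (g1 i) = i2 (g2 i) := by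
  obtain ⟨p1, f1⟩ := h1
  obtain ⟨p2, f2⟩ := h2
  obtain ⟨K, hK, i1, i2, S1, S2, h1, h2, h3, _⟩ := glue _ _
    (((MonoidHom.ker_eq_bot_iff _).2 f1).trans ((MonoidHom.ker_eq_bot_iff _).2 f2).symm)
  refine ⟨K, hK, i1, i2, h1, h2, fun i => ?_⟩
  have := h3 (Monoid.CoprodI.of (i := i) (Multiplicative.ofAdd ((1 : ℤ) : ZMod (q i))))
  simpa only [Monoid.CoprodI.lift_of, cyc_apply, zpow_one] using this

end P59


namespace P59
open Function

universe u v w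

/-! ### The monoid of slot words -/

/-- `nil g` is the element `g`, and `cons g m` is `g y m`. -/
inductive Mw (A : Type u) : Type u
  | nil : A → Mw A
  | cons : A → Mw A → Mw A

namespace Mw
variable {A : Type u} [Group A]

/-- Multiplication of slot words. -/
def mul : Mw A → Mw A → Mw A
  | nil g, nil h => nil (g * h)
  | nil g, cons h m => cons (g * h) m
  | cons g m, k => cons g (mul m k)

instance : Mul (Mw A) := ⟨mul⟩
instance : One (Mw A) := ⟨nil 1⟩

theorem one_def : (1 : Mw A) = nil 1 := rfl
@[simp] theorem nil_nil (g h : A) : nil g * nil h = nil (g * h) := rfl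
@[simp] theorem nil_cons (g h : A) (m : Mw A) : nil g * cons h m = cons (g * h) m := rfl
@[simp] theorem cons_mul (g : A) (m k : Mw A) : cons g m * k = cons g (m * k) := rfl

instance : Monoid (Mw A) where
  mul_assoc a b c := by
    induction a with
    | nil g => cases b <;> cases c <;> simp [mul_assoc]
    | cons g m ih => simp [ih]
  one_mul a := by cases a <;> simp [one_def]
  mul_one a := by
    induction a with
    | nil g => simp [one_def]
    | cons g m ih => simp [ih]

/-- The letter `y`. -/
def y : Mw A := cons 1 (nil 1)

theorem cons_eq (g : A) (m : Mw A) : cons g m = nil g * y * m := by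
  cases m <;> simp [y]

/-- The number of letters `y`. -/
def cnt : Mw A → ℕ
  | nil _ => 0
  | cons _ m => cnt m + 1

@[simp] theorem cnt_nil (g : A) : cnt (nil g) = 0 := rfl
@[simp] theorem cnt_one : cnt (1 : Mw A) = 0 := rfl
@[simp] theorem cnt_y : cnt (y : Mw A) = 1 := rfl
@[simp] theorem cnt_mul (a b : Mw A) : cnt (a * b) = cnt a + cnt b := by
  induction a with
  | nil g => cases b <;> simp [cnt]
  | cons g m ih => simp [cnt, ih]; omega

theorem eq_nil_of_cnt {a : Mw A} (h : cnt a = 0) : ∃ g, a = nil g := by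
  cases a with
  | nil g => exact ⟨g, rfl⟩
  | cons g m => simp [cnt] at h

theorem mul_comm_one {a b : Mw A} (h : a * b = 1) : b * a = 1 := by
  have h0 := congrArg cnt h
  simp only [cnt_mul, cnt_one] at h0
  obtain ⟨g, rfl⟩ := eq_nil_of_cnt (a := a) (by omega)
  obtain ⟨k, rfl⟩ := eq_nil_of_cnt (a := b) (by omega)
  rw [nil_nil, one_def, nil.injEq] at h ⊢
  exact mul_eq_one_comm.1 h

theorem split {p q p' q' : Mw A} (h : p * y * q = p' * q') :
    (∃ m, p' = p * y * m ∧ q = m * q') ∨ (∃ m, p = p' * m ∧ q' = m * y * q) := by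
  induction p' generalizing p with
  | nil g =>
    right
    refine ⟨nil g⁻¹ * p, ?_, ?_⟩
    · rw [← mul_assoc]; simp [← one_def]
    · rw [mul_assoc, mul_assoc, ← mul_assoc p, h, ← mul_assoc]; simp [← one_def]
  | cons g m ih =>
    cases p with
    | nil k =>
      rw [← cons_eq, cons_mul, cons.injEq] at h
      left
      exact ⟨m, by rw [← cons_eq, h.1], h.2⟩
    | cons k p2 =>
      simp only [cons_mul, cons.injEq] at h
      obtain ⟨rfl, h⟩ := h
      rcases ih h with ⟨m', h1, h2⟩ | ⟨m', h1, h2⟩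
      · left; exact ⟨m', by rw [h1]; rfl, h2⟩
      · right; exact ⟨m', by rw [h1]; rfl, h2⟩

variable {P : Type*} [Group P]

/-- Evaluation of slot words in a group. -/
def ev (j : A →* P) (z : P) : Mw A → P
  | nil g => j g
  | cons g m => j g * z * ev j z m

theorem ev_mul (j : A →* P) (z : P) (a b : Mw A) : ev j z (a * b) = ev j z a * ev j z b := by
  induction a with
  | nil g => cases b <;> simp [ev, mul_assoc]
  | cons g m ih => simp [ev, ih, mul_assoc]

/-- Evaluation as a homomorphism. -/
def pi (j : A →* P) (z : P) : Mw A →* P where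
  toFun := ev j z
  map_one' := by simp [one_def, ev]
  map_mul' := ev_mul j z

@[simp] theorem pi_nil (j : A →* P) (z : P) (g : A) : pi j z (nil g) = j g := rfl
@[simp] theorem pi_y (j : A →* P) (z : P) : pi j z y = z := by simp [pi, y, ev]

end Mw

/-! ### Products of conjugates -/

/-- Products of `n` conjugates of `r`. -/
inductive Pr {P : Type*} [Group P] (r : P) : ℕ → P → Prop
  | zero : Pr r 0 1
  | succ (n : ℕ) (z g : P) : Pr r n z → Pr r (n + 1) (g * r * g⁻¹ * z)

/-- Products of fewer than `n` conjugates of `r`. -/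
def PrLt {P : Type*} [Group P] (r : P) (n : ℕ) (z : P) : Prop := ∃ k < n, Pr r k z

section
variable {P : Type*} [Group P] {r : P}

theorem Pr.mul {m n : ℕ} {z t : P} (h : Pr r m z) (h' : Pr r n t) : Pr r (m + n) (z * t) := by
  induction h with
  | zero => simpa using h'
  | succ k z g _ ih =>
    have := Pr.succ _ _ g ih
    rw [show k + 1 + n = k + n + 1 by omega, mul_assoc]
    exact this

theorem Pr.conj {m : ℕ} {z : P} (h : Pr r m z) (g : P) : Pr r m (g * z * g⁻¹) := by
  induction h with
  | zero => simpa using Pr.zero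
  | succ k z k' _ ih =>
    have := Pr.succ _ _ (g * k') ih
    convert this using 1
    group

theorem Pr.rot {m : ℕ} {z t : P} (h : Pr r m (z * t)) : Pr r m (t * z) := by
  have := h.conj z⁻¹
  convert this using 1; group

theorem Pr.insert {m n : ℕ} {z t s : P} (h : Pr r m (z * t)) (h' : Pr r n s) :
    Pr r (m + n) (z * s * t) := by
  have := (h'.conj z).mul h
  rw [Nat.add_comm]
  convert this using 1; group

theorem PrLt.rot {m : ℕ} {z t : P} (h : PrLt r m (z * t)) : PrLt r m (t * z) := by
  obtain ⟨k, hk, h⟩ := h; exact ⟨k, hk, h.rot⟩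

theorem PrLt.insert {m n : ℕ} {z t s : P} (h : PrLt r m (z * t)) (h' : Pr r n s) :
    PrLt r (m + n) (z * s * t) := by
  obtain ⟨k, hk, h⟩ := h; exact ⟨k + n, by omega, h.insert h'⟩

theorem Pr.insert_lt {m n : ℕ} {z t s : P} (h : Pr r m (z * t)) (h' : PrLt r n s) :
    PrLt r (m + n) (z * s * t) := by
  obtain ⟨k, hk, h'⟩ := h'; exact ⟨m + k, by omega, h.insert h'⟩

theorem Pr.inv {g0 : P} (hg0 : r⁻¹ = g0 * r * g0⁻¹) {m : ℕ} {z : P} (h1 : Pr r m z) :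
    Pr r m z⁻¹ := by
  induction h1 with
  | zero => simpa using Pr.zero
  | succ k z c _ ih =>
    have h2 : Pr r 1 (c * r * c⁻¹)⁻¹ := by
      have := Pr.succ 0 1 (c * g0) (.zero (r := r))
      convert this using 1
      simp only [mul_inv_rev, inv_inv, hg0]; group
    rw [mul_inv_rev]
    exact ih.mul h2

theorem exists_pr_of_mem {z : P} (hr : ∃ g, r⁻¹ = g * r * g⁻¹)
    (h : z ∈ Subgroup.normalClosure {r}) : ∃ n, Pr r n z := by
  obtain ⟨g0, hg0⟩ := hr
  refine Subgroup.closure_induction (p := fun z _ => ∃ n, Pr r n z) ?_ ⟨0, .zero⟩ ?_ ?_ h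
  · intro z hz
    rw [Group.mem_conjugatesOfSet_iff] at hz
    obtain ⟨_, rfl, hc⟩ := hz
    obtain ⟨c, rfl⟩ := isConj_iff.1 hc
    exact ⟨1, by simpa using Pr.succ 0 1 c .zero⟩
  · rintro _ _ _ _ ⟨m, h1⟩ ⟨n, h2⟩; exact ⟨m + n, h1.mul h2⟩
  · rintro z _ ⟨m, h1⟩
    exact ⟨m, h1.inv hg0⟩
end

/-! ### Assemblies -/

section
open Mw
variable {A : Type u} [Group A] {P : Type v} [Group P] {r : P} {j : A →* P} {z : P}

/-- Words obtained from the trivial one by inserting pieces. -/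
inductive Asm (I : ℕ → Mw A → Prop) : ℕ → Mw A → Prop
  | one : Asm I 0 1
  | ins (n k : ℕ) (p q l : Mw A) : Asm I n (p * q) → I k l → Asm I (n + k) (p * l * q)

/-- The closure properties of the class of pieces. -/
structure Pieces (r : P) (j : A →* P) (z : P) (I : ℕ → Mw A → Prop) : Prop where
  pr : ∀ n l, I n l → Pr r n (pi j z l)
  pos : ∀ n l, I n l → 0 < cnt l
  fold : ∀ n m e, I n (m * y * y * e) →
    I n (m * e) ∨ (n = 0 ∧ m * e = 1) ∨ PrLt r n (pi j z (m * e))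
  glue : ∀ n1 n2 m m' s s', I n1 (m * y * m') → I n2 (s * y * s') →
    I (n1 + n2) (m * s' * s * m') ∨ PrLt r (n1 + n2) (pi j z (m * s' * s * m'))

variable {I : ℕ → Mw A → Prop} (hI : Pieces r j z I)
include hI

theorem Asm.pr {n : ℕ} {l : Mw A} (h : Asm I n l) : Pr r n (pi j z l) := by
  induction h with
  | one => simpa using Pr.zero
  | ins n k p q l _ hl ih =>
    rw [map_mul] at ih
    rw [map_mul, map_mul]
    exact ih.insert (hI.pr _ _ hl)

theorem Asm.subst {n k : ℕ} {s s' : Mw A} (hs : I k (s * y * s')) {w : Mw A} (h : Asm I n w) :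
    ∀ p q, w = p * y * q →
      Asm I (n + k) (p * s' * s * q) ∨ PrLt r (n + k) (pi j z (p * s' * s * q)) := by
  induction h with
  | one =>
    intro p q h
    have := congrArg cnt h
    simp at this
    omega
  | ins n k' p1 q1 l h0 hl ih =>
    intro p q h
    rw [mul_assoc p1] at h
    have e : n + k' + k = n + k + k' := by omega
    rcases split h.symm with ⟨m, rfl, rfl⟩ | ⟨m, rfl, h2⟩
    · have := ih p (m * q1) (by simp only [mul_assoc])
      rw [e]
      rcases this with h3 | h3
      · left
        have h4 := Asm.ins _ _ (p * s' * s * m) q1 l (by simpa only [mul_assoc] using h3) hl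
        simpa only [mul_assoc] using h4
      · right
        have h4 : PrLt r (n + k) (pi j z (p * s' * s * m) * pi j z q1) := by
          rw [← map_mul]; simpa only [mul_assoc] using h3
        have h5 := h4.insert (hI.pr _ _ hl)
        rw [← map_mul, ← map_mul] at h5
        simpa only [mul_assoc] using h5
    · rcases split h2.symm with ⟨m', rfl, rfl⟩ | ⟨m', rfl, rfl⟩
      · rcases hI.glue _ _ _ _ _ _ hl hs with h3 | h3
        · left
          have h4 := Asm.ins _ _ p1 q1 _ h0 h3
          rw [show n + k' + k = n + (k' + k) by omega]
          simpa only [mul_assoc] using h4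
        · right
          have h4 := Asm.pr hI h0
          rw [map_mul] at h4
          have h5 := h4.insert_lt h3
          rw [← map_mul, ← map_mul] at h5
          rw [show n + k' + k = n + (k' + k) by omega]
          simpa only [mul_assoc] using h5
      · have := ih (p1 * m') q (by simp only [mul_assoc])
        rw [e]
        rcases this with h3 | h3
        · left
          have h4 := Asm.ins _ _ p1 (m' * s' * s * q) l (by simpa only [mul_assoc] using h3) hl
          simpa only [mul_assoc] using h4
        · right
          have h4 : PrLt r (n + k) (pi j z p1 * pi j z (m' * s' * s * q)) := by
            rw [← map_mul]; simpa only [mul_assoc] using h3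
          have h5 := h4.insert (hI.pr _ _ hl)
          rw [← map_mul, ← map_mul] at h5
          simpa only [mul_assoc] using h5

theorem Asm.delete {n : ℕ} {w : Mw A} (h : Asm I n w) :
    ∀ p q, w = p * y * y * q → Asm I n (p * q) ∨ PrLt r n (pi j z (p * q)) := by
  induction h with
  | one =>
    intro p q h
    have := congrArg cnt h
    simp at this
    omega
  | ins n k p1 q1 l h0 hl ih =>
    intro p q h
    have both : ∀ a b c d, p1 * q1 = a * y * y * d → a * d = b * c → b * l * c = p * q →
        Asm I (n + k) (p * q) ∨ PrLt r (n + k) (pi j z (p * q)) := by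
      intro a b c d e1 e2 e3
      rcases ih a d e1 with h3 | h3
      · left; rw [← e3]; exact Asm.ins _ _ b c l (e2 ▸ h3) hl
      · right
        rw [e2, map_mul] at h3
        have := h3.insert (hI.pr _ _ hl)
        rw [← map_mul, ← map_mul] at this
        rwa [← e3]
    have sub : ∀ a s s' d, p1 * q1 = a * y * d → l = s * y * s' → a * s' * s * d = p * q →
        Asm I (n + k) (p * q) ∨ PrLt r (n + k) (pi j z (p * q)) := by
      intro a s s' d e1 e2 e3
      have := Asm.subst hI (e2 ▸ hl) h0 a d e1
      rwa [e3] at this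
    have hpos := hI.pos _ _ hl
    have h' : p * y * (y * q) = p1 * (l * q1) := by simp only [mul_assoc] at h ⊢; exact h.symm
    rcases split h' with ⟨m, rfl, h2⟩ | ⟨m, rfl, h2⟩
    · have hs' : 1 * y * q = m * (l * q1) := by rw [one_mul]; exact h2
      rcases split hs' with ⟨m', rfl, rfl⟩ | ⟨m', h3, h4⟩
      · exact both p (p * m') q1 (m' * q1) (by simp only [mul_assoc, one_mul])
          (by simp only [mul_assoc]) (by simp only [mul_assoc])
      · rcases split h4.symm with ⟨k', rfl, rfl⟩ | ⟨k', rfl, _⟩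
        · refine sub p m' k' (m * q1) (by simp only [mul_assoc]) rfl ?_
          have := mul_comm_one h3.symm
          rw [mul_assoc _ m', ← mul_assoc m', this, one_mul, mul_assoc]
        · have := congrArg cnt h3
          simp at this; omega
    · rcases split h2.symm with ⟨k', rfl, h3⟩ | ⟨k', rfl, rfl⟩
      · have hs' : 1 * y * q = k' * q1 := by rw [one_mul]; exact h3
        rcases split hs' with ⟨m', rfl, rfl⟩ | ⟨m', h4, rfl⟩
        · have e : m * y * (1 * y * m') = m * y * y * m' := by simp only [mul_assoc, one_mul]
          rw [e] at hl
          rcases hI.fold _ _ _ hl with h5 | ⟨rfl, h5⟩ | h5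
          · left
            have := Asm.ins _ _ p1 q1 _ h0 h5
            simpa only [mul_assoc] using this
          · left
            rw [show p1 * m * (m' * q1) = p1 * (m * m') * q1 by simp only [mul_assoc], h5, mul_one]
            exact h0
          · right
            have h4 := Asm.pr hI h0
            rw [map_mul] at h4
            have h6 := h4.insert_lt h5
            rw [← map_mul, ← map_mul] at h6
            simpa only [mul_assoc] using h6
        · refine sub (p1 * m') m k' q (by simp only [mul_assoc]) rfl ?_
          have := mul_comm_one h4.symm
          rw [mul_assoc p1, this, mul_one]
      · exact both (p1 * k') p1 (k' * q) q (by simp only [mul_assoc]) (by simp only [mul_assoc])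
          (by simp only [mul_assoc])

theorem Asm.nil_eq {n : ℕ} {g : A} (h : Asm I n (Mw.nil g)) : g = 1 := by
  generalize hw : Mw.nil g = w at h
  cases h with
  | one => rw [one_def, Mw.nil.injEq] at hw; exact hw
  | ins n k p q l _ hl =>
    have := congrArg cnt hw
    simp at this
    have := hI.pos _ _ hl
    omega

theorem Asm.hairs (hh : I 0 (y * y)) (hz : z * z = 1) {n : ℕ} (u : Mw A) :
    ∃ u', pi j z u * pi j z u' = 1 ∧ ∀ p q, Asm I n (p * q) → Asm I n (p * u * (u' * q)) := by
  induction u with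
  | nil g =>
    refine ⟨Mw.nil g⁻¹, by simp [← map_mul], fun p q h => ?_⟩
    have : p * Mw.nil g * (Mw.nil g⁻¹ * q) = p * q := by
      rw [mul_assoc, ← mul_assoc (Mw.nil g), nil_nil, mul_inv_cancel, ← one_def, one_mul]
    rwa [this]
  | cons g m ih =>
    obtain ⟨u', h1, h2⟩ := ih
    refine ⟨u' * y * Mw.nil g⁻¹, ?_, fun p q h => ?_⟩
    · rw [cons_eq]
      simp only [map_mul, pi_nil, pi_y]
      calc _ = j g * (z * (pi j z m * pi j z u') * z) * j g⁻¹ := by group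
        _ = 1 := by rw [h1, mul_one, hz]; simp [← map_mul]
    · have e : p * Mw.nil g * (Mw.nil g⁻¹ * q) = p * q := by
        rw [mul_assoc, ← mul_assoc (Mw.nil g), nil_nil, mul_inv_cancel, ← one_def, one_mul]
      have h3 := Asm.ins _ _ (p * Mw.nil g) (Mw.nil g⁻¹ * q) _ (by rwa [e]) hh
      have h4 := h2 (p * Mw.nil g * y) (y * (Mw.nil g⁻¹ * q)) (by
        simpa only [mul_assoc, add_zero] using h3)
      rw [cons_eq]
      simpa only [mul_assoc] using h4

theorem Asm.of_pr (hh : I 0 (y * y)) (hz : z * z = 1) {l0 : Mw A} (hl : I 1 l0)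
    (hl0 : pi j z l0 = r) (hsurj : Surjective (pi j z)) {n : ℕ} {t : P} (h : Pr r n t) :
    ∃ w, Asm I n w ∧ pi j z w = t := by
  induction h with
  | zero => exact ⟨1, .one, by simp⟩
  | succ n t g _ ih =>
    obtain ⟨w, h1, h2⟩ := ih
    obtain ⟨u, rfl⟩ := hsurj g
    obtain ⟨u', h3, h4⟩ := Asm.hairs hI hh hz (n := n) u
    have h5 := h4 1 w (by rwa [one_mul])
    refine ⟨_, Asm.ins _ _ _ _ _ h5 hl, ?_⟩
    rw [eq_comm, ← mul_eq_one_iff_eq_inv.1 (mul_eq_one_comm.1 h3)]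
    simp [hl0, h2, mul_assoc]

/-- The abstract form of the weight test. -/
theorem Pieces.main (hh : I 0 (y * y)) (hz : z * z = 1) {l0 : Mw A} (hl : I 1 l0)
    (hl0 : pi j z l0 = r) (hsurj : Surjective (pi j z)) (hj : Injective j)
    (hnf : ∀ w : Mw A, pi j z w ∈ j.range → 0 < cnt w → ∃ p q, w = p * y * y * q)
    {n : ℕ} {g : A} (h : Pr r n (j g)) : g = 1 := by
  induction n using Nat.strong_induction_on with
  | _ n ih =>
    obtain ⟨w, hw, hw2⟩ := Asm.of_pr hI hh hz hl hl0 hsurj h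
    have key : ∀ N (w : Mw A), cnt w ≤ N → Asm I n w → pi j z w = j g → g = 1 := by
      intro N
      induction N with
      | zero =>
        intro w hN hw hw2
        obtain ⟨g', rfl⟩ := eq_nil_of_cnt (a := w) (by omega)
        have := Asm.nil_eq hI hw
        rw [pi_nil] at hw2
        rw [← hj hw2, this]
      | succ N ihN =>
        intro w hN hw hw2
        by_cases hc : cnt w = 0
        · exact ihN w (by omega) hw hw2
        · obtain ⟨p, q, rfl⟩ := hnf w ⟨g, hw2.symm⟩ (by omega)
          have e : pi j z (p * q) = j g := by
            rw [← hw2]; simp only [map_mul, pi_y]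
            rw [mul_assoc (pi j z p) z z, hz, mul_one]
          rcases Asm.delete hI hw p q rfl with h3 | ⟨k, hk, h3⟩
          · exact ihN _ (by simp at hN ⊢; omega) h3 e
          · rw [e] at h3; exact ih k hk h3
    exact key _ w le_rfl hw hw2

end

end P59


namespace P59
open Function

universe u v w

/-! ### Concrete discs -/

/-- Boundary tokens of a disc made of triangles: sides and corners. -/
inductive Tok : Type
  | S : Fin 3 → Tok
  | C : Fin 3 → Tok

/-- Allowed adjacency of boundary tokens. -/
def Tok.R : Tok → Tok → Prop
  | S i, C j => j = i + 1
  | C j, S i => j = i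
  | C i, C j => i + j ≠ 0
  | S _, S _ => False

/-- The combinatorial curvature weight of a token. -/
def Tok.wt (θ : Fin 3 → ℤ) : Tok → ℤ
  | S _ => 6
  | C i => - θ i

open Tok

theorem wt_corners (θ : Fin 3 → ℤ) (u : List (Fin 3)) :
    ((u.map C).map (Tok.wt θ)).sum = - (u.map θ).sum := by
  induction u with
  | nil => rfl
  | cons c u ih =>
    simp only [List.map_cons, List.sum_cons, ih, Tok.wt]
    ring

section
variable {A : Type u} [Group A] {P : Type v} [Group P]

/-- The slot word of a token. -/
def tv (cv : Fin 3 → A) : Tok → Mw A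
  | S _ => Mw.y
  | C i => Mw.nil (cv i)

/-- The slot word of a token list. -/
def tval (cv : Fin 3 → A) (l : List Tok) : Mw A := (l.map (tv cv)).prod

/-- The value of a token list. -/
def pv (cv : Fin 3 → A) (j : A →* P) (z : P) (l : List Tok) : P := Mw.pi j z (tval cv l)

variable {cv : Fin 3 → A} {j : A →* P} {z : P}

@[simp] theorem tval_nil : tval cv [] = 1 := rfl
@[simp] theorem tval_cons (t : Tok) (l : List Tok) : tval cv (t :: l) = tv cv t * tval cv l := by
  simp [tval]
@[simp] theorem tval_append (k l : List Tok) : tval cv (k ++ l) = tval cv k * tval cv l := by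
  simp [tval]
@[simp] theorem pv_nil : pv cv j z [] = 1 := by simp [pv]
@[simp] theorem pv_S (i : Fin 3) (l : List Tok) : pv cv j z (S i :: l) = z * pv cv j z l := by
  simp [pv, tv]
@[simp] theorem pv_C (i : Fin 3) (l : List Tok) :
    pv cv j z (C i :: l) = j (cv i) * pv cv j z l := by
  simp [pv, tv]
@[simp] theorem pv_append (k l : List Tok) : pv cv j z (k ++ l) = pv cv j z k * pv cv j z l := by
  simp [pv]

theorem tval_split {l : List Tok} : ∀ {m m' : Mw A}, tval cv l = m * Mw.y * m' →
    ∃ l1 i l2, l = l1 ++ S i :: l2 ∧ tval cv l1 = m ∧ tval cv l2 = m' := by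
  induction l with
  | nil =>
    intro m m' h
    have := congrArg Mw.cnt h
    simp at this
    omega
  | cons t l ih =>
    intro m m' h
    rw [tval_cons] at h
    cases t with
    | C c =>
      have h2 : tval cv l = (Mw.nil (cv c)⁻¹ * m) * Mw.y * m' := by
        rw [mul_assoc, mul_assoc, ← mul_assoc m, ← h, ← mul_assoc]
        simp [tv, ← Mw.one_def]
      obtain ⟨l1, i, l2, rfl, h3, h4⟩ := ih h2
      refine ⟨C c :: l1, i, l2, rfl, ?_, h4⟩
      rw [tval_cons, h3, ← mul_assoc]
      simp [tv, ← Mw.one_def]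
    | S i =>
      have e : tv cv (S i) * tval cv l = Mw.cons 1 (tval cv l) := by
        rw [Mw.cons_eq, ← Mw.one_def, one_mul]; rfl
      rw [e] at h
      cases m with
      | nil g =>
        rw [← Mw.cons_eq, Mw.cons.injEq] at h
        exact ⟨[], i, l, rfl, by rw [← h.1]; rfl, h.2⟩
      | cons g m2 =>
        simp only [Mw.cons_mul, Mw.cons.injEq] at h
        obtain ⟨l1, i', l2, rfl, h3, h4⟩ := ih h.2
        refine ⟨S i :: l1, i', l2, rfl, ?_, h4⟩
        rw [tval_cons, h3, ← h.1, Mw.cons_eq, ← Mw.one_def, one_mul]; rfl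

theorem corners_of_cnt {l : List Tok} (h : Mw.cnt (tval cv l) = 0) :
    ∃ u : List (Fin 3), l = u.map C := by
  induction l with
  | nil => exact ⟨[], rfl⟩
  | cons t l ih =>
    rw [tval_cons, Mw.cnt_mul] at h
    obtain ⟨u, rfl⟩ := ih (by omega)
    cases t with
    | C c => exact ⟨c :: u, rfl⟩
    | S i => simp [tv] at h

theorem tval_corners (u : List (Fin 3)) :
    tval cv (u.map C) = Mw.nil (u.map cv).prod := by
  induction u with
  | nil => rfl
  | cons c u ih => simp [ih, tv]

/-- Cyclic chains. -/
def CycChain {α : Type*} (R : α → α → Prop) (l : List α) : Prop :=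
  l.IsChain R ∧ ∀ s ∈ l.getLast?, ∀ t ∈ l.head?, R s t

theorem CycChain.rot {α : Type*} {R : α → α → Prop} {k l : List α} (h : CycChain R (k ++ l)) :
    CycChain R (l ++ k) := by
  obtain ⟨h1, h2⟩ := h
  rw [List.isChain_append] at h1
  obtain ⟨h3, h4, h5⟩ := h1
  refine ⟨List.isChain_append.2 ⟨h4, h3, ?_⟩, ?_⟩
  · intro s hs t ht
    apply h2
    · rw [List.getLast?_append]; rw [Option.mem_def] at *; rw [hs]; rfl
    · rw [List.head?_append]; rw [Option.mem_def] at *; rw [ht]; rfl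
  · intro s hs t ht
    rw [List.getLast?_append, Option.mem_def] at hs
    rw [List.head?_append, Option.mem_def] at ht
    cases hk : k.getLast? with
    | none =>
      rw [List.getLast?_eq_none_iff] at hk
      subst hk
      simp at hs ht h2
      exact h2 _ hs _ ht
    | some s' =>
      cases hl : l.head? with
      | none =>
        rw [List.head?_eq_none_iff] at hl
        subst hl
        simp at hs ht h2
        exact h2 _ hs _ ht
      | some t' =>
        rw [hk] at hs; rw [hl] at ht
        simp at hs ht
        subst hs ht
        exact h5 _ hk _ hl

theorem isRotated_cons {α : Type*} {t : α} {w l : List α} (h : (t :: w) ~r l) :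
    ∃ p q, l = p ++ t :: q ∧ w = q ++ p := by
  obtain ⟨n, rfl⟩ := h
  rw [List.rotate_eq_drop_append_take_mod]
  set m := n % (t :: w).length
  rcases m with _ | m
  · exact ⟨[], w, by simp, by simp⟩
  · exact ⟨w.drop m, w.take m, by simp, by simp⟩

theorem mid_split {α : Type*} {t : α} {p q k l : List α} (h : p ++ t :: q = k ++ l) :
    (∃ m, k = p ++ t :: m ∧ q = m ++ l) ∨ (∃ m, p = k ++ m ∧ l = m ++ t :: q) := by
  rcases List.append_eq_append_iff.1 h with ⟨m, h1, h2⟩ | ⟨m, h1, h2⟩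
  · cases m with
    | nil => right; exact ⟨[], by simpa using h1.symm, by simpa using h2.symm⟩
    | cons s m =>
      simp at h2
      obtain ⟨rfl, rfl⟩ := h2
      left; exact ⟨m, h1, rfl⟩
  · right; exact ⟨m, h1, h2⟩

theorem CycChain.of_isRotated {α : Type*} {R : α → α → Prop} {k l : List α}
    (h : CycChain R k) (hr : k ~r l) : CycChain R l := by
  obtain ⟨n, rfl⟩ := hr
  rw [List.rotate_eq_drop_append_take_mod]
  apply CycChain.rot
  rwa [List.take_append_drop]

/-- Data common to all discs. -/
structure Setup (r : P) (j : A →* P) (z : P) (cv : Fin 3 → A) (θ : Fin 3 → ℤ)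
    (e : Fin 3 → P) : Prop where
  zz : z * z = 1
  e1 : ∀ i, e i * (j (cv (i + 1)) * z * j (cv (i + 2)) * z * j (cv i)) = 1
  ee : ∀ i k, i + k = 2 → e i * e k = 1
  c0 : cv 0 ≠ 1
  rr : z * j (cv 1) * z * j (cv 2) * z * j (cv 0) = r
  hθ : θ 0 + θ 1 + θ 2 = 6
  W1 : ∀ u : List (Fin 3), u ≠ [] → CycChain (fun i k => i + k ≠ 0) u →
    (u.map cv).prod = 1 → 12 ≤ (u.map θ).sum
  W2 : ∀ u : List (Fin 3), CycChain (fun i k => i + k ≠ 0) u → -12 < (u.map θ).sum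
  W3 : ∀ u : List (Fin 3), u.IsChain (fun i k => i + k ≠ 0) → u.head? = some 1 →
    u.getLast? = some 2 → 0 < (u.map θ).sum + θ 0

/-- Boundary words of good discs with `n` triangles. -/
structure Good (r : P) (j : A →* P) (z : P) (cv : Fin 3 → A) (θ : Fin 3 → ℤ)
    (e : Fin 3 → P) (n : ℕ) (l : List Tok) : Prop where
  pr : Pr r n (pv cv j z l)
  d1 : ∀ i u, (S i :: u) ~r l → PrLt r n (e i * pv cv j z u)
  d2 : ∀ i u k v, (S i :: (u ++ S k :: v)) ~r l →
    PrLt r n (e i * pv cv j z u * e k * pv cv j z v) ∨ (u = [C (i + 1)] ∧ k = i + 1) ∨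
      (v = [C i] ∧ i = k + 1)
  cc : CycChain Tok.R l
  J : 12 ≤ (l.map (Tok.wt θ)).sum

variable {r : P} {θ : Fin 3 → ℤ} {e : Fin 3 → P}

theorem Pr.of_rot {n : ℕ} {k l : List Tok} (h : Pr r n (pv cv j z k)) (hr : k ~r l) :
    Pr r n (pv cv j z l) := by
  obtain ⟨m, rfl⟩ := hr
  rw [List.rotate_eq_drop_append_take_mod, pv_append]
  apply Pr.rot
  rwa [← pv_append, List.take_append_drop]

theorem Good.rot {n : ℕ} {k l : List Tok} (h : Good r j z cv θ e n k) (hr : k ~r l) :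
    Good r j z cv θ e n l where
  pr := h.pr.of_rot hr
  d1 i u hu := h.d1 i u (hu.trans hr.symm)
  d2 i u m v hu := h.d2 i u m v (hu.trans hr.symm)
  cc := h.cc.of_isRotated hr
  J := by
    have : (l.map (Tok.wt θ)).sum = (k.map (Tok.wt θ)).sum :=
      ((hr.perm.map _).sum_eq).symm
    rw [this]; exact h.J

theorem rot_swap {α : Type*} (k l : List α) : (k ++ l) ~r (l ++ k) := List.isRotated_append

/-- The shape of a side token inside a good boundary. -/
theorem cc_side {i : Fin 3} {l : List Tok} (h : CycChain Tok.R (S i :: l)) :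
    ∃ m, (l = C (i + 1) :: m) ∧ l.getLast? = some (C i) ∧ l.IsChain Tok.R := by
  obtain ⟨h1, h2⟩ := h
  cases l with
  | nil =>
    exact (h2 (S i) (by simp) (S i) (by simp)).elim
  | cons t m =>
    rw [List.isChain_cons_cons] at h1
    have h3 := h1.1
    cases t with
    | S k => exact h3.elim
    | C k =>
      refine ⟨m, by rw [show k = i + 1 from h3], ?_, h1.2⟩
      rw [List.getLast?_cons_cons] at h2
      cases hg : (C k :: m).getLast? with
      | none => simp at hg
      | some s =>
        rw [hg] at h2
        have h4 := h2 s rfl (S i) rfl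
        cases s with
        | S _ => exact h4.elim
        | C k' => rw [show k' = i from h4]

theorem cc_glue {i k : Fin 3} {l1 l2 : List Tok} (h1 : CycChain Tok.R (S i :: l1))
    (h2 : CycChain Tok.R (S k :: l2)) (hik : i + k ≠ 2) : CycChain Tok.R (l1 ++ l2) := by
  obtain ⟨m1, e1, g1, c1⟩ := cc_side h1
  obtain ⟨m2, e2, g2, c2⟩ := cc_side h2
  have f1 : i + (k + 1) ≠ 0 := by clear * - hik; revert i k; decide
  have f2 : k + (i + 1) ≠ 0 := by clear * - hik; revert i k; decide
  refine ⟨List.isChain_append.2 ⟨c1, c2, ?_⟩, ?_⟩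
  · intro s hs t ht
    rw [g1] at hs; rw [e2] at ht
    simp at hs ht
    subst hs ht
    exact f1
  · intro s hs t ht
    rw [List.getLast?_append, g2] at hs; rw [e1] at ht
    simp at hs ht
    subst hs ht
    exact f2

theorem cc_fold {i k : Fin 3} {u l : List Tok} (h1 : CycChain Tok.R (S i :: (u ++ S k :: l)))
    (hik : i + k ≠ 2) : CycChain Tok.R l := by
  have h2 : CycChain Tok.R (S k :: (l ++ S i :: u)) := by
    have := CycChain.rot (k := S i :: u) (l := S k :: l) (by simpa using h1)
    simpa using this
  obtain ⟨m1, e1, g1, c1⟩ := cc_side h1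
  obtain ⟨m2, e2, g2, c2⟩ := cc_side h2
  have hl : l ≠ [] := by
    rintro rfl
    simp at e2
  have f1 : i + (k + 1) ≠ 0 := by clear * - hik; revert i k; decide
  refine ⟨(List.isChain_append.1 c2).1, ?_⟩
  intro s hs t ht
  obtain ⟨b, l', rfl⟩ := List.exists_cons_of_ne_nil hl
  rw [List.getLast?_append, List.getLast?_cons_cons] at g1
  simp at e2 ht
  rw [Option.mem_def] at hs
  rw [hs] at g1
  simp at g1
  subst ht
  rw [e2.1, g1]
  exact f1

variable (H : Setup r j z cv θ e)
include H

theorem pos_of_good {n : ℕ} {l : List Tok} (h : Good r j z cv θ e n l) :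
    0 < Mw.cnt (tval cv l) := by
  by_contra hc
  obtain ⟨u, rfl⟩ := corners_of_cnt (cv := cv) (l := l) (by omega)
  have h1 := h.J
  have h2 := H.W2 u (by
    obtain ⟨h3, h4⟩ := h.cc
    refine ⟨(List.isChain_map C).1 h3, ?_⟩
    intro s hs t ht
    exact h4 (C s) (by simp at hs; simp [hs]) (C t) (by simp at ht; simp [ht]))
  have h3 := wt_corners θ u
  omega

theorem glue_d1 {n1 n2 : ℕ} {i : Fin 3} {l1 l2 : List Tok}
    (h1 : Good r j z cv θ e n1 (S i :: l1)) (h2 : Pr r n2 (z * pv cv j z l2))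
    {k : Fin 3} {p q : List Tok} (hl : l1 = p ++ S k :: q) :
    PrLt r (n1 + n2) (e k * pv cv j z (q ++ l2 ++ p)) := by
  have h3 := h1.d1 k (q ++ S i :: p) (by
    rw [hl]
    have := rot_swap (S k :: q) (S i :: p)
    simpa using this)
  have h4 : PrLt r n1 ((e k * pv cv j z q * z) * pv cv j z p) := by
    simpa [mul_assoc] using h3
  have h5 := h4.insert h2
  convert h5 using 1
  simp only [pv_append]
  rw [show e k * pv cv j z q * z * (z * pv cv j z l2) = e k * pv cv j z q * (z * z) * pv cv j z l2
    by simp only [mul_assoc], H.zz]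
  simp only [mul_assoc, mul_one]

/-- `d2` for two sides on the same part. -/
theorem glue_d2_same {n1 n2 : ℕ} {i : Fin 3} {l1 l2 : List Tok}
    (h1 : Good r j z cv θ e n1 (S i :: l1)) (h2 : Pr r n2 (z * pv cv j z l2))
    {k l : Fin 3} {p m q : List Tok} (hl : l1 = p ++ S k :: (m ++ S l :: q)) :
    PrLt r (n1 + n2) (e k * pv cv j z m * e l * pv cv j z (q ++ l2 ++ p)) ∨
      (m = [C (k + 1)] ∧ l = k + 1) := by
  have h3 := h1.d2 k m l (q ++ S i :: p) (by
    rw [hl]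
    have := rot_swap (S k :: (m ++ S l :: q)) (S i :: p)
    simpa using this)
  rcases h3 with h3 | h3 | ⟨h3, _⟩
  · left
    have h4 : PrLt r n1 ((e k * pv cv j z m * e l * pv cv j z q * z) * pv cv j z p) := by
      simpa [mul_assoc] using h3
    have h5 := h4.insert h2
    convert h5 using 1
    simp only [pv_append]
    rw [show e k * pv cv j z m * e l * pv cv j z q * z * (z * pv cv j z l2) =
      e k * pv cv j z m * e l * pv cv j z q * (z * z) * pv cv j z l2
      by simp only [mul_assoc], H.zz]
    simp only [mul_assoc, mul_one]
  · right; exact h3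
  · exfalso
    cases q with
    | nil => simp at h3
    | cons a q => simp at h3

theorem PrLt.swap {n : ℕ} {i k : Fin 3} {u v : List Tok}
    (h : PrLt r n (e i * pv cv j z u * e k * pv cv j z v)) :
    PrLt r n (e k * pv cv j z v * e i * pv cv j z u) := by
  rw [mul_assoc, mul_assoc] at h
  rw [mul_assoc (e k * _)]
  apply PrLt.rot
  simpa only [mul_assoc] using h

theorem glue_d2 {n1 n2 : ℕ} {i i' : Fin 3} {l1 l2 : List Tok}
    (h1 : Good r j z cv θ e n1 (S i :: l1)) (h2 : Good r j z cv θ e n2 (S i' :: l2))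
    {k l : Fin 3} {p q u v : List Tok} (hl : l1 = p ++ S k :: q)
    (huv : u ++ S l :: v = q ++ l2 ++ p) :
    PrLt r (n1 + n2) (e k * pv cv j z u * e l * pv cv j z v) ∨ (u = [C (k + 1)] ∧ l = k + 1) ∨
      (v = [C k] ∧ k = l + 1) := by
  have p2 : Pr r n2 (z * pv cv j z l2) := by simpa using h2.pr
  rw [List.append_assoc] at huv
  rcases mid_split huv with ⟨m, rfl, rfl⟩ | ⟨m, rfl, h3⟩
  · rcases glue_d2_same H h1 p2 hl with h4 | h4
    · left; simpa using h4
    · right; left; exact h4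
  · rcases mid_split h3.symm with ⟨m', rfl, rfl⟩ | ⟨m', rfl, rfl⟩
    · left
      -- sides on different parts
      have h4 := h1.d1 k (q ++ S i :: p) (by
        rw [hl]
        have := rot_swap (S k :: q) (S i :: p)
        simpa using this)
      have h5 := h2.d1 l (m' ++ S i' :: m) (by
        have := rot_swap (S l :: m') (S i' :: m)
        simpa using this)
      obtain ⟨a, ha, h4⟩ := h4
      obtain ⟨b, hb, h5⟩ := h5
      refine ⟨a + b, by omega, ?_⟩
      have h6 : Pr r b ((z * pv cv j z m) * (e l * pv cv j z m')) := by
        have : Pr r b ((e l * pv cv j z m') * (z * pv cv j z m)) := by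
          simpa [mul_assoc] using h5
        exact this.rot
      have h7 : Pr r a ((e k * pv cv j z q * z) * pv cv j z p) := by
        simpa [mul_assoc] using h4
      have h8 := h7.insert h6
      convert h8 using 1
      simp only [pv_append]
      rw [show e k * pv cv j z q * z * (z * pv cv j z m * (e l * pv cv j z m')) =
        e k * pv cv j z q * (z * z) * pv cv j z m * (e l * pv cv j z m')
        by simp only [mul_assoc], H.zz]
      simp only [mul_assoc, mul_one]
    · -- l occurs in p
      have hl' : l1 = m' ++ S l :: (v ++ S k :: q) := by rw [hl]; simp
      rcases glue_d2_same H h1 p2 hl' with h4 | h4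
      · left
        have := PrLt.swap H h4
        simpa [mul_assoc] using this
      · right; right
        obtain ⟨rfl, rfl⟩ := h4
        exact ⟨rfl, rfl⟩

theorem good_glue {n1 n2 : ℕ} {i i' : Fin 3} {l1 l2 : List Tok}
    (h1 : Good r j z cv θ e n1 (S i :: l1)) (h2 : Good r j z cv θ e n2 (S i' :: l2))
    (hii : i + i' ≠ 2) : Good r j z cv θ e (n1 + n2) (l1 ++ l2) where
  pr := by
    have a1 : Pr r n1 (pv cv j z l1 * z) := by
      have : Pr r n1 (z * pv cv j z l1) := by simpa using h1.pr
      exact this.rot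
    have a2 : Pr r n2 (z * pv cv j z l2) := by simpa using h2.pr
    have := a1.mul a2
    rw [mul_assoc, ← mul_assoc z, H.zz, one_mul] at this
    rwa [pv_append]
  d1 k w hw := by
    obtain ⟨p, q, h3, rfl⟩ := isRotated_cons hw
    rcases mid_split h3.symm with ⟨m, h4, rfl⟩ | ⟨m, rfl, h4⟩
    · have := glue_d1 H h1 (by simpa using h2.pr) h4
      simpa using this
    · have := glue_d1 H h2 (by simpa using h1.pr) h4
      rw [Nat.add_comm]
      simpa using this
  d2 k u l v hw := by
    obtain ⟨p, q, h3, h3'⟩ := isRotated_cons hw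
    rcases mid_split h3.symm with ⟨m, h4, rfl⟩ | ⟨m, rfl, h4⟩
    · exact glue_d2 H h1 h2 h4 (by simpa using h3')
    · rw [Nat.add_comm]
      exact glue_d2 H h2 h1 h4 (by simpa using h3')
  cc := cc_glue h1.cc h2.cc hii
  J := by
    have a1 := h1.J
    have a2 := h2.J
    simp [Tok.wt] at a1 a2 ⊢
    linarith

theorem good_fold {n : ℕ} {i i' : Fin 3} {u : List (Fin 3)} {l : List Tok}
    (h1 : Good r j z cv θ e n (S i :: (u.map C ++ S i' :: l))) (hu : (u.map cv).prod = 1)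
    (hii : i + i' ≠ 2) : Good r j z cv θ e n l where
  pr := by
    have := h1.pr
    simp only [pv_S, pv_append] at this
    rw [pv, tval_corners, hu] at this
    simpa [← mul_assoc, H.zz] using this
  d1 k w hw := by
    obtain ⟨p, q, rfl, rfl⟩ := isRotated_cons hw
    have h3 := h1.d1 k (q ++ S i :: (u.map C ++ S i' :: p)) (by
      have := rot_swap (S k :: q) (S i :: (u.map C ++ S i' :: p))
      simpa using this)
    simp only [pv_S, pv_append] at h3
    rw [pv, pv, tval_corners, hu] at h3
    simp only [Mw.pi_nil, map_one, one_mul] at h3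
    rw [← mul_assoc z z, H.zz, one_mul] at h3
    simpa [pv] using h3
  d2 k m l' v hw := by
    obtain ⟨p, q, rfl, h2⟩ := isRotated_cons hw
    have hz : pv cv j z (S i :: (u.map C ++ [S i'])) = 1 := by
      simp only [pv_S, pv_append]
      rw [pv, tval_corners, hu]
      simp [H.zz]
    have hr : ∀ s, (S k :: q ++ (S i :: (u.map C ++ S i' :: s))) ~r
        (S i :: (u.map C ++ S i' :: (s ++ S k :: q))) := by
      intro s
      have := rot_swap (S k :: q) (S i :: (u.map C ++ S i' :: s))
      simpa using this
    rcases mid_split h2 with ⟨m', rfl, rfl⟩ | ⟨m', rfl, rfl⟩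
    · have h3 := h1.d2 k m l' (m' ++ (S i :: (u.map C ++ [S i']) ++ p)) (by simpa using hr p)
      rcases h3 with h3 | h3 | ⟨h3, _⟩
      · left
        simp only [pv_append, hz, one_mul] at h3 ⊢
        simpa only [mul_assoc] using h3
      · right; left; exact h3
      · exfalso
        cases m' with
        | nil => simp at h3
        | cons a q => simp at h3
    · have h3 := h1.d2 k (q ++ (S i :: (u.map C ++ [S i']) ++ m')) l' v (by
        simpa using hr (m' ++ S l' :: v))
      rcases h3 with h3 | ⟨h3, _⟩ | h3
      · left
        simp only [pv_append, hz, one_mul] at h3 ⊢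
        simpa only [mul_assoc] using h3
      · exfalso
        cases q with
        | nil => simp at h3
        | cons a q => simp at h3
      · right; right; exact h3
  cc := cc_fold h1.cc hii
  J := by
    have a1 := h1.J
    obtain ⟨m, f1, f2, f3⟩ := cc_side h1.cc
    have h2 : CycChain Tok.R (S i' :: (l ++ S i :: u.map C)) :=
      h1.cc.of_isRotated (by
        have := rot_swap (S i :: u.map C) (S i' :: l)
        simpa using this)
    obtain ⟨m', g1, g2, g3⟩ := cc_side h2
    have hne : u ≠ [] := by
      rintro rfl
      simp at f1
    obtain ⟨c, u', rfl⟩ := List.exists_cons_of_ne_nil hne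
    have hc : c = i + 1 := by
      simp at f1; exact f1.1
    have hlast : (c :: u').getLast? = some i' := by
      rw [List.getLast?_append, List.map_cons, List.getLast?_cons_cons, ← List.map_cons,
        List.getLast?_map] at g2
      cases hg : (c :: u').getLast? with
      | none => simp at hg
      | some t => rw [hg] at g2; simp at g2; rw [g2]
    have w1 := H.W1 (c :: u') hne ⟨(List.isChain_map C).1 (List.isChain_append.1 f3).1, by
      intro s hs t ht
      rw [hlast] at hs
      simp at hs ht
      subst hs ht
      rw [hc]
      clear * - hii
      revert i i'; decide⟩ hu
    have h3 := wt_corners θ (c :: u')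
    simp only [List.map_cons, List.map_append, List.sum_cons, List.sum_append, Tok.wt] at a1 h3 w1
    linarith

theorem dipole_fold {n : ℕ} {i i' : Fin 3} {u : List (Fin 3)} {l : List Tok}
    (h1 : Good r j z cv θ e n (S i :: (u.map C ++ S i' :: l))) (hu : (u.map cv).prod = 1)
    (hii : i + i' = 2) : PrLt r n (pv cv j z l) := by
  rcases h1.d2 i (u.map C) i' l (List.IsRotated.refl _) with h3 | ⟨h3, h4⟩ | ⟨h3, h4⟩
  · rw [pv, tval_corners, hu] at h3
    simpa [H.ee i i' hii] using h3
  · exfalso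
    have hi : i + 1 = 0 := by subst h4; clear * - hii; revert i; decide
    cases u with
    | nil => simp at h3
    | cons c u =>
      cases u with
      | cons d u => simp at h3
      | nil =>
        simp at h3 hu
        rw [h3, hi] at hu
        exact H.c0 hu
  · exfalso
    have hi : i = 0 := by subst h4; clear * - hii; revert i'; decide
    have hi' : i' = 2 := by subst h4; clear * - hii; revert i'; decide
    subst hi hi' h3
    obtain ⟨m, f1, f2, f3⟩ := cc_side h1.cc
    have h2 : CycChain Tok.R (S 2 :: ([C 0] ++ S 0 :: u.map C)) :=
      h1.cc.of_isRotated (by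
        have := rot_swap (S 0 :: u.map C) (S 2 :: [C 0])
        simpa using this)
    obtain ⟨m', g1, g2, g3⟩ := cc_side h2
    have hne : u ≠ [] := by
      rintro rfl
      simp at f1
    obtain ⟨c, u', rfl⟩ := List.exists_cons_of_ne_nil hne
    have hc : c = 1 := by
      simp at f1; exact f1.1
    have hlast : (c :: u').getLast? = some 2 := by
      rw [List.getLast?_append, List.map_cons, List.getLast?_cons_cons, ← List.map_cons,
        List.getLast?_map] at g2
      cases hg : (c :: u').getLast? with
      | none => simp at hg
      | some t => rw [hg] at g2; simp at g2; rw [g2]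
    have w3 := H.W3 (c :: u') ((List.isChain_map C).1 (List.isChain_append.1 f3).1)
      (by rw [hc]; rfl) hlast
    have h3 := wt_corners θ (c :: u')
    have a1 := h1.J
    simp only [List.map_cons, List.map_append, List.sum_cons, List.sum_append, Tok.wt,
      List.map_nil, List.sum_nil] at a1 h3 w3
    linarith

/-- The class of pieces. -/
def PieceI (r : P) (j : A →* P) (z : P) (cv : Fin 3 → A) (θ : Fin 3 → ℤ)
    (e : Fin 3 → P) (n : ℕ) (m : Mw A) : Prop :=
  (∃ l, Good r j z cv θ e n l ∧ tval cv l = m) ∨ (n = 0 ∧ m = Mw.y * Mw.y)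

omit H in
theorem yy_split {m m' : Mw A} (h : m * Mw.y * m' = Mw.y * Mw.y) :
    (m = 1 ∧ m' = Mw.y) ∨ (m = Mw.y ∧ m' = 1) := by
  have h' : 1 * Mw.y * Mw.y = m * Mw.y * m' := by rw [h, one_mul]
  have h0 : tval (fun _ => (1 : A)) [S 0, S 0] = m * Mw.y * m' := by
    rw [h]; simp [tv]
  obtain ⟨l1, i, l2, h1, rfl, rfl⟩ := tval_split h0
  rcases l1 with _ | ⟨a, l1⟩
  · simp at h1
    left
    rw [← h1.2]; simp [tv]
  · rcases l1 with _ | ⟨b, l1⟩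
    · simp at h1
      right
      rw [← h1.1, h1.2.2]; simp [tv]
    · simp at h1

theorem good_triangle : Good r j z cv θ e 1 [S 0, C 1, S 1, C 2, S 2, C 0] where
  pr := by
    have := Pr.succ (r := r) 0 1 1 .zero
    convert this using 1
    simp [← H.rr, mul_assoc]
  d1 i u hu := by
    refine ⟨0, by omega, ?_⟩
    have : e i * pv cv j z u = 1 := by
      obtain ⟨n, hn⟩ := hu.symm
      have hu' : S i :: u = [S 0, C 1, S 1, C 2, S 2, C 0].rotate (n % 6) := by
        rw [← hn]; exact (List.rotate_mod _ n).symm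
      have h6 : n % 6 < 6 := Nat.mod_lt _ (by omega)
      generalize n % 6 = t at hu' h6
      interval_cases t <;> simp at hu'
      · obtain ⟨rfl, rfl⟩ := hu'
        have := H.e1 0; simpa [mul_assoc] using this
      · obtain ⟨rfl, rfl⟩ := hu'
        have := H.e1 1; simpa [mul_assoc] using this
      · obtain ⟨rfl, rfl⟩ := hu'
        have := H.e1 2; simpa [mul_assoc] using this
    rw [this]; exact .zero
  d2 i u k v hu := by
    right
    obtain ⟨n, hn⟩ := hu.symm
    have hu' : S i :: (u ++ S k :: v) = [S 0, C 1, S 1, C 2, S 2, C 0].rotate (n % 6) := by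
      rw [← hn]; exact (List.rotate_mod _ n).symm
    have h6 : n % 6 < 6 := Nat.mod_lt _ (by omega)
    generalize n % 6 = t at hu' h6
    rcases u with _ | ⟨u1, _ | ⟨u2, _ | ⟨u3, _ | ⟨u4, _ | ⟨u5, u⟩⟩⟩⟩⟩ <;>
      interval_cases t <;> simp at hu' <;> simp_all
  cc := by
    simp [CycChain, Tok.R]
  J := by
    have := H.hθ
    simp [Tok.wt]
    linarith

theorem pieces : Pieces r j z (PieceI r j z cv θ e) where
  pr n m h := by
    rcases h with ⟨l, h, rfl⟩ | ⟨rfl, rfl⟩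
    · exact h.pr
    · rw [map_mul, Mw.pi_y, H.zz]; exact .zero
  pos n m h := by
    rcases h with ⟨l, h, rfl⟩ | ⟨rfl, rfl⟩
    · exact pos_of_good H h
    · simp
  fold n m t h := by
    rcases h with ⟨l, h, h2⟩ | ⟨rfl, h2⟩
    · rw [mul_assoc (m * Mw.y)] at h2
      obtain ⟨l1, i, l2, rfl, rfl, h3⟩ := tval_split h2
      have h3' : tval cv l2 = 1 * Mw.y * t := by rw [one_mul]; exact h3
      obtain ⟨u, i', l3, rfl, h4, rfl⟩ := tval_split h3'
      obtain ⟨u, rfl⟩ := corners_of_cnt (cv := cv) (l := u) (by rw [h4]; rfl)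
      have hu : (u.map cv).prod = 1 := by
        rw [tval_corners, Mw.one_def, Mw.nil.injEq] at h4; exact h4
      have h5 : Good r j z cv θ e n (S i :: (u.map C ++ S i' :: (l3 ++ l1))) :=
        h.rot (by
          have := rot_swap l1 (S i :: (u.map C ++ S i' :: l3))
          simpa using this)
      by_cases hii : i + i' = 2
      · right; right
        have := dipole_fold H h5 hu hii
        rw [pv_append] at this
        have := this.rot
        rw [← pv_append] at this
        simpa [pv] using this
      · left; left
        exact ⟨_, (good_fold H h5 hu hii).rot (rot_swap _ _), by simp⟩
    · right; left
      refine ⟨rfl, ?_⟩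
      rw [mul_assoc (m * Mw.y)] at h2
      rcases yy_split h2 with ⟨rfl, h3⟩ | ⟨rfl, h3⟩
      · have : Mw.cnt t = 0 := by
          have := congrArg Mw.cnt h3; simp at this; omega
        obtain ⟨g, rfl⟩ := Mw.eq_nil_of_cnt this
        simp [Mw.y] at h3
        rw [h3, one_mul]; rfl
      · have := congrArg Mw.cnt h3
        simp at this
  glue n1 n2 m m' s s' h1 h2 := by
    rcases h1 with ⟨l1, h1, g1⟩ | ⟨rfl, g1⟩
    · obtain ⟨p, i, q, rfl, rfl, rfl⟩ := tval_split g1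
      rcases h2 with ⟨l2, h2, g2⟩ | ⟨rfl, g2⟩
      · obtain ⟨p', i', q', rfl, rfl, rfl⟩ := tval_split g2
        have a1 : Good r j z cv θ e n1 (S i :: (q ++ p)) := h1.rot (by
          have := rot_swap p (S i :: q)
          simpa using this)
        have a2 : Good r j z cv θ e n2 (S i' :: (q' ++ p')) := h2.rot (by
          have := rot_swap p' (S i' :: q')
          simpa using this)
        by_cases hii : i + i' = 2
        · right
          obtain ⟨a, ha, b1⟩ := a1.d1 i _ (List.IsRotated.refl _)
          obtain ⟨b, hb, b2⟩ := a2.d1 i' _ (List.IsRotated.refl _)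
          refine ⟨a + b, by omega, ?_⟩
          have b3 := b1.rot.mul b2
          rw [mul_assoc, ← mul_assoc (e i), H.ee _ _ hii, one_mul, pv_append q, mul_assoc] at b3
          have b4 := b3.rot
          simpa [pv, mul_assoc] using b4
        · left; left
          refine ⟨_, (good_glue H a1 a2 hii).rot (l := p ++ (q' ++ p') ++ q) ?_, by
            simp [mul_assoc]⟩
          have := rot_swap q (p ++ (q' ++ p'))
          simpa using this
      · left; left
        rcases yy_split g2 with ⟨rfl, rfl⟩ | ⟨rfl, rfl⟩
        · exact ⟨_, h1, by simp [tv, mul_assoc]⟩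
        · exact ⟨_, h1, by simp [tv, mul_assoc]⟩
    · rcases h2 with ⟨l2, h2, g2⟩ | ⟨rfl, g2⟩
      · obtain ⟨p', i', q', rfl, rfl, rfl⟩ := tval_split g2
        left; left
        rw [Nat.zero_add]
        rcases yy_split g1 with ⟨rfl, rfl⟩ | ⟨rfl, rfl⟩
        · refine ⟨_, h2.rot (l := q' ++ (p' ++ [S i'])) ?_, by simp [tv, mul_assoc]⟩
          have := rot_swap (p' ++ [S i']) q'
          simpa using this
        · refine ⟨_, h2.rot (l := (S i' :: q') ++ p') ?_, by simp [tv, mul_assoc]⟩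
          have := rot_swap p' (S i' :: q')
          simpa using this
      · left; right
        refine ⟨rfl, ?_⟩
        rcases yy_split g1 with ⟨rfl, rfl⟩ | ⟨rfl, rfl⟩ <;>
        rcases yy_split g2 with ⟨rfl, rfl⟩ | ⟨rfl, rfl⟩ <;> simp

end

end P59


namespace P59
open Function

universe u v w

section
variable {A : Type u} [Group A]

/-- The group of order two. -/
abbrev Z2 : Type u := ULift.{u} (Multiplicative (ZMod 2))

/-- The generator. -/
def t2 : Z2.{u} := ULift.up (Multiplicative.ofAdd 1)

theorem t2_sq : t2.{u} * t2 = 1 := by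
  apply ULift.down_injective
  change (Multiplicative.ofAdd (1 : ZMod 2)) * Multiplicative.ofAdd 1 = 1
  decide

theorem t2_ne : t2.{u} ≠ 1 := by
  intro h
  have := congrArg ULift.down h
  change (Multiplicative.ofAdd (1 : ZMod 2)) = 1 at this
  revert this; decide

theorem z2_cases (s : Z2.{u}) : s = 1 ∨ s = t2 := by
  obtain ⟨s⟩ := s
  have : ∀ s : Multiplicative (ZMod 2), s = 1 ∨ s = Multiplicative.ofAdd 1 := by decide
  rcases this s with h | h
  · left; rw [h]; rfl
  · right; rw [h]; rfl

open Monoid in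
theorem nf_coprod : Injective (Coprod.inl : A →* Coprod A Z2.{u}) ∧
    Surjective (Mw.pi (Coprod.inl : A →* Coprod A Z2.{u}) (Coprod.inr t2)) ∧
    ∀ w : Mw A, Mw.pi (Coprod.inl : A →* Coprod A Z2.{u}) (Coprod.inr t2) w ∈
      (Coprod.inl : A →* Coprod A Z2.{u}).range → 0 < Mw.cnt w →
      ∃ p q, w = p * Mw.y * Mw.y * q := by
  obtain ⟨K, _, i1, i2, S1, S2, inj1, inj2, h1, h2, h3, h4, h5, h6, h7⟩ := free_prod A Z2.{u}
  let φ : Coprod A Z2.{u} →* K := Coprod.lift i1 i2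
  have key : ∀ w : Mw A, (∃ p q, w = p * Mw.y * Mw.y * q) ∨ (∃ g, w = Mw.nil g) ∨
      ∃ g m, w = Mw.cons g m ∧ i2 t2 * φ (Mw.pi Coprod.inl (Coprod.inr t2) m) ∈ S2 := by
    intro w
    induction w with
    | nil g => right; left; exact ⟨g, rfl⟩
    | cons g m ih =>
      rcases ih with ⟨p, q, rfl⟩ | ⟨g', rfl⟩ | ⟨g', m', rfl, h⟩
      · left
        exact ⟨Mw.cons g p, q, by simp⟩
      · right; right
        refine ⟨g, _, rfl, ?_⟩
        by_cases hg : g' = 1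
        · subst hg; simpa using h2 _ t2_ne
        · simpa [φ] using h4 _ t2_ne _ (h1 _ hg)
      · by_cases hg : g' = 1
        · left
          exact ⟨Mw.nil g, m', by subst hg; simp [Mw.y, ← Mw.one_def]⟩
        · right; right
          refine ⟨g, _, rfl, ?_⟩
          apply h4 _ t2_ne
          have := h3 _ hg _ h
          simpa [Mw.cons_eq, φ, mul_assoc] using this
  refine ⟨?_, ?_, ?_⟩
  · intro g h e
    apply inj1
    have := congrArg φ e
    simpa [φ] using this
  · intro s
    induction s using Coprod.induction_on with
    | inl g => exact ⟨Mw.nil g, by simp⟩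
    | inr t =>
      rcases z2_cases t with rfl | rfl
      · exact ⟨1, by simp⟩
      · exact ⟨Mw.y, by simp⟩
    | mul s t hs ht =>
      obtain ⟨a, rfl⟩ := hs
      obtain ⟨b, rfl⟩ := ht
      exact ⟨a * b, map_mul _ _ _⟩
  · rintro w ⟨g0, hg0⟩ hc
    rcases key w with h | ⟨g, rfl⟩ | ⟨g, m, rfl, h⟩
    · exact h
    · simp at hc
    · exfalso
      have e : i2 t2 * φ (Mw.pi Coprod.inl (Coprod.inr t2) m) = i1 (g⁻¹ * g0) := by
        have := congrArg φ hg0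
        simp [Mw.cons_eq, φ, mul_assoc] at this
        simp [this, φ]
      rw [e] at h
      by_cases hg : g⁻¹ * g0 = 1
      · rw [hg, map_one] at h; exact h6 h
      · exact h7 _ (h1 _ hg) h

open Monoid in
theorem thmW (x a : A) (hx : x * x = 1) (hx1 : x ≠ 1) (θ : Fin 3 → ℤ)
    (hθ : θ 0 + θ 1 + θ 2 = 6)
    (W1 : ∀ u : List (Fin 3), u ≠ [] → CycChain (fun i k => i + k ≠ 0) u →
      (u.map ![x, a, a⁻¹]).prod = 1 → 12 ≤ (u.map θ).sum)
    (W2 : ∀ u : List (Fin 3), CycChain (fun i k => i + k ≠ 0) u → -12 < (u.map θ).sum)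
    (W3 : ∀ u : List (Fin 3), u.IsChain (fun i k => i + k ≠ 0) → u.head? = some 1 →
      u.getLast? = some 2 → 0 < (u.map θ).sum + θ 0) :
    ∃ (K : Type u) (_ : Group K) (i : A →* K) (y : K), Injective i ∧ y * y = 1 ∧
      y * i x * y = i a * y * (i a)⁻¹ := by
  obtain ⟨hj, hs, hnf⟩ := nf_coprod (A := A)
  set j : A →* Coprod A Z2.{u} := Coprod.inl with hj'
  set z : Coprod A Z2.{u} := Coprod.inr t2 with hz'
  have hz : z * z = 1 := by rw [hz', ← map_mul, t2_sq, map_one]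
  have hzi : z⁻¹ = z := inv_eq_of_mul_eq_one_left hz
  have hxi : (j x)⁻¹ = j x := inv_eq_of_mul_eq_one_left (by rw [← map_mul, hx, map_one])
  have hzc : ∀ g, z * (z * g) = g := fun g => by rw [← mul_assoc, hz, one_mul]
  have hxx : j x * j x = 1 := by rw [← map_mul, hx, map_one]
  have hxc : ∀ g, j x * (j x * g) = g := fun g => by rw [← mul_assoc, hxx, one_mul]
  set r : Coprod A Z2.{u} := z * j a * z * j a⁻¹ * z * j x with hr
  have H : Setup r j z ![x, a, a⁻¹] θ
      (fun i => (j (![x, a, a⁻¹] (i + 1)) * z * j (![x, a, a⁻¹] (i + 2)) * z *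
        j (![x, a, a⁻¹] i))⁻¹) :=
    { zz := hz
      e1 := fun i => inv_mul_cancel _
      ee := by
        intro i k hik
        have : (i = 0 ∧ k = 2) ∨ (i = 1 ∧ k = 1) ∨ (i = 2 ∧ k = 0) := by
          revert i k; decide
        rcases this with ⟨rfl, rfl⟩ | ⟨rfl, rfl⟩ | ⟨rfl, rfl⟩
        all_goals simp [hzi, hxi, mul_assoc, hz, hzc, hxx, hxc]
      c0 := hx1
      rr := rfl
      hθ := hθ
      W1 := W1
      W2 := W2
      W3 := W3 }
  have hmain : ∀ n g, Pr r n (j g) → g = 1 := by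
    intro n g h
    refine (pieces H).main (l0 := tval ![x, a, a⁻¹] [Tok.S 0, .C 1, .S 1, .C 2, .S 2, .C 0])
      (Or.inr ⟨rfl, rfl⟩) hz (Or.inl ⟨_, good_triangle H, rfl⟩) ?_ hs hj hnf h
    simp [tv, hr, mul_assoc]
  refine ⟨Coprod A Z2.{u} ⧸ Subgroup.normalClosure {r}, inferInstance,
    (QuotientGroup.mk' _).comp j, QuotientGroup.mk' _ z, ?_, ?_, ?_⟩
  · rw [injective_iff_map_eq_one]
    intro g hg
    simp only [MonoidHom.comp_apply, QuotientGroup.mk'_apply, QuotientGroup.eq_one_iff] at hg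
    obtain ⟨n, hn⟩ := exists_pr_of_mem (r := r) ⟨j x, by
      rw [hr]
      simp [hzi, hxi, mul_assoc, hz, hzc, hxx, hxc]⟩ hg
    exact hmain n g hn
  · rw [← map_mul, hz, map_one]
  · have h0 : (QuotientGroup.mk' (Subgroup.normalClosure {r})) r = 1 := by
      simp only [QuotientGroup.mk'_apply, QuotientGroup.eq_one_iff]
      exact Subgroup.subset_normalClosure rfl
    have e : z * j x * z = (z * r⁻¹ * z⁻¹) * (j a * z * (j a)⁻¹) := by
      rw [hr]
      simp [hzi, hxi, mul_assoc, hz, hzc, hxx, hxc]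
    simp only [MonoidHom.comp_apply, ← map_mul, ← map_inv]
    rw [e, map_mul _ (z * r⁻¹ * z⁻¹), map_mul _ (z * r⁻¹), map_mul _ z, map_inv _ r, h0]
    simp

end

end P59


namespace P59
open Function
universe u v w

/-! ### Enumeration of short cyclic words -/

/-- Adjacency of letters in reduced words. -/
abbrev Adj3 : Fin 3 → Fin 3 → Prop := fun i k => i + k ≠ 0

theorem chain_count (i : Fin 3) (u : List (Fin 3)) (h : (i :: u).IsChain Adj3) :
    (1 : ℤ) - (if i = 0 then 1 else 0) - (if (i :: u).getLast (by simp) = 0 then 1 else 0) ≤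
      (i :: u).length - 2 * (i :: u).count 0 := by
  induction u generalizing i with
  | nil => by_cases hi : i = 0 <;> simp [hi]
  | cons j r ih =>
    rw [List.isChain_cons_cons] at h
    have h1 := ih j h.2
    have h2 := h.1
    rw [List.getLast_cons (by simp)]
    rw [List.count_cons (a := 0) (b := i), List.length_cons (a := i)]
    push_cast
    by_cases hi : i = 0
    · have hj : j ≠ 0 := by rintro rfl; simp [Adj3, hi] at h2
      simp only [hi, hj, if_true, if_false, beq_self_eq_true] at h1 ⊢
      omega
    · simp only [hi, beq_iff_eq, if_false] at h1 ⊢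
      split_ifs at h1 ⊢ <;> push_cast at * <;> omega

theorem cyc_count (u : List (Fin 3)) (h : CycChain Adj3 u) : 2 * u.count 0 ≤ u.length := by
  cases u with
  | nil => simp
  | cons i r =>
    have h1 := chain_count i r h.1
    have h2 := h.2 ((i :: r).getLast (by simp)) (List.getLast?_eq_some_getLast _) i (by simp)
    by_cases hi : i = 0
    · have : (i :: r).getLast (by simp) ≠ 0 := by
        intro h3; apply h2; rw [h3, hi]; rfl
      rw [if_neg this] at h1
      simp only [hi, if_true] at h1 ⊢
      omega
    · rw [if_neg hi] at h1
      split_ifs at h1 <;> omega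

theorem sum_theta (s t : ℤ) (u : List (Fin 3)) :
    (u.map ![s, t, t]).sum = s * u.count 0 + t * (u.length - u.count 0) := by
  induction u with
  | nil => simp
  | cons i r ih =>
    rw [List.map_cons, List.sum_cons, ih, List.count_cons, List.length_cons]
    fin_cases i <;> simp <;> ring

/-- All reduced words with length at most `n` starting after the letter `i`. -/
def genF : ℕ → Fin 3 → List (List (Fin 3))
  | 0, _ => [[]]
  | n + 1, i => [] :: ((if i + 0 ≠ 0 then (genF n 0).map (0 :: ·) else []) ++
      (if i + 1 ≠ 0 then (genF n 1).map (1 :: ·) else []) ++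
      (if i + 2 ≠ 0 then (genF n 2).map (2 :: ·) else []))

theorem mem_genF (n : ℕ) (i : Fin 3) (u : List (Fin 3)) (h : (i :: u).IsChain Adj3)
    (hl : u.length ≤ n) : u ∈ genF n i := by
  induction n generalizing i u with
  | zero => 
    have : u = [] := by simpa using hl
    simp [genF, this]
  | succ n ih =>
    cases u with
    | nil => simp [genF]
    | cons j r =>
      rw [List.isChain_cons_cons] at h
      have := ih j r h.2 (by simpa using hl)
      have h2 : i + j ≠ 0 := h.1
      simp only [genF]
      fin_cases j <;> simp_all

/-- inverse word -/
def winv (u : List (Fin 3)) : List (Fin 3) := (u.map (fun i => -i)).reverse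

section
variable {A : Type u} [Group A]

/-- evaluation of a word -/
def ew (x a : A) (u : List (Fin 3)) : A := (u.map ![x, a, a⁻¹]).prod

theorem ew_append (x a : A) (u v : List (Fin 3)) : ew x a (u ++ v) = ew x a u * ew x a v := by
  simp [ew]

theorem ew_cons (x a : A) (i) (v : List (Fin 3)) : ew x a (i :: v) = ![x, a, a⁻¹] i * ew x a v := by
  simp [ew]

theorem ew_nil (x a : A) : ew x a [] = 1 := by simp [ew]

theorem ew_winv (x a : A) (hx : x * x = 1) (u : List (Fin 3)) :
    ew x a (winv u) = (ew x a u)⁻¹ := by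
  induction u with
  | nil => simp [winv, ew]
  | cons i r ih =>
    have : winv (i :: r) = winv r ++ [-i] := by simp [winv]
    rw [this, ew_append, ih, ew_cons x a i r, mul_inv_rev, ew_cons, ew_nil, mul_one]
    congr 1
    have hxi : x⁻¹ = x := inv_eq_of_mul_eq_one_left hx
    fin_cases i
    · simpa using hxi.symm
    · simp [show (-1 : Fin 3) = 2 from rfl]
    · simp [show (-2 : Fin 3) = 1 from rfl]

theorem ew_rotate (x a : A) (u : List (Fin 3)) (n : ℕ) :
    ew x a (u.rotate n) = 1 ↔ ew x a u = 1 := by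
  induction n generalizing u with
  | zero => simp
  | succ n ih =>
    cases u with
    | nil => simp
    | cons i r =>
      rw [List.rotate_cons_succ, ih, ew_append, ew_cons, ew_cons, ew_nil, mul_one]
      exact mul_eq_one_iff_eq_inv.trans (by rw [mul_eq_one_iff_inv_eq, eq_comm])

end

/-- all rotations of a word -/
def rots (u : List (Fin 3)) : List (List (Fin 3)) := (List.range u.length).map (fun n => u.rotate n)

/-- boolean check that a word is covered. -/
def chk (θ : Fin 3 → ℤ) (NW : List (List (Fin 3))) (u : List (Fin 3)) : Bool :=
  match u with
  | [] => true
  | i :: r => (decide ((i :: r).getLast (by simp) + i = 0)) || (decide (12 ≤ ((i :: r).map θ).sum)) ||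
    ((rots (i :: r)).any (fun v => NW.contains v) ||
      (rots (winv (i :: r))).any (fun v => NW.contains v))

theorem W_all {A : Type u} [Group A] (x a : A) (hx : x * x = 1) (s t : ℤ)
    (NW : List (List (Fin 3)))
    (hNW : ∀ v ∈ NW, ew x a v ≠ 1) (N : ℕ)
    (hN : ∀ u : List (Fin 3), CycChain Adj3 u → (u.map ![s, t, t]).sum < 12 → u.length ≤ N + 1)
    (hchk : ∀ i : Fin 3, ∀ r ∈ genF N i, chk ![s, t, t] NW (i :: r) = true)
    (u : List (Fin 3)) (hu : u ≠ []) (hc : CycChain Adj3 u) (h1 : ew x a u = 1) :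
    12 ≤ (u.map ![s, t, t]).sum := by
  by_contra hlt
  push Not at hlt
  have hl := hN u hc hlt
  cases u with
  | nil => exact hu rfl
  | cons i r =>
    have := hchk i r (mem_genF N i r hc.1 (by simpa using hl))
    simp only [chk, Bool.or_eq_true, decide_eq_true_eq, List.any_eq_true, List.contains_iff_mem,
      rots, List.mem_map, List.mem_range] at this
    rcases this with (h | h) | (⟨_, ⟨n, _, rfl⟩, h⟩ | ⟨_, ⟨n, _, rfl⟩, h⟩)
    · exact hc.2 _ (List.getLast?_eq_some_getLast _) i (by simp) h
    · omega
    · exact hNW _ h ((ew_rotate x a _ _).2 h1)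
    · exact hNW _ h ((ew_rotate x a _ _).2 (by rw [ew_winv x a hx, h1, inv_one]))

theorem thmW' {A : Type u} [Group A] (x a : A) (hx : x * x = 1) (hx1 : x ≠ 1) (s t : ℤ)
    (hst : s + t + t = 6) (hs : -2 ≤ s) (ht : 2 ≤ t)
    (NW : List (List (Fin 3)))
    (hNW : ∀ v ∈ NW, ew x a v ≠ 1) (N : ℕ)
    (hN : ∀ l m : ℤ, 0 ≤ l → 0 ≤ m → l ≤ m → s * l + t * m < 12 → l + m ≤ N + 1)
    (hchk : ∀ i : Fin 3, ∀ r ∈ genF N i, chk ![s, t, t] NW (i :: r) = true) :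
    ∃ (K : Type u) (_ : Group K) (i : A →* K) (y : K), Injective i ∧ y * y = 1 ∧
      y * i x * y = i a * y * (i a)⁻¹ := by
  refine thmW x a hx hx1 ![s, t, t] (by simpa using hst) ?_ ?_ ?_
  · intro u hu hc h
    refine W_all x a hx s t NW hNW N ?_ hchk u hu hc h
    intro u hc h
    rw [sum_theta] at h
    have := cyc_count u hc
    have h3 := hN (u.count 0) (u.length - u.count 0) (by omega) (by omega) (by omega) h
    omega
  · intro u hc
    rw [sum_theta]
    have := cyc_count u hc
    have h1 : (0 : ℤ) ≤ u.count 0 := by omega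
    have h2 : (u.count 0 : ℤ) ≤ u.length - u.count 0 := by omega
    nlinarith
  · intro u hc hh hlast
    cases u with
    | nil => simp at hh
    | cons i r =>
      have h1 := chain_count i r hc
      have hi : i = 1 := by simpa using hh
      have hl : (i :: r).getLast (by simp) = 2 := by
        rw [List.getLast?_eq_some_getLast (by simp)] at hlast
        simpa using hlast
      rw [hl, hi] at h1
      rw [sum_theta]
      simp only [hi] at h1 ⊢
      norm_num at h1
      simp only [Matrix.cons_val_zero]
      have h2 : (0 : ℤ) ≤ ((1 : Fin 3) :: r).count 0 := by omega
      have h3 : (((1 : Fin 3) :: r).count 0 : ℤ) + 1 ≤ ((1 : Fin 3) :: r).length - ((1 : Fin 3) :: r).count 0 := by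
        simp only [List.length_cons]; push_cast; push_cast at h1; simp at *;omega
      nlinarith

/-- words for the generic case -/
def NW6 : List (List (Fin 3)) := [[1],[0,1],[1,1],[0,1,1],[1,1,1],[0,1,0,1],[0,1,0,2],[0,1,1,1],
  [1,1,1,1],[0,1,0,1,1],[0,1,0,2,2],[0,1,1,1,1],[1,1,1,1,1]]

/-- words for orders four and five -/
def NW4 : List (List (Fin 3)) := [[1],[0,1],[1,1],[0,1,1],[1,1,1],[0,1,0,1],[0,1,0,2],[0,1,1,1],
  [0,1,0,1,1],[0,1,0,2,2],[0,1,0,1,0,1],[0,1,0,1,0,2]]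

/-- words for order three -/
def NW3 : List (List (Fin 3)) := [[1],[0,1],[1,1],[0,1,1],[0,1,0,1],[0,1,0,2],[0,1,1,1],
  [0,1,0,1,1],[0,1,0,2,2],[0,1,0,1,0,1],[0,1,0,1,0,2],[0,1,0,1,0,1,1],[0,1,0,1,0,2,2],
  [0,1,0,1,1,0,2],[0,1,0,2,0,1,1],[0,1,0,1,0,1,0,1],[0,1,0,1,0,1,0,2],[0,1,0,1,0,2,0,2],
  [0,1,0,2,0,1,0,2],[0,1,0,1,0,1,0,1,0,1],[0,1,0,1,0,1,0,1,0,2],[0,1,0,1,0,1,0,2,0,2],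
  [0,1,0,1,0,2,0,1,0,2]]

theorem chk6 : ∀ i : Fin 3, ∀ r ∈ genF 4 i, chk ![2, 2, 2] NW6 (i :: r) = true := by
  decide +kernel
theorem chk4 : ∀ i : Fin 3, ∀ r ∈ genF 5 i, chk ![0, 3, 3] NW4 (i :: r) = true := by
  decide +kernel
theorem chk3 : ∀ i : Fin 3, ∀ r ∈ genF 9 i, chk ![-2, 4, 4] NW3 (i :: r) = true := by
  decide +kernel

/-- The conclusion of Theorem E. -/
def EC {A : Type u} [Group A] (x a : A) : Prop :=
  ∃ (K : Type u) (_ : Group K) (i : A →* K) (y : K), Injective i ∧ y * y = 1 ∧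
      y * i x * y = i a * y * (i a)⁻¹

theorem EC6 {A : Type u} [Group A] (x a : A) (hx : x * x = 1) (hx1 : x ≠ 1)
    (hNW : ∀ v ∈ NW6, ew x a v ≠ 1) : EC x a :=
  thmW' x a hx hx1 2 2 (by norm_num) (by norm_num) (by norm_num) NW6 hNW 4
    (by intros; push_cast; omega) chk6
theorem EC4 {A : Type u} [Group A] (x a : A) (hx : x * x = 1) (hx1 : x ≠ 1)
    (hNW : ∀ v ∈ NW4, ew x a v ≠ 1) : EC x a :=
  thmW' x a hx hx1 0 3 (by norm_num) (by norm_num) (by norm_num) NW4 hNW 5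
    (by intros; push_cast; omega) chk4
theorem EC3 {A : Type u} [Group A] (x a : A) (hx : x * x = 1) (hx1 : x ≠ 1)
    (hNW : ∀ v ∈ NW3, ew x a v ≠ 1) : EC x a :=
  thmW' x a hx hx1 (-2) 4 (by norm_num) (by norm_num) (by norm_num) NW3 hNW 9
    (by intros; push_cast; omega) chk3

end P59


namespace P59
open Function
universe u v w

/-! ### Certified rewriting -/

/-- remove a starting part -/
def stripPre : List (Fin 3) → List (Fin 3) → Option (List (Fin 3))
  | [], l => some l
  | _ :: _, [] => none
  | i :: u, j :: l => if i = j then stripPre u l else none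

theorem stripPre_spec (u l r : List (Fin 3)) (h : stripPre u l = some r) : l = u ++ r := by
  induction u generalizing l with
  | nil => simpa [stripPre] using h
  | cons i u ih =>
    cases l with
    | nil => simp [stripPre] at h
    | cons j l =>
      simp only [stripPre] at h
      split_ifs at h with hij
      rw [ih l h, hij]; rfl

/-- rewriting rules -/
abbrev Rules := List (List (Fin 3) × List (Fin 3))

/-- rewrite at the head -/
def stepHead : Rules → List (Fin 3) → Option (List (Fin 3))
  | [], _ => none
  | (u, v) :: R, l => match stripPre u l with
    | some r => some (v ++ r)
    | none => stepHead R l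

/-- rewrite at the first possible position -/
def step (R : Rules) : List (Fin 3) → Option (List (Fin 3))
  | [] => none
  | i :: l => match stepHead R (i :: l) with
    | some r => some r
    | none => match step R l with
      | some r => some (i :: r)
      | none => none

/-- reduce a word -/
def red (R : Rules) : ℕ → List (Fin 3) → List (Fin 3)
  | 0, l => l
  | n + 1, l => match step R l with
    | some r => red R n r
    | none => l

/-- a critical pair -/
def extR (R : Rules) (c : ℕ × ℕ × ℕ × Bool) : Rules :=
  let r1 := R.getD c.1 ([], [])
  let r2 := R.getD c.2.1 ([], [])
  let k := c.2.2.1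
  let p := r1.1.take (r1.1.length - k)
  let s := r2.1.drop k
  if r1.1.drop (r1.1.length - k) = r2.1.take k then
    let e := (red R 100 (r1.2 ++ s), red R 100 (p ++ r2.2))
    R ++ [if c.2.2.2 then (e.2, e.1) else e]
  else R

/-- rules from relators and certificates -/
def build (rel : List (List (Fin 3))) (C : List (ℕ × ℕ × ℕ × Bool)) : Rules :=
  C.foldl extR (([0, 0], []) :: ([1, 2], []) :: ([2, 1], []) :: rel.map (fun r => (r, [])))

section
variable {A : Type u} [Group A] (x a : A)

/-- all rules hold in the group. -/
def ValidR (R : Rules) : Prop := ∀ r ∈ R, ew x a r.1 = ew x a r.2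

variable {x a}

theorem stepHead_sound {R : Rules} (hR : ValidR x a R) (l r) (h : stepHead R l = some r) :
    ew x a r = ew x a l := by
  induction R with
  | nil => simp [stepHead] at h
  | cons q R ih =>
    obtain ⟨u, v⟩ := q
    simp only [stepHead] at h
    cases hs : stripPre u l with
    | none =>
      rw [hs] at h
      exact ih (fun r hr => hR r (List.mem_cons_of_mem _ hr)) h
    | some t =>
      rw [hs] at h
      have h1 := stripPre_spec _ _ _ hs
      have h2 := hR (u, v) (by simp)
      simp only [Option.some.injEq] at h
      rw [← h, h1, ew_append, ew_append, h2]

theorem step_sound {R : Rules} (hR : ValidR x a R) (l r) (h : step R l = some r) :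
    ew x a r = ew x a l := by
  induction l generalizing r with
  | nil => simp [step] at h
  | cons i l ih =>
    simp only [step] at h
    cases hs : stepHead R (i :: l) with
    | some t =>
      rw [hs] at h
      simp only [Option.some.injEq] at h
      rw [← h]; exact stepHead_sound hR _ _ hs
    | none =>
      rw [hs] at h
      cases ht : step R l with
      | none => simp [ht] at h
      | some t =>
        simp only [ht, Option.some.injEq] at h
        rw [← h, ew_cons, ew_cons, ih t ht]

theorem red_sound {R : Rules} (hR : ValidR x a R) (n l) : ew x a (red R n l) = ew x a l := by
  induction n generalizing l with
  | zero => rfl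
  | succ n ih =>
    simp only [red]
    cases hs : step R l with
    | none => rfl
    | some t => simp only; rw [ih, step_sound hR _ _ hs]

theorem getD_valid {R : Rules} (hR : ValidR x a R) (n : ℕ) :
    ew x a (R.getD n ([], [])).1 = ew x a (R.getD n ([], [])).2 := by
  by_cases h : n < R.length
  · rw [List.getD_eq_getElem _ _ h]; exact hR _ (List.getElem_mem h)
  · rw [List.getD_eq_default _ _ (not_lt.1 h)]

theorem extR_valid {R : Rules} (hR : ValidR x a R) (c) : ValidR x a (extR R c) := by
  unfold extR
  simp only
  split_ifs with h
  all_goals try exact hR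
  all_goals
    intro r hr
    rw [List.mem_append, List.mem_singleton] at hr
    rcases hr with hr | rfl
    · exact hR r hr
    · simp only [red_sound hR]
      have h1 := getD_valid hR c.1
      have h2 := getD_valid hR c.2.1
      set r1 := R.getD c.1 ([], [])
      set r2 := R.getD c.2.1 ([], [])
      have e1 : ew x a r1.1 = ew x a (r1.1.take (r1.1.length - c.2.2.1)) * ew x a (r2.1.take c.2.2.1) := by
        rw [← h, ← ew_append, List.take_append_drop]
      have e2 : ew x a r2.1 = ew x a (r2.1.take c.2.2.1) * ew x a (r2.1.drop c.2.2.1) := by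
        rw [← ew_append, List.take_append_drop]
      simp only [ew_append]
      rw [← h1, ← h2, e1, e2, mul_assoc]

theorem build_valid (hx : x * x = 1) (rel : List (List (Fin 3))) (hrel : ∀ r ∈ rel, ew x a r = 1)
    (C) : ValidR x a (build rel C) := by
  have h0 : ValidR x a (([0, 0], []) :: ([1, 2], []) :: ([2, 1], []) :: rel.map (fun r => (r, []))) := by
    intro r hr
    simp only [List.mem_cons, List.mem_map] at hr
    rcases hr with rfl | rfl | rfl | ⟨s, hs, rfl⟩
    · simp [ew, hx]
    · simp [ew]
    · simp [ew]
    · simpa [ew] using hrel s hs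
  unfold build
  generalize (([0, 0], []) :: ([1, 2], []) :: ([2, 1], []) :: rel.map (fun r => (r, []))) = R at h0
  induction C generalizing R with
  | nil => exact h0
  | cons c C ih => exact ih _ (extR_valid h0 c)

theorem kb_one (hx : x * x = 1) (rel : List (List (Fin 3))) (C) (w : List (Fin 3))
    (hrel : ∀ r ∈ rel, ew x a r = 1) 
    (h : red (build rel C) 100 w = []) : ew x a w = 1 := by
  rw [← red_sound (build_valid hx rel hrel C) 100 w, h, ew_nil]

end

theorem D1 {A : Type u} [Group A] (x a : A) (hx : x * x = 1) (h : ew x a [0, 1, 0, 2] = 1) :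
    EC x a := by
  have h : x * (a * (x * a⁻¹)) = 1 := by simpa [ew] using h
  refine ⟨A, inferInstance, MonoidHom.id A, x, fun _ _ h => h, hx, ?_⟩
  have h2 : a * (x * a⁻¹) = x⁻¹ := eq_inv_of_mul_eq_one_right h
  have hxi : x⁻¹ = x := inv_eq_of_mul_eq_one_left hx
  simp [hx, mul_assoc, h2, hxi]

theorem D2 {A : Type u} [Group A] (x a : A) (hx : x * x = 1)
    (h : ew x a [1, 0, 2, 0, 1, 0, 2, 1, 1, 0, 2, 2] = 1) : EC x a := by
  have h : a * (x * (a⁻¹ * (x * (a * (x * (a⁻¹ * (a * (a * (x * (a⁻¹ * a⁻¹)))))))))) = 1 := by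
    simpa [ew] using h
  refine ⟨A, inferInstance, MonoidHom.id A, a * x * a⁻¹, fun _ _ h => h, ?_, ?_⟩
  · simp only [mul_assoc, inv_mul_cancel_left]
    rw [← mul_assoc x x, hx]; simp
  · have hxi : x⁻¹ = x := inv_eq_of_mul_eq_one_left hx
    have h1 : (a * x * a⁻¹ * x * (a * x * a⁻¹)) * (a * (a * x * a⁻¹) * a⁻¹) = 1 := by
      simpa only [mul_assoc] using h
    rw [mul_eq_one_iff_eq_inv] at h1
    simp only [MonoidHom.id_apply, h1]
    simp [mul_assoc, hxi]

theorem D3 {A : Type u} [Group A] (x a : A) (hx : x * x = 1)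
    (h : ew x a [0, 2, 0, 1, 0, 2, 0, 1] = 1) : EC x a := by
  have h : x * (a⁻¹ * (x * (a * (x * (a⁻¹ * (x * a)))))) = 1 := by simpa [ew] using h
  have hxi : x⁻¹ = x := inv_eq_of_mul_eq_one_left hx
  refine ⟨A, inferInstance, MonoidHom.id A, a⁻¹ * x * a, fun _ _ h => h, ?_, ?_⟩
  · simp only [mul_assoc, mul_inv_cancel_left]
    rw [← mul_assoc x x, hx]; simp
  · have h1 := eq_inv_of_mul_eq_one_right h
    rw [hxi] at h1
    simp only [MonoidHom.id_apply, mul_assoc, h1, mul_inv_cancel_left, mul_inv_cancel, mul_one]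

/-! ### Finite exceptional groups -/

theorem pair_glue {A K2 : Type u} [Group A] [Group K2] (x a : A) (x' a' : K2)
    (hx : x * x = 1) (hx' : x' * x' = 1)
    (T : Set (List (Fin 3))) (hT : ∀ t ∈ T, (ew x a t = 1 ↔ ew x' a' t = 1))
    (hnil : [] ∈ T) (hcl : ∀ t ∈ T, ∀ i : Fin 3, ∃ s ∈ T, ew x a (i :: t) = ew x a s ∧
      ew x' a' (i :: t) = ew x' a' s) :
    ∃ (K : Type u) (_ : Group K) (i1 : A →* K) (i2 : K2 →* K), Injective i1 ∧ Injective i2 ∧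
      i1 x = i2 x' ∧ i1 a = i2 a' := by
  have hxi : x⁻¹ = x := inv_eq_of_mul_eq_one_left hx
  have hxi' : x'⁻¹ = x' := inv_eq_of_mul_eq_one_left hx'
  let f1 : FreeGroup (Fin 2) →* A := FreeGroup.lift ![x, a]
  let f2 : FreeGroup (Fin 2) →* K2 := FreeGroup.lift ![x', a']
  have key : ∀ L : List (Fin 2 × Bool), ∃ t ∈ T, f1 (FreeGroup.mk L) = ew x a t ∧
      f2 (FreeGroup.mk L) = ew x' a' t := by
    intro L
    induction L with
    | nil => exact ⟨[], hnil, by simp [f1, ew], by simp [f2, ew]⟩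
    | cons p L ih =>
      obtain ⟨t, ht, h1, h2⟩ := ih
      have go : ∀ i : Fin 3, f1 (FreeGroup.mk [p]) = ![x, a, a⁻¹] i →
          f2 (FreeGroup.mk [p]) = ![x', a', a'⁻¹] i → ∃ t ∈ T, f1 (FreeGroup.mk (p :: L)) = ew x a t ∧
          f2 (FreeGroup.mk (p :: L)) = ew x' a' t := by
        intro i e1 e2
        obtain ⟨s, hs, g1, g2⟩ := hcl t ht i
        refine ⟨s, hs, ?_, ?_⟩
        · rw [← g1, ew_cons, ← e1, ← h1, ← map_mul, FreeGroup.mul_mk]; rfl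
        · rw [← g2, ew_cons, ← e2, ← h2, ← map_mul, FreeGroup.mul_mk]; rfl
      obtain ⟨i, b⟩ := p
      fin_cases i <;> cases b
      · exact go 0 (by simp [f1, hxi]) (by simp [f2, hxi'])
      · exact go 0 (by simp [f1]) (by simp [f2])
      · exact go 2 (by simp [f1]) (by simp [f2])
      · exact go 1 (by simp [f1]) (by simp [f2])
  have hker : f1.ker = f2.ker := by
    ext g
    induction g using Quot.inductionOn with
    | h L =>
      obtain ⟨t, ht, h1, h2⟩ := key L
      show f1 (FreeGroup.mk L) = 1 ↔ f2 (FreeGroup.mk L) = 1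
      rw [h1, h2]; exact hT t ht
  obtain ⟨K, hK, i1, i2, S1, S2, j1, j2, j3, -⟩ := glue f1 f2 hker
  refine ⟨K, hK, i1, i2, j1, j2, ?_, ?_⟩
  · simpa [f1, f2] using j3 (FreeGroup.of 0)
  · simpa [f1, f2] using j3 (FreeGroup.of 1)

theorem EC_of_pair {A K2 : Type u} [Group A] [Group K2] (x a : A) (x' a' y : K2)
    (hx : x * x = 1) (hx' : x' * x' = 1) (hy : y * y = 1) (hyx : y * x' * y = a' * y * a'⁻¹)
    (T : Set (List (Fin 3))) (hT : ∀ t ∈ T, (ew x a t = 1 ↔ ew x' a' t = 1))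
    (hnil : [] ∈ T) (hcl : ∀ t ∈ T, ∀ i : Fin 3, ∃ s ∈ T, ew x a (i :: t) = ew x a s ∧
      ew x' a' (i :: t) = ew x' a' s) : EC x a := by
  obtain ⟨K, hK, i1, i2, j1, j2, j3, j4⟩ := pair_glue x a x' a' hx hx' T hT hnil hcl
  refine ⟨K, hK, i1, i2 y, j1, by rw [← map_mul, hy, map_one], ?_⟩
  rw [j3, j4, ← map_mul, ← map_mul, hyx]; simp

theorem map_ew {A K : Type*} [Group A] [Group K] (f : A →* K) (x a : A) (t : List (Fin 3)) :
    f (ew x a t) = ew (f x) (f a) t := by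
  induction t with
  | nil => simp [ew]
  | cons i t ih => rw [ew_cons, ew_cons, map_mul, ih]; fin_cases i <;> simp

theorem nt_of_conj {A : Type*} [Group A] {x a : A} (hx : x * x = 1) {R : Rules} (hR : ValidR x a R)
    (NT : List (List (Fin 3))) (hNT : ∀ v ∈ NT, ew x a v ≠ 1) (t w : List (Fin 3)) (n : ℕ)
    (h : red R n (winv w ++ t ++ w) ∈ NT) : ew x a t ≠ 1 := by
  intro h1
  refine hNT _ h ?_
  rw [red_sound hR, ew_append, ew_append, h1, ew_winv x a hx]; simp

theorem EC_table {A : Type u} [Group A] {N : ℕ} (x a : A) (x' a' y : Equiv.Perm (Fin N))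
    (hx : x * x = 1) (hx' : x' * x' = 1) (hy : y * y = 1) (hyx : y * x' * y = a' * y * a'⁻¹)
    (rel : List (List (Fin 3))) (C) (R : Rules) (hRC : ∀ r ∈ R, r ∈ build rel C)
    (T NT : List (List (Fin 3))) (hr : ∀ r ∈ rel, ew x a r = 1) (hr' : ∀ r ∈ rel, ew x' a' r = 1)
    (hN : ∀ r ∈ NT, ew x a r ≠ 1) (hN' : ∀ r ∈ NT, ew x' a' r ≠ 1)
    (hnil : [] ∈ T) (hcl : ∀ t ∈ T, ∀ i : Fin 3, red R 100 (i :: t) ∈ T)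
    (Q : List (List (Fin 3) × List (Fin 3))) (hQT : T = [] :: Q.map Prod.fst)
    (hconj : ∀ q ∈ Q, red R 100 (winv q.2 ++ q.1 ++ q.2) ∈ NT) :
    EC x a := by
  have hR : ValidR x a R := fun r h => build_valid hx rel hr C r (hRC r h)
  have hR' : ValidR x' a' R := fun r h => build_valid hx' rel hr' C r (hRC r h)
  let e : Equiv.Perm (Fin N) ≃* ULift.{u} (Equiv.Perm (Fin N)) := MulEquiv.ulift.symm
  have he : ∀ t, ew (e x') (e a') t = e (ew x' a' t) := fun t => (map_ew e.toMonoidHom x' a' t).symm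
  refine EC_of_pair x a (e x') (e a') (e y) hx (by rw [← map_mul, hx', map_one])
    (by rw [← map_mul, hy, map_one]) (by simp only [← map_mul, ← map_inv, hyx]) {t | t ∈ T} ?_ hnil ?_
  · intro t ht
    rw [he, MulEquiv.map_eq_one_iff]
    simp only [hQT, Set.mem_setOf_eq, List.mem_cons, List.mem_map] at ht
    rcases ht with rfl | ⟨⟨t, w⟩, hq, rfl⟩
    · simp [ew]
    · have hw := hconj _ hq
      exact iff_of_false (nt_of_conj hx hR NT hN t w _ hw) (nt_of_conj hx' hR' NT hN' t w _ hw)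
  · intro t ht i
    refine ⟨_, hcl t ht i, ?_, ?_⟩
    · rw [red_sound hR]
    · rw [he, he, red_sound hR']

end P59


namespace P59
open Function
universe u v w

theorem EC_one_of {A : Type u} [Group A] {x a : A} (hx : x * x = 1) {v : List (Fin 3)}
    (h : ew x a v = 1) : ∀ r ∈ [v], ew x a r = 1 := by
  simpa using h

theorem EC_two_of {A : Type u} [Group A] {x a : A} {v w : List (Fin 3)}
    (h : ew x a v = 1) (h' : ew x a w = 1) : ∀ r ∈ [v, w], ew x a r = 1 := by
  simpa using ⟨h, h'⟩

theorem EW_xa {A : Type u} [Group A] {x a : A} (hx : x * x = 1)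
    (h0 : ew x a [0, 1] = 1) : EC x a :=
  D1 x a hx (kb_one hx [[0, 1]]
    [(0, 3, 1, false), (3, 1, 1, false)]
    [0, 1, 0, 2] (EC_one_of hx h0) (by decide +kernel))

theorem EW_xaa {A : Type u} [Group A] {x a : A} (hx : x * x = 1)
    (h0 : ew x a [0, 1, 1] = 1) : EC x a :=
  D1 x a hx (kb_one hx [[0, 1, 1]]
    [(3, 1, 1, true), (0, 4, 1, true)]
    [0, 1, 0, 2] (EC_one_of hx h0) (by decide +kernel))

theorem EW_xaaa {A : Type u} [Group A] {x a : A} (hx : x * x = 1)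
    (h0 : ew x a [0, 1, 1, 1] = 1) : EC x a :=
  D1 x a hx (kb_one hx [[0, 1, 1, 1]]
    [(3, 1, 1, true), (0, 4, 1, false), (4, 1, 1, false), (1, 6, 1, true), (7, 1, 1, true)]
    [0, 1, 0, 2] (EC_one_of hx h0) (by decide +kernel))

theorem EW_xaaaa {A : Type u} [Group A] {x a : A} (hx : x * x = 1)
    (h0 : ew x a [0, 1, 1, 1, 1] = 1) : EC x a :=
  D1 x a hx (kb_one hx [[0, 1, 1, 1, 1]]
    [(3, 1, 1, true), (4, 1, 1, true), (0, 5, 1, true), (0, 4, 1, false), (7, 7, 2, true)]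
    [0, 1, 0, 2] (EC_one_of hx h0) (by decide +kernel))

theorem EW_xaxa {A : Type u} [Group A] {x a : A} (hx : x * x = 1)
    (h0 : ew x a [0, 1, 0, 1] = 1) : EC x a :=
  D2 x a hx (kb_one hx [[0, 1, 0, 1]]
    [(3, 1, 1, true), (0, 4, 1, false), (4, 0, 1, false)]
    [1, 0, 2, 0, 1, 0, 2, 1, 1, 0, 2, 2] (EC_one_of hx h0) (by decide +kernel))

theorem EW_xaxA {A : Type u} [Group A] {x a : A} (hx : x * x = 1)
    (h0 : ew x a [0, 1, 0, 2] = 1) : EC x a :=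
  D1 x a hx (kb_one hx [[0, 1, 0, 2]]
    []
    [0, 1, 0, 2] (EC_one_of hx h0) (by decide +kernel))

theorem EW_xaxaa {A : Type u} [Group A] {x a : A} (hx : x * x = 1)
    (h0 : ew x a [0, 1, 0, 1, 1] = 1) : EC x a :=
  D1 x a hx (kb_one hx [[0, 1, 0, 1, 1]]
    [(3, 1, 1, true), (4, 1, 1, true), (4, 5, 2, false), (6, 3, 1, false), (2, 7, 1, true)]
    [0, 1, 0, 2] (EC_one_of hx h0) (by decide +kernel))

theorem EW_xaxAA {A : Type u} [Group A] {x a : A} (hx : x * x = 1)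
    (h0 : ew x a [0, 1, 0, 2, 2] = 1) : EC x a :=
  D2 x a hx (kb_one hx [[0, 1, 0, 2, 2]]
    [(3, 2, 1, true), (4, 2, 1, true), (0, 5, 1, true)]
    [1, 0, 2, 0, 1, 0, 2, 1, 1, 0, 2, 2] (EC_one_of hx h0) (by decide +kernel))

theorem EWS_xaxaxA {A : Type u} [Group A] {x a : A} (hx : x * x = 1)
    (h0 : ew x a [0, 1, 0, 1, 0, 2] = 1) : ew x a [1, 1] = 1 :=
  kb_one hx [[0, 1, 0, 1, 0, 2]]
    [(3, 2, 1, true), (4, 4, 3, false), (4, 0, 1, true), (0, 6, 1, false), (5, 3, 1, true)]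
    [1, 1] (EC_one_of hx h0) (by decide +kernel)

theorem EWT_xaxaxa {A : Type u} [Group A] {x a : A} (hx : x * x = 1)
    (h0 : ew x a [1, 1, 1] = 1) (h1 : ew x a [0, 1, 0, 1, 0, 1] = 1) : EC x a :=
  D3 x a hx (kb_one hx [[1, 1, 1], [0, 1, 0, 1, 0, 1]]
    [(2, 3, 1, false), (2, 5, 1, true), (4, 1, 1, true), (7, 0, 1, true), (0, 8, 1, false), (4, 7, 2, true), (8, 5, 1, true)]
    [0, 2, 0, 1, 0, 2, 0, 1] (EC_two_of h0 h1) (by decide +kernel))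

theorem EWT_xaxaxA {A : Type u} [Group A] {x a : A} (hx : x * x = 1)
    (h0 : ew x a [1, 1, 1] = 1) (h1 : ew x a [0, 1, 0, 1, 0, 2] = 1) : EC x a :=
  D1 x a hx (kb_one hx [[1, 1, 1], [0, 1, 0, 1, 0, 2]]
    [(2, 3, 1, false), (2, 5, 1, true), (4, 2, 1, true), (7, 7, 3, false), (8, 7, 1, false), (7, 9, 2, false), (5, 10, 1, false), (0, 4, 1, true)]
    [0, 1, 0, 2] (EC_two_of h0 h1) (by decide +kernel))

theorem EWT_xaxaxaa {A : Type u} [Group A] {x a : A} (hx : x * x = 1)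
    (h0 : ew x a [1, 1, 1] = 1) (h1 : ew x a [0, 1, 0, 1, 0, 1, 1] = 1) : EC x a :=
  D1 x a hx (kb_one hx [[1, 1, 1], [0, 1, 0, 1, 0, 1, 1]]
    [(2, 3, 1, false), (2, 5, 1, true), (4, 3, 2, true), (7, 7, 3, false), (8, 7, 1, false), (7, 9, 2, false), (5, 10, 1, false), (0, 4, 1, true)]
    [0, 1, 0, 2] (EC_two_of h0 h1) (by decide +kernel))

theorem EWT_xaxaxAA {A : Type u} [Group A] {x a : A} (hx : x * x = 1)
    (h0 : ew x a [1, 1, 1] = 1) (h1 : ew x a [0, 1, 0, 1, 0, 2, 2] = 1) : EC x a :=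
  D3 x a hx (kb_one hx [[1, 1, 1], [0, 1, 0, 1, 0, 2, 2]]
    [(2, 3, 1, false), (2, 5, 1, true), (4, 6, 1, true), (7, 0, 1, true), (0, 8, 1, false), (7, 7, 1, true), (8, 5, 1, true)]
    [0, 2, 0, 1, 0, 2, 0, 1] (EC_two_of h0 h1) (by decide +kernel))

theorem EWT_xaxaaxA {A : Type u} [Group A] {x a : A} (hx : x * x = 1)
    (h0 : ew x a [1, 1, 1] = 1) (h1 : ew x a [0, 1, 0, 1, 1, 0, 2] = 1) : EC x a :=
  D1 x a hx (kb_one hx [[1, 1, 1], [0, 1, 0, 1, 1, 0, 2]]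
    [(2, 3, 1, false), (2, 5, 1, true), (4, 2, 1, true), (7, 0, 1, true), (8, 2, 1, false), (0, 4, 1, true), (0, 7, 1, true)]
    [0, 1, 0, 2] (EC_two_of h0 h1) (by decide +kernel))

theorem EWT_xaxAxaa {A : Type u} [Group A] {x a : A} (hx : x * x = 1)
    (h0 : ew x a [1, 1, 1] = 1) (h1 : ew x a [0, 1, 0, 2, 0, 1, 1] = 1) : EC x a :=
  D1 x a hx (kb_one hx [[1, 1, 1], [0, 1, 0, 2, 0, 1, 1]]
    [(2, 3, 1, false), (2, 5, 1, true), (4, 3, 2, true), (7, 0, 1, true), (8, 2, 1, false), (9, 7, 2, true), (0, 4, 1, true), (0, 7, 1, true)]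
    [0, 1, 0, 2] (EC_two_of h0 h1) (by decide +kernel))

theorem EWT_xaxaxaxA {A : Type u} [Group A] {x a : A} (hx : x * x = 1)
    (h0 : ew x a [1, 1, 1] = 1) (h1 : ew x a [0, 1, 0, 1, 0, 1, 0, 2] = 1) : EC x a :=
  D1 x a hx (kb_one hx [[1, 1, 1], [0, 1, 0, 1, 0, 1, 0, 2]]
    [(2, 3, 1, false), (2, 5, 1, true), (4, 2, 1, true), (7, 7, 5, false), (6, 8, 1, false)]
    [0, 1, 0, 2] (EC_two_of h0 h1) (by decide +kernel))

theorem EWT_xaxaxAxA {A : Type u} [Group A] {x a : A} (hx : x * x = 1)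
    (h0 : ew x a [1, 1, 1] = 1) (h1 : ew x a [0, 1, 0, 1, 0, 2, 0, 2] = 1) : EC x a :=
  D2 x a hx (kb_one hx [[1, 1, 1], [0, 1, 0, 1, 0, 2, 0, 2]]
    [(2, 3, 1, false), (2, 5, 1, true), (4, 2, 1, true), (7, 0, 1, true)]
    [1, 0, 2, 0, 1, 0, 2, 1, 1, 0, 2, 2] (EC_two_of h0 h1) (by decide +kernel))

theorem EWT_xaxAxaxA {A : Type u} [Group A] {x a : A} (hx : x * x = 1)
    (h0 : ew x a [1, 1, 1] = 1) (h1 : ew x a [0, 1, 0, 2, 0, 1, 0, 2] = 1) : EC x a :=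
  D3 x a hx (kb_one hx [[1, 1, 1], [0, 1, 0, 2, 0, 1, 0, 2]]
    [(2, 3, 1, false), (2, 5, 1, true), (4, 2, 1, true), (7, 0, 1, true)]
    [0, 2, 0, 1, 0, 2, 0, 1] (EC_two_of h0 h1) (by decide +kernel))

theorem EWT_xaxaxaxaxA {A : Type u} [Group A] {x a : A} (hx : x * x = 1)
    (h0 : ew x a [1, 1, 1] = 1) (h1 : ew x a [0, 1, 0, 1, 0, 1, 0, 1, 0, 2] = 1) : EC x a :=
  D1 x a hx (kb_one hx [[1, 1, 1], [0, 1, 0, 1, 0, 1, 0, 1, 0, 2]]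
    [(2, 3, 1, false), (2, 5, 1, true), (4, 2, 1, true), (7, 7, 7, false), (6, 8, 1, false)]
    [0, 1, 0, 2] (EC_two_of h0 h1) (by decide +kernel))

theorem EWT_xaxaxaxAxA {A : Type u} [Group A] {x a : A} (hx : x * x = 1)
    (h0 : ew x a [1, 1, 1] = 1) (h1 : ew x a [0, 1, 0, 1, 0, 1, 0, 2, 0, 2] = 1) : EC x a :=
  D1 x a hx (kb_one hx [[1, 1, 1], [0, 1, 0, 1, 0, 1, 0, 2, 0, 2]]
    [(2, 3, 1, false), (2, 5, 1, true), (4, 2, 1, true), (7, 0, 1, true), (8, 2, 1, true), (9, 9, 5, false), (0, 4, 1, false), (5, 11, 1, false), (0, 4, 1, true)]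
    [0, 1, 0, 2] (EC_two_of h0 h1) (by decide +kernel))

theorem EWT_xaxaxAxaxA {A : Type u} [Group A] {x a : A} (hx : x * x = 1)
    (h0 : ew x a [1, 1, 1] = 1) (h1 : ew x a [0, 1, 0, 1, 0, 2, 0, 1, 0, 2] = 1) : EC x a :=
  D1 x a hx (kb_one hx [[1, 1, 1], [0, 1, 0, 1, 0, 2, 0, 1, 0, 2]]
    [(2, 3, 1, false), (2, 5, 1, true), (4, 2, 1, true), (7, 0, 1, true), (8, 1, 1, true), (9, 0, 1, true), (0, 10, 1, false), (10, 2, 1, false), (12, 12, 1, true), (11, 12, 3, false), (2, 12, 1, true), (0, 4, 1, false)]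
    [0, 1, 0, 2] (EC_two_of h0 h1) (by decide +kernel))

/-- explicit permutation -/
def X34y : Equiv.Perm (Fin 7) :=
  ⟨![0, 4, 5, 3, 1, 2, 6], ![0, 4, 5, 3, 1, 2, 6], by decide, by decide⟩

/-- explicit permutation -/
def X34a : Equiv.Perm (Fin 7) :=
  ⟨![6, 1, 4, 2, 3, 0, 5], ![5, 1, 3, 4, 2, 6, 0], by decide, by decide⟩

/-- certificate -/
def X34C : List (ℕ × ℕ × ℕ × Bool) :=
  [(2, 3, 1, false), (2, 5, 1, true), (4, 1, 1, true), (7, 0, 1, true), (8, 1, 1, true), (0, 9, 1, false), (9, 0, 1, false), (5, 10, 1, true), (6, 11, 1, true), (12, 6, 1, false), (10, 12, 2, true)]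

/-- rules -/
def X34R : Rules :=
  [([0, 0], []),
  ([1, 2], []),
  ([2, 1], []),
  ([1, 1], [2]),
  ([2, 2], [1]),
  ([1, 0, 1, 0], [0, 2, 0, 2]),
  ([2, 0, 2, 0], [0, 1, 0, 1]),
  ([1, 0, 2, 0, 2], [2, 0, 1, 0]),
  ([2, 0, 1, 0, 1], [1, 0, 2, 0]),
  ([2, 0, 1, 0, 2], [1, 0, 2, 0, 1]),
  ([1, 0, 2, 0, 1, 0], [0, 1, 0, 2, 0, 1])]

/-- table -/
def X34Q : List (List (Fin 3) × List (Fin 3)) :=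
  [([0], []),
  ([1], []),
  ([2], [0, 2, 0, 1, 0]),
  ([1, 0], [0]),
  ([2, 0], [1, 0, 2]),
  ([0, 1], []),
  ([0, 2], [2, 0, 2]),
  ([0, 1, 0], [0]),
  ([0, 2, 0], [2, 0, 1, 0]),
  ([1, 0, 1], [0, 2]),
  ([2, 0, 1], [2]),
  ([1, 0, 2], [1]),
  ([2, 0, 2], [2]),
  ([0, 2, 0, 2], [0]),
  ([2, 0, 1, 0], [0, 1, 0]),
  ([1, 0, 2, 0], [2, 0]),
  ([0, 1, 0, 1], []),
  ([0, 2, 0, 1], [1, 0]),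
  ([0, 1, 0, 2], [0, 2, 0]),
  ([0, 2, 0, 1, 0], [0, 2]),
  ([0, 1, 0, 2, 0], [0, 1]),
  ([1, 0, 2, 0, 1], [2]),
  ([0, 1, 0, 2, 0, 1], [1, 0, 1])]

/-- table -/
def X34T : List (List (Fin 3)) := [] :: X34Q.map Prod.fst

theorem EX34 {A : Type u} [Group A] {x a : A} (hx : x * x = 1) (hr : ew x a [1, 1, 1] = 1)
    (hs : ew x a [0, 1, 0, 1, 0, 1, 0, 1] = 1)
    (hN : ∀ r ∈ ([[0], [1], [0, 1], [0, 1, 0, 1]] : List (List (Fin 3))), ew x a r ≠ 1) : EC x a :=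
  EC_table x a (X34y * X34a * X34y * X34a⁻¹ * X34y) X34a X34y hx (by decide +kernel) (by decide +kernel)
    (by decide +kernel) [[1, 1, 1], [0, 1, 0, 1, 0, 1, 0, 1]] X34C X34R (by decide +kernel) X34T [[0], [1], [0, 1], [0, 1, 0, 1]]
    (EC_two_of hr hs) (by decide +kernel) hN (by decide +kernel) (by decide +kernel)
    (by decide +kernel) X34Q rfl (by decide +kernel)

/-- explicit permutation -/
def X35y : Equiv.Perm (Fin 10) :=
  ⟨![9, 2, 1, 7, 4, 5, 8, 3, 6, 0], ![9, 2, 1, 7, 4, 5, 8, 3, 6, 0], by decide, by decide⟩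

/-- explicit permutation -/
def X35a : Equiv.Perm (Fin 10) :=
  ⟨![0, 5, 6, 9, 2, 7, 4, 1, 3, 8], ![0, 7, 4, 8, 6, 1, 2, 5, 9, 3], by decide, by decide⟩

/-- certificate -/
def X35C : List (ℕ × ℕ × ℕ × Bool) :=
  [(2, 3, 1, false), (2, 5, 1, true), (4, 1, 1, true), (7, 0, 1, true), (8, 1, 1, true), (9, 0, 1, true), (0, 10, 1, false), (10, 1, 1, false), (10, 5, 1, true), (0, 13, 1, true), (5, 11, 1, true), (6, 12, 1, true), (14, 16, 3, false), (13, 15, 3, false), (5, 17, 1, true), (6, 18, 1, true), (15, 13, 1, false), (17, 19, 6, true)]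

/-- rules -/
def X35R : Rules :=
  [([0, 0], []),
  ([1, 2], []),
  ([2, 1], []),
  ([1, 1], [2]),
  ([2, 2], [1]),
  ([1, 0, 1, 0, 1], [0, 2, 0, 2, 0]),
  ([2, 0, 2, 0, 2], [0, 1, 0, 1, 0]),
  ([0, 1, 0, 1, 0, 2], [2, 0, 2, 0, 1]),
  ([0, 2, 0, 2, 0, 1], [1, 0, 1, 0, 2]),
  ([1, 0, 2, 0, 2, 0], [2, 0, 1, 0, 1]),
  ([2, 0, 1, 0, 1, 0], [1, 0, 2, 0, 2]),
  ([1, 0, 1, 0, 2, 0, 1, 0], [0, 2, 0, 1, 0, 2, 0, 2]),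
  ([2, 0, 2, 0, 1, 0, 2, 0], [0, 1, 0, 2, 0, 1, 0, 1]),
  ([1, 0, 2, 0, 1, 0, 2, 0, 2], [2, 0, 1, 0, 2, 0, 1, 0]),
  ([2, 0, 1, 0, 2, 0, 1, 0, 1], [1, 0, 2, 0, 1, 0, 2, 0]),
  ([2, 0, 1, 0, 2, 0, 1, 0, 2], [1, 0, 2, 0, 1, 0, 2, 0, 1]),
  ([1, 0, 2, 0, 1, 0, 2, 0, 1, 0], [0, 1, 0, 2, 0, 1, 0, 2, 0, 1])]

/-- table -/
def X35Q : List (List (Fin 3) × List (Fin 3)) :=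
  [([0], []),
  ([1], []),
  ([2], [0, 2, 0, 1, 0, 2, 0, 1, 0]),
  ([1, 0], [0]),
  ([2, 0], [1, 0, 2, 0, 1, 0, 2]),
  ([0, 1], []),
  ([0, 2], [2, 0, 2, 0, 1, 0, 2]),
  ([0, 1, 0], [0]),
  ([0, 2, 0], [2, 0, 1, 0, 2, 0, 1, 0]),
  ([1, 0, 1], [0, 2, 0, 1, 0, 2]),
  ([2, 0, 1], [2]),
  ([1, 0, 2], [1]),
  ([2, 0, 2], [2]),
  ([1, 0, 1, 0], [0]),
  ([2, 0, 1, 0], [1, 0, 2]),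
  ([1, 0, 2, 0], [0, 2, 0, 2]),
  ([2, 0, 2, 0], [1, 0, 2, 0, 1, 0, 2]),
  ([0, 1, 0, 1], []),
  ([0, 2, 0, 1], [0, 1, 0, 2]),
  ([0, 1, 0, 2], [2, 0, 2]),
  ([0, 2, 0, 2], [2, 0, 2, 0, 1, 0, 2]),
  ([0, 1, 0, 1, 0], [2, 0, 1, 0, 2]),
  ([0, 2, 0, 1, 0], [0, 2]),
  ([0, 1, 0, 2, 0], [0, 1]),
  ([0, 2, 0, 2, 0], [0, 2]),
  ([2, 0, 1, 0, 1], [2, 0]),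
  ([1, 0, 2, 0, 1], [0, 2, 0, 1, 0, 2]),
  ([2, 0, 2, 0, 1], [0, 2, 0, 1, 0, 2, 0]),
  ([1, 0, 1, 0, 2], [1, 0]),
  ([2, 0, 1, 0, 2], [2]),
  ([1, 0, 2, 0, 2], [0, 1, 0, 2, 0, 1, 0]),
  ([1, 0, 2, 0, 1, 0], [2, 0, 2, 0, 1, 0]),
  ([2, 0, 2, 0, 1, 0], [0, 1, 0]),
  ([1, 0, 1, 0, 2, 0], [2, 0, 1, 0, 2, 0]),
  ([2, 0, 1, 0, 2, 0], [2, 0, 2, 0]),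
  ([0, 2, 0, 1, 0, 1], [1, 0, 2, 0, 1, 0]),
  ([0, 1, 0, 2, 0, 1], [1, 0, 1, 0, 2, 0]),
  ([0, 2, 0, 1, 0, 2], [1, 0, 1, 0]),
  ([0, 1, 0, 2, 0, 2], [0, 2, 0]),
  ([0, 1, 0, 2, 0, 1, 0], [2, 0, 1, 0, 2]),
  ([0, 2, 0, 1, 0, 2, 0], [0, 2]),
  ([1, 0, 2, 0, 1, 0, 1], [2, 0, 1, 0]),
  ([2, 0, 2, 0, 1, 0, 1], [2, 0, 2]),
  ([1, 0, 1, 0, 2, 0, 1], [1, 0, 2, 0]),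
  ([2, 0, 1, 0, 2, 0, 1], [2, 0, 1]),
  ([1, 0, 2, 0, 1, 0, 2], [1, 0, 2]),
  ([2, 0, 2, 0, 1, 0, 2], [0, 2, 0, 1, 0]),
  ([1, 0, 1, 0, 2, 0, 2], [1, 0, 1]),
  ([2, 0, 1, 0, 2, 0, 2], [0, 1, 0, 2, 0]),
  ([0, 2, 0, 1, 0, 2, 0, 2], [0, 2, 0, 2]),
  ([2, 0, 1, 0, 2, 0, 1, 0], [1, 0, 2]),
  ([1, 0, 2, 0, 1, 0, 2, 0], [0, 2, 0, 2]),
  ([0, 1, 0, 2, 0, 1, 0, 1], [0, 1, 0, 1]),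
  ([0, 2, 0, 1, 0, 2, 0, 1], [0, 1, 0, 2]),
  ([0, 1, 0, 2, 0, 1, 0, 2], [2, 0, 2]),
  ([0, 2, 0, 1, 0, 2, 0, 1, 0], [0, 2, 0, 1]),
  ([0, 1, 0, 2, 0, 1, 0, 2, 0], [0, 1, 0, 2]),
  ([1, 0, 2, 0, 1, 0, 2, 0, 1], [2, 0, 1, 0, 1]),
  ([0, 1, 0, 2, 0, 1, 0, 2, 0, 1], [2, 0, 2, 0, 1])]

/-- table -/
def X35T : List (List (Fin 3)) := [] :: X35Q.map Prod.fst

theorem EX35 {A : Type u} [Group A] {x a : A} (hx : x * x = 1) (hr : ew x a [1, 1, 1] = 1)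
    (hs : ew x a [0, 1, 0, 1, 0, 1, 0, 1, 0, 1] = 1)
    (hN : ∀ r ∈ ([[0], [1], [0, 1], [0, 1, 0, 1]] : List (List (Fin 3))), ew x a r ≠ 1) : EC x a :=
  EC_table x a (X35y * X35a * X35y * X35a⁻¹ * X35y) X35a X35y hx (by decide +kernel) (by decide +kernel)
    (by decide +kernel) [[1, 1, 1], [0, 1, 0, 1, 0, 1, 0, 1, 0, 1]] X35C X35R (by decide +kernel) X35T [[0], [1], [0, 1], [0, 1, 0, 1]]
    (EC_two_of hr hs) (by decide +kernel) hN (by decide +kernel) (by decide +kernel)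
    (by decide +kernel) X35Q rfl (by decide +kernel)

/-- explicit permutation -/
def X43y : Equiv.Perm (Fin 5) :=
  ⟨![0, 1, 2, 4, 3], ![0, 1, 2, 4, 3], by decide, by decide⟩

/-- explicit permutation -/
def X43a : Equiv.Perm (Fin 5) :=
  ⟨![2, 0, 4, 3, 1], ![1, 4, 0, 3, 2], by decide, by decide⟩

/-- certificate -/
def X43C : List (ℕ × ℕ × ℕ × Bool) :=
  [(2, 3, 1, false), (2, 5, 1, true), (4, 1, 1, true), (7, 0, 1, true), (0, 8, 1, false), (4, 7, 2, true), (6, 10, 1, true), (8, 5, 1, false), (5, 9, 1, true)]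

/-- rules -/
def X43R : Rules :=
  [([0, 0], []),
  ([1, 2], []),
  ([2, 1], []),
  ([1, 1, 1], [2]),
  ([2, 2], [1, 1]),
  ([1, 0, 1], [0, 2, 0]),
  ([2, 0, 2], [0, 1, 0]),
  ([2, 0, 1, 0], [1, 1, 0, 2]),
  ([2, 0, 1, 1], [0, 1, 0, 2]),
  ([1, 1, 0, 2, 0], [2, 0, 1])]

/-- table -/
def X43Q : List (List (Fin 3) × List (Fin 3)) :=
  [([0], []),
  ([1], []),
  ([2], [0, 1, 1, 0]),
  ([1, 0], [0]),
  ([2, 0], [1, 0, 2]),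
  ([0, 1], []),
  ([1, 1], []),
  ([0, 2], [1, 1, 0, 2]),
  ([0, 1, 0], [0]),
  ([1, 1, 0], [2, 0]),
  ([0, 2, 0], [1, 1, 0]),
  ([2, 0, 1], [2]),
  ([0, 1, 1], [1, 0]),
  ([1, 0, 2], [1]),
  ([1, 1, 0, 2], [1, 0]),
  ([0, 1, 1, 0], [0]),
  ([1, 0, 2, 0], [0, 2]),
  ([0, 2, 0, 1], [0, 1, 0]),
  ([0, 1, 0, 2], [2]),
  ([0, 1, 1, 0, 2], [0, 2]),
  ([0, 1, 0, 2, 0], [0, 1]),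
  ([1, 0, 2, 0, 1], [1, 1]),
  ([0, 1, 0, 2, 0, 1], [1, 0])]

/-- table -/
def X43T : List (List (Fin 3)) := [] :: X43Q.map Prod.fst

theorem EX43 {A : Type u} [Group A] {x a : A} (hx : x * x = 1) (hr : ew x a [1, 1, 1, 1] = 1)
    (hs : ew x a [0, 1, 0, 1, 0, 1] = 1)
    (hN : ∀ r ∈ ([[0], [1], [1, 1], [0, 1]] : List (List (Fin 3))), ew x a r ≠ 1) : EC x a :=
  EC_table x a (X43y * X43a * X43y * X43a⁻¹ * X43y) X43a X43y hx (by decide +kernel) (by decide +kernel)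
    (by decide +kernel) [[1, 1, 1, 1], [0, 1, 0, 1, 0, 1]] X43C X43R (by decide +kernel) X43T [[0], [1], [1, 1], [0, 1]]
    (EC_two_of hr hs) (by decide +kernel) hN (by decide +kernel) (by decide +kernel)
    (by decide +kernel) X43Q rfl (by decide +kernel)

/-- explicit permutation -/
def X53y : Equiv.Perm (Fin 7) :=
  ⟨![3, 1, 2, 0, 6, 5, 4], ![3, 1, 2, 0, 6, 5, 4], by decide, by decide⟩

/-- explicit permutation -/
def X53a : Equiv.Perm (Fin 7) :=
  ⟨![0, 5, 3, 1, 4, 6, 2], ![0, 3, 6, 2, 4, 1, 5], by decide, by decide⟩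

/-- certificate -/
def X53C : List (ℕ × ℕ × ℕ × Bool) :=
  [(2, 3, 1, false), (2, 5, 1, false), (2, 6, 1, true), (4, 1, 1, true), (8, 0, 1, true), (0, 9, 1, false), (4, 8, 2, true), (9, 6, 1, true), (0, 12, 1, true), (6, 10, 1, true), (7, 11, 1, true), (11, 15, 1, false), (10, 14, 1, false), (17, 16, 5, false), (6, 18, 1, false), (14, 12, 1, false)]

/-- rules -/
def X53R : Rules :=
  [([0, 0], []),
  ([1, 2], []),
  ([2, 1], []),
  ([1, 1, 1], [2, 2]),
  ([2, 2, 2], [1, 1]),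
  ([1, 0, 1], [0, 2, 0]),
  ([2, 0, 2], [0, 1, 0]),
  ([0, 1, 0, 2, 2], [2, 0, 1, 1]),
  ([0, 2, 0, 1, 1], [1, 0, 2, 2]),
  ([1, 1, 0, 2, 0], [2, 2, 0, 1]),
  ([2, 2, 0, 1, 0], [1, 1, 0, 2]),
  ([0, 1, 0, 2, 0, 1, 0], [2, 0, 1, 1, 0, 2]),
  ([0, 2, 0, 1, 0, 2, 0], [1, 0, 2, 2, 0, 1]),
  ([1, 0, 2, 2, 0, 1, 1, 0], [0, 2, 2, 0, 1, 1, 0, 2]),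
  ([2, 0, 1, 1, 0, 2, 2, 0], [0, 1, 1, 0, 2, 2, 0, 1]),
  ([2, 2, 0, 1, 1, 0, 2, 2], [1, 1, 0, 2, 2, 0, 1, 1])]

/-- table -/
def X53Q : List (List (Fin 3) × List (Fin 3)) :=
  [([0], []),
  ([1], []),
  ([2], [0, 2, 2, 0, 1, 1, 0]),
  ([1, 0], [0]),
  ([2, 0], [1, 0, 2, 0, 1, 0, 2]),
  ([0, 1], []),
  ([1, 1], []),
  ([0, 2], [2, 2, 0, 1, 1, 0, 2]),
  ([2, 2], [0, 2, 2, 0, 1, 1, 0]),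
  ([0, 1, 0], [0]),
  ([1, 1, 0], [2, 0, 1, 1, 0]),
  ([0, 2, 0], [2, 2, 0, 1, 1, 0]),
  ([2, 2, 0], [2, 0]),
  ([2, 0, 1], [2]),
  ([0, 1, 1], [1, 0, 2, 2, 0]),
  ([1, 0, 2], [1]),
  ([0, 2, 2], [1, 0]),
  ([2, 0, 1, 0], [0, 1, 1, 0]),
  ([0, 1, 1, 0], [0]),
  ([1, 0, 2, 0], [2, 2, 0]),
  ([0, 2, 2, 0], [2, 2, 0, 1, 1, 0]),
  ([0, 2, 0, 1], [1, 1, 0]),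
  ([2, 2, 0, 1], [0, 2, 0, 1, 0, 2]),
  ([2, 0, 1, 1], [2]),
  ([0, 1, 0, 2], [0, 2, 2, 0]),
  ([1, 1, 0, 2], [1, 0]),
  ([1, 0, 2, 2], [2, 0, 1, 1, 0, 2]),
  ([0, 2, 0, 1, 0], [0, 2]),
  ([2, 0, 1, 1, 0], [1, 1, 0, 2, 2]),
  ([0, 1, 0, 2, 0], [0, 1]),
  ([1, 0, 2, 2, 0], [0, 2]),
  ([1, 0, 2, 0, 1], [0, 1, 1, 0, 2]),
  ([0, 2, 2, 0, 1], [0, 1, 0]),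
  ([2, 2, 0, 1, 1], [2, 2]),
  ([2, 0, 1, 0, 2], [2, 2]),
  ([0, 1, 1, 0, 2], [2, 0, 1, 0, 2]),
  ([1, 1, 0, 2, 2], [1, 1]),
  ([1, 0, 2, 0, 1, 0], [2, 0, 1, 1, 0]),
  ([2, 2, 0, 1, 1, 0], [1, 0, 2]),
  ([2, 0, 1, 0, 2, 0], [2, 0]),
  ([1, 1, 0, 2, 2, 0], [1, 0, 2, 2]),
  ([0, 1, 0, 2, 0, 1], [1, 0, 2, 2, 0]),
  ([1, 0, 2, 2, 0, 1], [0, 2, 2]),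
  ([0, 2, 2, 0, 1, 1], [0, 1, 0, 2]),
  ([0, 2, 0, 1, 0, 2], [1, 0]),
  ([2, 0, 1, 1, 0, 2], [1, 1, 0, 2]),
  ([0, 1, 1, 0, 2, 2], [2, 0, 1, 0]),
  ([0, 2, 2, 0, 1, 1, 0], [0, 2, 2]),
  ([0, 1, 1, 0, 2, 2, 0], [0, 1, 1]),
  ([2, 0, 1, 0, 2, 0, 1], [2, 0, 1]),
  ([1, 1, 0, 2, 2, 0, 1], [2, 2, 0]),
  ([1, 0, 2, 2, 0, 1, 1], [1, 1, 0]),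
  ([1, 0, 2, 0, 1, 0, 2], [1, 0, 2]),
  ([2, 2, 0, 1, 1, 0, 2], [0, 1, 1, 0]),
  ([2, 0, 1, 1, 0, 2, 2], [0, 2, 2, 0]),
  ([0, 2, 2, 0, 1, 1, 0, 2], [0, 2, 0, 1]),
  ([0, 1, 1, 0, 2, 2, 0, 1], [0, 1, 0, 2]),
  ([1, 1, 0, 2, 2, 0, 1, 1], [2, 2, 0, 1]),
  ([0, 1, 1, 0, 2, 2, 0, 1, 1], [2, 0, 1, 1])]

/-- table -/
def X53T : List (List (Fin 3)) := [] :: X53Q.map Prod.fst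

theorem EX53 {A : Type u} [Group A] {x a : A} (hx : x * x = 1) (hr : ew x a [1, 1, 1, 1, 1] = 1)
    (hs : ew x a [0, 1, 0, 1, 0, 1] = 1)
    (hN : ∀ r ∈ ([[0], [1], [1, 1], [0, 1]] : List (List (Fin 3))), ew x a r ≠ 1) : EC x a :=
  EC_table x a (X53y * X53a * X53y * X53a⁻¹ * X53y) X53a X53y hx (by decide +kernel) (by decide +kernel)
    (by decide +kernel) [[1, 1, 1, 1, 1], [0, 1, 0, 1, 0, 1]] X53C X53R (by decide +kernel) X53T [[0], [1], [1, 1], [0, 1]]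
    (EC_two_of hr hs) (by decide +kernel) hN (by decide +kernel) (by decide +kernel)
    (by decide +kernel) X53Q rfl (by decide +kernel)

end P59


namespace P59
open Function
universe u v w

theorem dih_gx {A : Type*} [Group A] {x a : A} (hx : x * x = 1) (ha : a * a = 1) (k : ℤ) :
    x * (x * a) ^ k = (x * a) ^ (-k) * x := by
  have hxi : x⁻¹ = x := inv_eq_of_mul_eq_one_left hx
  have hai : a⁻¹ = a := inv_eq_of_mul_eq_one_left ha
  have h1 : x * (x * a) * x⁻¹ = (x * a)⁻¹ := by
    rw [mul_inv_rev, hxi, hai, ← mul_assoc, hx, one_mul]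
  have h2 : x * (x * a) ^ k * x⁻¹ = (x * a) ^ (-k) := by
    rw [← conj_zpow, h1, inv_zpow, zpow_neg]
  rw [← h2]; simp

theorem dih_step0 {A : Type*} [Group A] {x a : A} (hx : x * x = 1) (ha : a * a = 1) {k : ℤ} {z : A} :
    (z = (x * a) ^ k → x * z = (x * a) ^ (-k) * x) ∧
    (z = (x * a) ^ k * x → x * z = (x * a) ^ (-k)) :=
  ⟨fun h => by rw [h, dih_gx hx ha], fun h => by
    rw [h, ← mul_assoc, dih_gx hx ha, mul_assoc, hx, mul_one]⟩

theorem dih_step1 {A : Type*} [Group A] {x a : A} (hx : x * x = 1) (ha : a * a = 1) {k : ℤ} {z : A} :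
    (z = (x * a) ^ k → a * z = (x * a) ^ (-k - 1) * x) ∧
    (z = (x * a) ^ k * x → a * z = (x * a) ^ (-k - 1)) := by
  have e : a = x * (x * a) := by rw [← mul_assoc, hx, one_mul]
  have e2 : (x * a) * (x * a) ^ k = (x * a) ^ (k + 1) := by rw [add_comm, zpow_add, zpow_one]
  have e3 : a * (x * a) ^ k = (x * a) ^ (-k - 1) * x := by
    conv_lhs => rw [e, mul_assoc, ← e, e2, dih_gx hx ha]
    congr 2; ring
  exact ⟨fun h => by rw [h, e3], fun h => by rw [h, ← mul_assoc, e3, mul_assoc, hx, mul_one]⟩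

theorem dih_words {A : Type*} [Group A] {x a : A} (hx : x * x = 1) (ha : a * a = 1)
    {K : Type*} [Group K] {x' a' : K} (hx' : x' * x' = 1) (ha' : a' * a' = 1) (t : List (Fin 3)) :
    ∃ k : ℤ, (ew x a t = (x * a) ^ k ∧ ew x' a' t = (x' * a') ^ k) ∨
      (ew x a t = (x * a) ^ k * x ∧ ew x' a' t = (x' * a') ^ k * x') := by
  induction t with
  | nil => exact ⟨0, by simp [ew]⟩
  | cons i t ih =>
    obtain ⟨k, hk⟩ := ih
    fin_cases i
    · refine ⟨-k, ?_⟩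
      simp only [ew_cons]
      rcases hk with ⟨h1, h2⟩ | ⟨h1, h2⟩
      · exact Or.inr ⟨(dih_step0 hx ha).1 h1, (dih_step0 hx' ha').1 h2⟩
      · exact Or.inl ⟨(dih_step0 hx ha).2 h1, (dih_step0 hx' ha').2 h2⟩
    · refine ⟨-k - 1, ?_⟩
      simp only [ew_cons]
      rcases hk with ⟨h1, h2⟩ | ⟨h1, h2⟩
      · exact Or.inr ⟨(dih_step1 hx ha).1 h1, (dih_step1 hx' ha').1 h2⟩
      · exact Or.inl ⟨(dih_step1 hx ha).2 h1, (dih_step1 hx' ha').2 h2⟩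
    · refine ⟨-k - 1, ?_⟩
      have hai : a⁻¹ = a := inv_eq_of_mul_eq_one_left ha
      have hai' : a'⁻¹ = a' := inv_eq_of_mul_eq_one_left ha'
      simp only [ew_cons, hai, hai']
      rcases hk with ⟨h1, h2⟩ | ⟨h1, h2⟩
      · exact Or.inr ⟨(dih_step1 hx ha).1 h1, (dih_step1 hx' ha').1 h2⟩
      · exact Or.inl ⟨(dih_step1 hx ha).2 h1, (dih_step1 hx' ha').2 h2⟩

theorem EC_two {A : Type u} [Group A] (x a : A) (hx : x * x = 1) (ha : a * a = 1) : EC x a := by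
  by_cases hD : ew x a [0, 1, 0, 2] = 1
  · exact D1 x a hx hD
  let n := 3 * orderOf (x * a)
  let e : DihedralGroup n ≃* ULift.{u} (DihedralGroup n) := MulEquiv.ulift.symm
  let y : DihedralGroup n := .sr 0
  let b : DihedralGroup n := .sr 1
  have hy : y * y = 1 := by simp [y]
  have hb : b * b = 1 := by simp [b]
  have hbi : b⁻¹ = b := inv_eq_of_mul_eq_one_left hb
  have hx' : (y * b * y * b⁻¹ * y) * (y * b * y * b⁻¹ * y) = 1 := by
    have : (y * b * y * b⁻¹ * y) * (y * b * y * b⁻¹ * y) =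
      y * (b * (y * (b⁻¹ * ((y * y) * (b * (y * (b⁻¹ * y))))))) := by simp only [mul_assoc]
    rw [this, hy, one_mul, inv_mul_cancel_left, ← mul_assoc y y, hy, one_mul, mul_inv_cancel_left, hy]
  have hxb : (y * b * y * b⁻¹ * y) * b = (.r 1) ^ 3 := by
    rw [hbi]
    simp only [y, b, DihedralGroup.sr_mul_sr, DihedralGroup.r_mul_sr, DihedralGroup.sr_mul_r, pow_succ, pow_zero, one_mul,
      DihedralGroup.r_mul_r]
    congr 1; ring
  have hne : ∀ k : ℤ, ((y * b * y * b⁻¹ * y) * b) ^ k * (y * b * y * b⁻¹ * y) ≠ 1 := by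
    intro k h
    have h1 : ∀ k : ℤ, ∃ i, ((y * b * y * b⁻¹ * y) * b) ^ k = .r i := by
      intro k
      rw [hxb, ← zpow_natCast, ← zpow_mul]
      have : ∀ m : ℕ, ∃ i, ((.r 1 : DihedralGroup n)) ^ m = .r i := by
        intro m
        exact ⟨_, DihedralGroup.r_one_pow m⟩
      obtain ⟨m, hm | hm⟩ := Int.eq_nat_or_neg (((3 : ℕ) : ℤ) * k)
      · rw [hm, zpow_natCast]; exact this m
      · obtain ⟨i, hi⟩ := this m
        rw [hm, zpow_neg, zpow_natCast, hi]; exact ⟨-i, rfl⟩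
    obtain ⟨i, hi⟩ := h1 k
    rw [hi, hbi] at h
    simp only [y, b, DihedralGroup.sr_mul_sr, DihedralGroup.r_mul_sr, DihedralGroup.sr_mul_r] at h
    rw [DihedralGroup.one_def] at h
    cases h
  refine EC_of_pair x a (e (y * b * y * b⁻¹ * y)) (e b) (e y) hx
    (by rw [← map_mul, hx', map_one])
    (by rw [← map_mul, hy, map_one]) (by
      simp only [← map_mul, ← map_inv]
      congr 1
      simp only [mul_assoc]
      rw [hy, mul_one, ← mul_assoc y y, hy, one_mul]) Set.univ ?_ (Set.mem_univ _)
    (fun t _ i => ⟨i :: t, Set.mem_univ _, rfl, rfl⟩)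
  intro t _
  have he : ew (e (y * b * y * b⁻¹ * y)) (e b) t = e (ew (y * b * y * b⁻¹ * y) b t) :=
    (map_ew e.toMonoidHom _ b t).symm
  rw [he, MulEquiv.map_eq_one_iff]
  obtain ⟨k, ⟨h1, h2⟩ | ⟨h1, h2⟩⟩ := dih_words hx ha hx' hb t
  · rw [h1, h2, hxb, ← zpow_natCast, ← zpow_mul, ← orderOf_dvd_iff_zpow_eq_one,
      ← orderOf_dvd_iff_zpow_eq_one, DihedralGroup.orderOf_r_one]
    simp only [n]
    push_cast
    exact (mul_dvd_mul_iff_left (by norm_num)).symm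
  · rw [h1, h2]
    refine iff_of_false ?_ (hne k)
    intro h
    apply hD
    have hxk : x = (x * a) ^ (-k) := by rw [zpow_neg]; exact eq_inv_of_mul_eq_one_right h
    have hc : Commute x (x * a) := by
      conv_lhs => rw [hxk]
      exact (Commute.refl _).zpow_left _
    have hai : a⁻¹ = a := inv_eq_of_mul_eq_one_left ha
    have : x * (a * (x * a⁻¹)) = 1 := by
      have h3 : x * (x * a) = x * a * x := hc
      rw [hai]
      calc x * (a * (x * a)) = (x * a * x) * a := by simp only [mul_assoc]
        _ = 1 := by rw [← h3, ← mul_assoc, hx, one_mul, ha]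
    simpa [ew] using this

theorem thmE {A : Type u} [Group A] (x a : A) (hx : x * x = 1) (hx1 : x ≠ 1) (ha1 : a ≠ 1) :
    EC x a := by
  by_cases h2 : ew x a [1, 1] = 1
  · exact EC_two x a hx (by simpa [ew] using h2)
  have h1 : ew x a [1] ≠ 1 := by simpa [ew] using ha1
  have hx0 : ew x a [0] ≠ 1 := by simpa [ew] using hx1
  by_cases w1 : ew x a [0, 1] = 1
  · exact EW_xa hx w1
  by_cases w2 : ew x a [0, 1, 1] = 1
  · exact EW_xaa hx w2
  by_cases w3 : ew x a [0, 1, 1, 1] = 1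
  · exact EW_xaaa hx w3
  by_cases w4 : ew x a [0, 1, 1, 1, 1] = 1
  · exact EW_xaaaa hx w4
  by_cases w5 : ew x a [0, 1, 0, 1] = 1
  · exact EW_xaxa hx w5
  by_cases w6 : ew x a [0, 1, 0, 2] = 1
  · exact EW_xaxA hx w6
  by_cases w7 : ew x a [0, 1, 0, 1, 1] = 1
  · exact EW_xaxaa hx w7
  by_cases w8 : ew x a [0, 1, 0, 2, 2] = 1
  · exact EW_xaxAA hx w8
  have w9 : ew x a [0, 1, 0, 1, 0, 2] ≠ 1 := fun h => h2 (EWS_xaxaxA hx h)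
  by_cases h3 : ew x a [1, 1, 1] = 1
  · by_cases v1 : ew x a [0, 1, 0, 1, 0, 1] = 1
    · exact EWT_xaxaxa hx h3 v1
    by_cases v2 : ew x a [0, 1, 0, 1, 0, 1, 1] = 1
    · exact EWT_xaxaxaa hx h3 v2
    by_cases v3 : ew x a [0, 1, 0, 1, 0, 2, 2] = 1
    · exact EWT_xaxaxAA hx h3 v3
    by_cases v4 : ew x a [0, 1, 0, 1, 1, 0, 2] = 1
    · exact EWT_xaxaaxA hx h3 v4
    by_cases v5 : ew x a [0, 1, 0, 2, 0, 1, 1] = 1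
    · exact EWT_xaxAxaa hx h3 v5
    by_cases v6 : ew x a [0, 1, 0, 1, 0, 1, 0, 2] = 1
    · exact EWT_xaxaxaxA hx h3 v6
    by_cases v7 : ew x a [0, 1, 0, 1, 0, 2, 0, 2] = 1
    · exact EWT_xaxaxAxA hx h3 v7
    by_cases v8 : ew x a [0, 1, 0, 2, 0, 1, 0, 2] = 1
    · exact EWT_xaxAxaxA hx h3 v8
    by_cases v9 : ew x a [0, 1, 0, 1, 0, 1, 0, 1, 0, 2] = 1
    · exact EWT_xaxaxaxaxA hx h3 v9
    by_cases v10 : ew x a [0, 1, 0, 1, 0, 1, 0, 2, 0, 2] = 1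
    · exact EWT_xaxaxaxAxA hx h3 v10
    by_cases v11 : ew x a [0, 1, 0, 1, 0, 2, 0, 1, 0, 2] = 1
    · exact EWT_xaxaxAxaxA hx h3 v11
    by_cases v12 : ew x a [0, 1, 0, 1, 0, 1, 0, 1] = 1
    · refine EX34 hx h3 v12 ?_
      simp only [List.forall_mem_cons]
      exact ⟨hx0, h1, w1, w5, by simp⟩
    by_cases v13 : ew x a [0, 1, 0, 1, 0, 1, 0, 1, 0, 1] = 1
    · refine EX35 hx h3 v13 ?_
      simp only [List.forall_mem_cons]
      exact ⟨hx0, h1, w1, w5, by simp⟩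
    refine EC3 x a hx hx1 ?_
    simp only [NW3, List.forall_mem_cons]
    exact ⟨h1, w1, h2, w2, w5, w6, w3, w7, w8, v1, w9, v2, v3, v4, v5, v12, v6, v7, v8, v13, v9,
      v10, v11, by simp⟩
  by_cases v : ew x a [0, 1, 0, 1, 0, 1] = 1
  · by_cases h4 : ew x a [1, 1, 1, 1] = 1
    · refine EX43 hx h4 v ?_
      simp only [List.forall_mem_cons]
      exact ⟨hx0, h1, h2, w1, by simp⟩
    by_cases h5 : ew x a [1, 1, 1, 1, 1] = 1
    · refine EX53 hx h5 v ?_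
      simp only [List.forall_mem_cons]
      exact ⟨hx0, h1, h2, w1, by simp⟩
    refine EC6 x a hx hx1 ?_
    simp only [NW6, List.forall_mem_cons]
    exact ⟨h1, w1, h2, w2, h3, w5, w6, w3, h4, w7, w8, w4, h5, by simp⟩
  refine EC4 x a hx hx1 ?_
  simp only [NW4, List.forall_mem_cons]
  exact ⟨h1, w1, h2, w2, h3, w5, w6, w3, w7, w8, v, w9, by simp⟩

end P59


namespace P59
open Function
universe u v w

/-! ### Matrices -/

/-- shorthand -/
abbrev SL2 := Matrix.SpecialLinearGroup (Fin 2) ℂ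

/-- the projective quotient -/
abbrev PS2 := SL2 ⧸ (Subgroup.center SL2)

/-- the projection -/
abbrev pr : SL2 →* PS2 := QuotientGroup.mk' (Subgroup.center SL2)

theorem pr_eq_one_iff (M : SL2) : pr M = 1 ↔ M.1 0 1 = 0 ∧ M.1 1 0 = 0 ∧ M.1 0 0 = M.1 1 1 := by
  rw [QuotientGroup.mk'_apply, QuotientGroup.eq_one_iff, Matrix.SpecialLinearGroup.mem_center_iff]
  constructor
  · rintro ⟨r, -, h⟩
    rw [← h]; simp
  · rintro ⟨h1, h2, h3⟩
    have hd := M.2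
    rw [Matrix.det_fin_two, h1, h2] at hd
    refine ⟨M.1 0 0, ?_, ?_⟩
    · simp only [Fintype.card_fin]
      rw [← h3] at hd
      linear_combination hd
    · ext i j; fin_cases i <;> fin_cases j <;> simp [h1, h2, h3]

theorem sl_ch (M : SL2) : M.1 * M.1 = (M.1 0 0 + M.1 1 1) • M.1 - (1 : Matrix (Fin 2) (Fin 2) ℂ) := by
  have hd := M.2
  rw [Matrix.det_fin_two] at hd
  ext i j; fin_cases i <;> fin_cases j <;> simp [Matrix.mul_apply, Fin.sum_univ_two] <;>
    first | linear_combination hd | linear_combination -hd | ring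

theorem sl_inv (M : SL2) : (M⁻¹).1 = (M.1 0 0 + M.1 1 1) • (1 : Matrix (Fin 2) (Fin 2) ℂ) - M.1 := by
  rw [Matrix.SpecialLinearGroup.coe_inv, Matrix.adjugate_fin_two]
  ext i j; fin_cases i <;> fin_cases j <;> simp

theorem sl_pow (M : SL2) (l : ℂ) (hl : l ≠ 0) (ht : M.1 0 0 + M.1 1 1 = l + l⁻¹) (n : ℕ) :
    (l - l⁻¹) • (M ^ (n + 1)).1 = (l ^ (n + 1) - l⁻¹ ^ (n + 1)) • M.1 -
      (l ^ n - l⁻¹ ^ n) • (1 : Matrix (Fin 2) (Fin 2) ℂ) := by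
  induction n with
  | zero => simp
  | succ n ih =>
    rw [pow_succ M (n + 1), Matrix.SpecialLinearGroup.coe_mul, ← smul_mul_assoc, ih, sub_mul,
      smul_mul_assoc, sl_ch, ht]
    have hli : l * l⁻¹ = 1 := mul_inv_cancel₀ hl
    ext i j
    simp only [smul_mul_assoc, one_mul, Matrix.sub_apply, Matrix.smul_apply, smul_eq_mul]
    simp only [pow_succ]
    linear_combination (l ^ n - l⁻¹ ^ n) * M.1 i j * hli

theorem sl_span (M : SL2) (n : ℤ) : ∃ k k' : ℂ, (M ^ n).1 = k • M.1 + k' • (1 : Matrix (Fin 2) (Fin 2) ℂ) := by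
  induction n with
  | zero => exact ⟨0, 1, by simp⟩
  | succ n ih =>
    obtain ⟨k, k', h⟩ := ih
    refine ⟨k * (M.1 0 0 + M.1 1 1) + k', -k, ?_⟩
    rw [zpow_add_one, Matrix.SpecialLinearGroup.coe_mul, h, add_mul, smul_mul_assoc, sl_ch]
    ext i j
    simp only [smul_mul_assoc, one_mul, Matrix.add_apply, Matrix.sub_apply, Matrix.smul_apply, smul_eq_mul]
    ring
  | pred n ih =>
    obtain ⟨k, k', h⟩ := ih
    refine ⟨-k', k + k' * (M.1 0 0 + M.1 1 1), ?_⟩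
    have h2 : M.1 * (M⁻¹).1 = 1 := by
      rw [← Matrix.SpecialLinearGroup.coe_mul]; simp
    rw [zpow_sub_one, Matrix.SpecialLinearGroup.coe_mul, h, add_mul, smul_mul_assoc, h2, smul_mul_assoc, one_mul, sl_inv]
    ext i j
    simp only [Matrix.add_apply, Matrix.sub_apply, Matrix.smul_apply, smul_eq_mul]
    ring

theorem orderOf_pr (M : SL2) (l : ℂ) (hl : l ≠ 0) (hl2 : l ^ 2 ≠ 1)
    (ht : M.1 0 0 + M.1 1 1 = l + l⁻¹) : orderOf (pr M) = orderOf (l ^ 2) := by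
  have hli : l * l⁻¹ = 1 := mul_inv_cancel₀ hl
  have hd : l - l⁻¹ ≠ 0 := by
    intro h; apply hl2; linear_combination l * h + hli
  have hM : ¬ (M.1 0 1 = 0 ∧ M.1 1 0 = 0 ∧ M.1 0 0 = M.1 1 1) := by
    rintro ⟨h1, h2, h3⟩
    have hdet := M.2
    rw [Matrix.det_fin_two, h1, h2, ← h3] at hdet
    rw [← h3] at ht
    apply hl2
    have h4 : (l - l⁻¹) ^ 2 = 0 := by
      linear_combination 4 * hdet - (2 * M.1 0 0 + l + l⁻¹) * ht - 4 * hli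
    exact absurd (pow_eq_zero_iff (by norm_num) |>.1 h4) hd
  rw [orderOf_eq_orderOf_iff]
  intro n
  cases n with
  | zero => simp
  | succ n =>
    rw [← map_pow, pr_eq_one_iff]
    have hp := sl_pow M l hl ht n
    have e : ∀ i j, (l - l⁻¹) * (M ^ (n + 1)).1 i j = (l ^ (n + 1) - l⁻¹ ^ (n + 1)) * M.1 i j -
      (l ^ n - l⁻¹ ^ n) * (1 : Matrix (Fin 2) (Fin 2) ℂ) i j := by
      intro i j
      have := congrFun (congrFun hp i) j
      simpa using this
    have e01 := e 0 1
    have e10 := e 1 0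
    have e00 := e 0 0
    have e11 := e 1 1
    simp only [ne_eq, zero_ne_one, not_false_eq_true, Matrix.one_apply_ne, Matrix.one_apply_eq, mul_zero, sub_zero,
      one_ne_zero] at e01 e10 e00 e11
    have hw : l ^ (n + 1) * l⁻¹ ^ (n + 1) = 1 := by rw [← mul_pow, hli, one_pow]
    constructor
    · rintro ⟨h1, h2, h3⟩
      by_contra hne
      have hU : l ^ (n + 1) - l⁻¹ ^ (n + 1) ≠ 0 := by
        intro h; apply hne
        rw [← pow_mul, mul_comm, pow_mul]
        linear_combination l ^ (n + 1) * h + hw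
      apply hM
      rw [h1, mul_zero] at e01
      rw [h2, mul_zero] at e10
      refine ⟨?_, ?_, ?_⟩
      · exact (mul_eq_zero.1 e01.symm).resolve_left hU
      · exact (mul_eq_zero.1 e10.symm).resolve_left hU
      · apply mul_left_cancel₀ hU
        linear_combination e11 - e00 + (l - l⁻¹) * h3
    · intro h
      have hU : l ^ (n + 1) - l⁻¹ ^ (n + 1) = 0 := by
        have h5 : (l ^ (n + 1)) ^ 2 = 1 := by rw [← pow_mul, mul_comm, pow_mul]; exact h
        linear_combination l⁻¹ ^ (n + 1) * h5 - l ^ (n + 1) * hw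
      rw [hU, zero_mul] at e01 e10 e00 e11
      refine ⟨(mul_eq_zero.1 e01).resolve_left hd, (mul_eq_zero.1 e10).resolve_left hd, ?_⟩
      apply mul_left_cancel₀ hd
      linear_combination e00 - e11

/-- Commuting criterion: equal nontrivial projective powers force commutation. -/
theorem commute_of_pow (M N : SL2) (m n : ℤ) (h : pr M ^ m = pr N ^ n) (h1 : pr M ^ m ≠ 1) :
    M.1 * N.1 = N.1 * M.1 := by
  obtain ⟨k, k', hk⟩ := sl_span M m
  obtain ⟨j, j', hj⟩ := sl_span N n
  rw [← map_zpow, ← map_zpow] at h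
  rw [← map_zpow] at h1
  have h2 : pr ((M ^ m)⁻¹ * N ^ n) = 1 := by rw [map_mul, map_inv, h, inv_mul_cancel]
  rw [QuotientGroup.mk'_apply, QuotientGroup.eq_one_iff, Matrix.SpecialLinearGroup.mem_center_iff] at h2
  obtain ⟨r, -, hr⟩ := h2
  have h3 : (N ^ n).1 = r • (M ^ m).1 := by
    have : (M ^ m).1 * ((M ^ m)⁻¹ * N ^ n).1 = (N ^ n).1 := by
      rw [← Matrix.SpecialLinearGroup.coe_mul]; simp
    rw [← this, ← hr]; ext i j; simp [Matrix.mul_apply, Fin.sum_univ_two]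
    fin_cases j <;> simp <;> ring
  have hk0 : k ≠ 0 := by
    rintro rfl
    apply h1; rw [pr_eq_one_iff, hk]; simp
  have hrne : r ≠ 0 := by
    rintro rfl
    have := (N ^ n).2
    rw [h3] at this
    simp at this
  rw [hk, hj] at h3
  have hj0 : j ≠ 0 := by
    rintro rfl
    apply h1; rw [pr_eq_one_iff, hk]
    have e01 := congrFun (congrFun h3 0) 1
    have e10 := congrFun (congrFun h3 1) 0
    have e00 := congrFun (congrFun h3 0) 0
    have e11 := congrFun (congrFun h3 1) 1
    simp at e01 e10 e00 e11
    simp only [hrne, hk0, false_or] at e01 e10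
    refine ⟨by simp [e01], by simp [e10], ?_⟩
    have : r * (k * M.1 0 0 + k') = r * (k * M.1 1 1 + k') := by rw [← e00, ← e11]
    simpa using mul_left_cancel₀ hrne this
  have h4 : N.1 = (r * k / j) • M.1 + ((r * k' - j') / j) • (1 : Matrix (Fin 2) (Fin 2) ℂ) := by
    ext a b
    have := congrFun (congrFun h3 a) b
    simp only [Matrix.add_apply, Matrix.smul_apply, smul_eq_mul] at this ⊢
    field_simp
    linear_combination this
  rw [h4]
  simp [mul_add, add_mul]

end P59


namespace P59
open Function
universe u v w

/-- diagonal matrix -/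
noncomputable def Zmat (v : ℂˣ) : SL2 :=
  ⟨!![(v : ℂ), 0; 0, (v : ℂ)⁻¹], by simp [Matrix.det_fin_two]⟩

/-- diagonal matrices -/
noncomputable def Zh : ℂˣ →* SL2 where
  toFun v := Zmat v
  map_one' := by
    apply Subtype.ext
    ext i j; fin_cases i <;> fin_cases j <;> simp [Zmat]
  map_mul' a b := by
    apply Subtype.ext
    rw [Matrix.SpecialLinearGroup.coe_mul (Zmat a) (Zmat b)]
    ext i j; fin_cases i <;> fin_cases j <;>
      simp [Zmat, Matrix.mul_apply, Fin.sum_univ_two, mul_comm]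

theorem Zh_val (v : ℂˣ) : (Zh v).1 = !![(v : ℂ), 0; 0, (v : ℂ)⁻¹] := rfl

/-- the matrix `X` -/
noncomputable def Xm (P S : ℂ) : SL2 := ⟨!![P, 1; P * S - 1, S], by simp [Matrix.det_fin_two]⟩

/-- the matrix `Y` -/
noncomputable def Ym (P S : ℂ) (v : ℂˣ) : SL2 :=
  ⟨!![S * (v : ℂ)⁻¹, -(v : ℂ)⁻¹; -(P * S - 1) * v, P * v], by
    have : (v : ℂ) * (v : ℂ)⁻¹ = 1 := by simp
    rw [Matrix.det_fin_two]
    simp only [Matrix.cons_val', Matrix.cons_val_zero, Matrix.cons_val_one, Matrix.of_apply,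
      Matrix.cons_val_fin_one]
    linear_combination this⟩

theorem YXZ (P S : ℂ) (v : ℂˣ) : Ym P S v * Xm P S * Zh v = 1 := by
  have : (v : ℂ) * (v : ℂ)⁻¹ = 1 := by simp
  apply Subtype.ext
  rw [Matrix.SpecialLinearGroup.coe_mul, Matrix.SpecialLinearGroup.coe_mul]
  ext i j
  fin_cases i <;> fin_cases j <;>
    simp [Matrix.mul_apply, Fin.sum_univ_two, Ym, Xm, Zh_val]
  · linear_combination this
  · ring
  · ring
  · linear_combination this

/-- the conjugate of `X`. -/
noncomputable def Vm (P S : ℂ) (v : ℂˣ) (k : ℤ) : SL2 := Zh v ^ (-k) * Xm P S * Zh v ^ k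

theorem Vm_val (P S : ℂ) (v : ℂˣ) (k : ℤ) : (Vm P S v k).1 =
    !![P, ((v ^ k : ℂˣ) : ℂ)⁻¹ * ((v ^ k : ℂˣ) : ℂ)⁻¹;
      (P * S - 1) * (((v ^ k : ℂˣ) : ℂ) * ((v ^ k : ℂˣ) : ℂ)), S] := by
  unfold Vm
  rw [← map_zpow, ← map_zpow, zpow_neg]
  generalize v ^ k = m
  have : (m : ℂ) * (m : ℂ)⁻¹ = 1 := by simp
  rw [Matrix.SpecialLinearGroup.coe_mul, Matrix.SpecialLinearGroup.coe_mul]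
  ext i j
  fin_cases i <;> fin_cases j <;>
    simp [Matrix.mul_apply, Fin.sum_univ_two, Xm, Zh_val]
  · linear_combination P * this
  · ring
  · linear_combination S * this

section
variable (P S : ℂ) (v : ℂˣ) (hv : (v : ℂ) ^ 2 ≠ 1) (l m : ℂ) (hl : l ≠ 0) (hl2 : l ^ 2 ≠ 1)
  (hm : m ≠ 0) (hm2 : m ^ 2 ≠ 1) (hX : P + S = l + l⁻¹) (hY : P * v + S * (v : ℂ)⁻¹ = m + m⁻¹)

include hl hl2 hX in
theorem ordX : orderOf (pr (Xm P S)) = orderOf (l ^ 2) :=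
  orderOf_pr _ l hl hl2 (by simpa [Xm] using hX)

include hm hm2 hY in
theorem ordY : orderOf (pr (Ym P S v)) = orderOf (m ^ 2) :=
  orderOf_pr _ m hm hm2 (by
    have : S * (v : ℂ)⁻¹ + P * v = m + m⁻¹ := by rw [← hY]; ring
    simpa [Ym] using this)

include hv in
theorem ordZ : orderOf (pr (Zh v)) = orderOf ((v : ℂ) ^ 2) :=
  orderOf_pr _ v (by simp) hv (by simp [Zh_val])

include hv in
theorem XZ_inter (a b : ℤ) (h : pr (Xm P S) ^ a = pr (Zh v) ^ b) : pr (Xm P S) ^ a = 1 := by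
  by_contra h1
  have := commute_of_pow _ _ a b h h1
  have e := congrFun (congrFun this 0) 1
  simp [Xm, Zh_val, Matrix.mul_apply, Fin.sum_univ_two] at e
  apply hv
  have hi : (v : ℂ) * (v : ℂ)⁻¹ = 1 := by simp
  linear_combination -(v : ℂ) * e + hi

include hv in
theorem YZ_inter (a b : ℤ) (h : pr (Ym P S v) ^ a = pr (Zh v) ^ b) : pr (Ym P S v) ^ a = 1 := by
  by_contra h1
  have := commute_of_pow _ _ a b h h1
  have e := congrFun (congrFun this 0) 1
  simp [Ym, Zh_val, Matrix.mul_apply, Fin.sum_univ_two] at e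
  apply hv
  have hi : (v : ℂ) * (v : ℂ)⁻¹ = 1 := by simp
  linear_combination -(v : ℂ) ^ 2 * e + ((v : ℂ) * (v : ℂ)⁻¹ + 1) * hi

/-- the commutator determinant -/
theorem comm_det (k : ℤ) : ((Ym P S v).1 * (Vm P S v k).1 - (Vm P S v k).1 * (Ym P S v).1).det =
    (P * S - 1) * (((P - S) - (((v ^ (2 * k - 1) : ℂˣ) : ℂ) + ((v ^ (2 * k - 1) : ℂˣ) : ℂ)⁻¹) / 2 *
      (P * v - S * (v : ℂ)⁻¹)) ^ 2 - ((((v ^ (2 * k - 1) : ℂˣ) : ℂ) - ((v ^ (2 * k - 1) : ℂˣ) : ℂ)⁻¹) / 2) ^ 2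
      * ((P * v + S * (v : ℂ)⁻¹) ^ 2 - 4)) := by
  have hk : ((v ^ (2 * k - 1) : ℂˣ) : ℂ) = ((v ^ k : ℂˣ) : ℂ) * ((v ^ k : ℂˣ) : ℂ) * (v : ℂ)⁻¹ := by
    rw [zpow_sub_one, two_mul, zpow_add]; simp
  rw [Vm_val, hk, Matrix.det_fin_two]
  have h0 : ((v ^ k : ℂˣ) : ℂ) ≠ 0 := Units.ne_zero _
  have h1 : (v : ℂ) ≠ 0 := Units.ne_zero _
  simp only [Matrix.sub_apply, Matrix.mul_apply, Fin.sum_univ_two, Ym]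
  generalize ((v ^ k : ℂˣ) : ℂ) = t at *
  generalize (v : ℂ) = z at *
  simp
  field_simp
  ring

end
end P59


namespace P59
open Function
universe u v w

theorem exists_root_order (n : ℕ) (hn : n ≠ 1) : ∃ l : ℂ, ‖l‖ = 1 ∧ orderOf (l ^ 2) = n := by
  rcases Nat.eq_zero_or_pos n with rfl | hp
  · refine ⟨Complex.exp Complex.I, by simpa using Complex.norm_exp_ofReal_mul_I 1, ?_⟩
    rw [orderOf_eq_zero_iff']
    intro n hn h
    rw [← pow_mul, ← Complex.exp_nat_mul, Complex.exp_eq_one_iff] at h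
    obtain ⟨k, hk⟩ := h
    have h1 : ((2 * n : ℕ) : ℂ) = k * (2 * Real.pi) := by
      have := Complex.I_ne_zero
      apply mul_right_cancel₀ this
      rw [hk]; ring
    have h2 : ((2 * n : ℕ) : ℝ) = k * (2 * Real.pi) := by exact_mod_cast h1
    have hk0 : (k : ℝ) ≠ 0 := by
      rintro h0
      rw [h0, zero_mul] at h2
      have : 2 * n = 0 := by exact_mod_cast h2
      omega
    apply irrational_pi
    refine ⟨(n : ℚ) / k, ?_⟩
    push_cast at h2 ⊢
    field_simp
    linarith
  · have hn0 : n ≠ 0 := by omega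
    have hnc : (n : ℂ) ≠ 0 := by exact_mod_cast hn0
    refine ⟨Complex.exp ((Real.pi / n : ℝ) * Complex.I), Complex.norm_exp_ofReal_mul_I _, ?_⟩
    have := Complex.isPrimitiveRoot_exp n hn0
    rw [← Complex.exp_nat_mul]
    have e : ((2 : ℕ) : ℂ) * (((Real.pi / n : ℝ) : ℂ) * Complex.I) = 2 * Real.pi * Complex.I / n := by
      push_cast; ring
    rw [e]
    exact this.eq_orderOf.symm

theorem inv_of_norm {l : ℂ} (h : ‖l‖ = 1) : l⁻¹ = (starRingEnd ℂ) l := by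
  exact (Complex.inv_eq_conj h)

theorem im_ne {l : ℂ} (h : ‖l‖ = 1) (h2 : l ^ 2 ≠ 1) : l.im ≠ 0 := by
  intro h0
  apply h2
  have h1 : l = l⁻¹ := by
    rw [inv_of_norm h]
    exact (Complex.conj_eq_iff_im.2 h0).symm
  have hl : l ≠ 0 := by rintro rfl; simp at h
  rw [pow_two]
  nth_rewrite 2 [h1]
  exact mul_inv_cancel₀ hl

theorem order_of_trace {l m : ℂ} (hl : l ≠ 0) (hm : m ≠ 0) (h : (l + l⁻¹) ^ 2 = (m + m⁻¹) ^ 2) :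
    orderOf (l ^ 2) = orderOf (m ^ 2) := by
  have e : (l ^ 2 - m ^ 2) * (l ^ 2 * m ^ 2 - 1) = 0 := by
    have := congrArg (fun t => t * (l ^ 2 * m ^ 2)) h
    field_simp at this
    linear_combination this
  rcases mul_eq_zero.1 e with h | h
  · rw [sub_eq_zero.1 h]
  · have : l ^ 2 = (m ^ 2)⁻¹ := eq_inv_of_mul_eq_one_left (sub_eq_zero.1 h)
    rw [this]
    have h1 := orderOf_inv (Units.mk0 (m ^ 2) (pow_ne_zero 2 hm))
    rw [← orderOf_units, ← orderOf_units (y := Units.mk0 (m ^ 2) (pow_ne_zero 2 hm))] at h1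
    simpa using h1

/-- the data -/
structure Dat (P S : ℂ) (v : ℂˣ) (l m : ℂ) : Prop where
  nl : ‖l‖ = 1
  nm : ‖m‖ = 1
  nv : ‖(v : ℂ)‖ = 1
  l2 : l ^ 2 ≠ 1
  m2 : m ^ 2 ≠ 1
  v2 : (v : ℂ) ^ 2 ≠ 1
  hX : P + S = l + l⁻¹
  hY : P * v + S * (v : ℂ)⁻¹ = m + m⁻¹
  hS : S = (starRingEnd ℂ) P

theorem dat_exists {l m : ℂ} {v : ℂˣ} (nl : ‖l‖ = 1) (nm : ‖m‖ = 1) (nv : ‖(v : ℂ)‖ = 1)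
    (l2 : l ^ 2 ≠ 1) (m2 : m ^ 2 ≠ 1) (v2 : (v : ℂ) ^ 2 ≠ 1) : ∃ P S, Dat P S v l m := by
  have hv0 : (v : ℂ) ≠ 0 := Units.ne_zero v
  have hi : (v : ℂ) * (v : ℂ)⁻¹ = 1 := by simp
  have hd : (v : ℂ) - (v : ℂ)⁻¹ ≠ 0 := by
    intro h
    apply v2
    linear_combination (v : ℂ) * h + hi
  have cv : (starRingEnd ℂ) (v : ℂ) = (v : ℂ)⁻¹ := (inv_of_norm nv).symm
  have cv' : (starRingEnd ℂ) (v : ℂ)⁻¹ = (v : ℂ) := by rw [← cv]; simp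
  have cl : (starRingEnd ℂ) l = l⁻¹ := (inv_of_norm nl).symm
  have cl' : (starRingEnd ℂ) l⁻¹ = l := by rw [← cl]; simp
  have cm : (starRingEnd ℂ) m = m⁻¹ := (inv_of_norm nm).symm
  have cm' : (starRingEnd ℂ) m⁻¹ = m := by rw [← cm]; simp
  refine ⟨((m + m⁻¹) - (l + l⁻¹) * (v : ℂ)⁻¹) / ((v : ℂ) - (v : ℂ)⁻¹),
    ((l + l⁻¹) * v - (m + m⁻¹)) / ((v : ℂ) - (v : ℂ)⁻¹), ⟨nl, nm, nv, l2, m2, v2, ?_, ?_, ?_⟩⟩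
  · rw [← add_div, div_eq_iff hd]; ring
  · rw [div_mul_eq_mul_div, div_mul_eq_mul_div, ← add_div, div_eq_iff hd]; ring
  · rw [map_div₀]
    simp only [map_sub, map_mul, map_add, cv, cv', cl, cl', cm, cm']
    have hd' : (v : ℂ)⁻¹ - (v : ℂ) ≠ 0 := by
      intro h; apply hd; linear_combination -h
    rw [div_eq_div_iff hd hd']
    ring

section
variable {P S : ℂ} {v : ℂˣ} {l m : ℂ} (D : Dat P S v l m)
include D

theorem Dat.l0 : l ≠ 0 := by rintro rfl; simpa using D.nl
theorem Dat.m0 : m ≠ 0 := by rintro rfl; simpa using D.nm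

theorem Dat.ord_eq (h : (P - S) ^ 2 = (P * v - S * (v : ℂ)⁻¹) ^ 2) : orderOf (l ^ 2) = orderOf (m ^ 2) := by
  apply order_of_trace D.l0 D.m0
  rw [← D.hX, ← D.hY]
  have hi : (v : ℂ) * (v : ℂ)⁻¹ = 1 := by simp
  linear_combination h - 4 * P * S * hi

theorem Dat.PS : P - S = (2 * P.im : ℝ) * Complex.I := by
  rw [D.hS]; apply Complex.ext <;> simp; ring

theorem Dat.Q : P * v - S * (v : ℂ)⁻¹ = (2 * (P * v).im : ℝ) * Complex.I := by
  rw [D.hS, inv_of_norm D.nv, ← map_mul]; apply Complex.ext <;> simp; ring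

theorem norm_zpow_one (k : ℤ) : ‖((v ^ k : ℂˣ) : ℂ)‖ = 1 := by
  rw [Units.val_zpow_eq_zpow_val, norm_zpow, D.nv, one_zpow]

theorem Dat.brace (k : ℤ) (h : (((P - S) - (((v ^ (2 * k - 1) : ℂˣ) : ℂ) + ((v ^ (2 * k - 1) : ℂˣ) : ℂ)⁻¹) / 2 *
      (P * v - S * (v : ℂ)⁻¹)) ^ 2 - ((((v ^ (2 * k - 1) : ℂˣ) : ℂ) - ((v ^ (2 * k - 1) : ℂˣ) : ℂ)⁻¹) / 2) ^ 2
      * ((P * v + S * (v : ℂ)⁻¹) ^ 2 - 4)) = 0) : orderOf (l ^ 2) = orderOf (m ^ 2) := by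
  have hn := norm_zpow_one D (2 * k - 1)
  have h0 := Units.ne_zero (v ^ (2 * k - 1))
  generalize ((v ^ (2 * k - 1) : ℂˣ) : ℂ) = η at *
  have e1 : (η + η⁻¹) / 2 = (η.re : ℂ) := by
    rw [inv_of_norm hn]; apply Complex.ext <;> simp
  have e2 : (η - η⁻¹) / 2 = (η.im : ℂ) * Complex.I := by
    rw [inv_of_norm hn]; apply Complex.ext <;> simp
  have hi : m * m⁻¹ = 1 := mul_inv_cancel₀ D.m0
  have e3 : (P * v + S * (v : ℂ)⁻¹) ^ 2 - 4 = ((2 * m.im : ℝ) * Complex.I) ^ 2 := by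
    rw [D.hY]
    have : m - m⁻¹ = ((2 * m.im : ℝ) * Complex.I) := by
      rw [inv_of_norm D.nm]; apply Complex.ext <;> simp; ring
    rw [← this]
    linear_combination 4 * hi
  have hPS := D.PS
  have hQ := D.Q
  rw [e1, e2, e3, hPS, hQ] at h
  have h' : ((2 * P.im - η.re * (2 * (P * v).im)) ^ 2 + (η.im * (2 * m.im)) ^ 2 : ℝ) = 0 := by
    have hI := Complex.I_sq
    have : (((2 * P.im - η.re * (2 * (P * v).im)) ^ 2 + (η.im * (2 * m.im)) ^ 2 : ℝ) : ℂ) = 0 := by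
      push_cast
      push_cast at h
      generalize ((P * v).im : ℂ) = u at h ⊢
      generalize (P.im : ℂ) = u1 at h ⊢
      generalize (η.im : ℂ) = u2 at h ⊢
      generalize (η.re : ℂ) = u3 at h ⊢
      generalize (m.im : ℂ) = u4 at h ⊢
      linear_combination -h + ((2 * u1 - u3 * (2 * u)) ^ 2 + (u2 * (2 * u4)) ^ 2 - u2 ^ 2 * (2 * u4) ^ 2 * (Complex.I ^ 2 + 0)) * hI
    exact_mod_cast this
  have a1 : (2 * P.im - η.re * (2 * (P * v).im)) = 0 := by
    have := sq_nonneg (η.im * (2 * m.im))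
    have := sq_nonneg (2 * P.im - η.re * (2 * (P * v).im))
    apply pow_eq_zero_iff (two_ne_zero) |>.1; linarith
  have a2 : η.im * (2 * m.im) = 0 := by
    have := sq_nonneg (η.im * (2 * m.im))
    have := sq_nonneg (2 * P.im - η.re * (2 * (P * v).im))
    apply pow_eq_zero_iff (two_ne_zero) |>.1; linarith
  have hmi := im_ne D.nm D.m2
  have a3 : η.im = 0 := by
    rcases mul_eq_zero.1 a2 with h | h
    · exact h
    · exfalso; apply hmi; linarith
  have a4 : η.re ^ 2 = 1 := by
    have := Complex.sq_norm η
    rw [hn, Complex.normSq_apply, a3] at this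
    linarith
  apply D.ord_eq
  rw [hPS, hQ]
  have : 2 * P.im = η.re * (2 * (P * v).im) := by linarith
  rw [this]
  push_cast
  have a4' : (η.re : ℂ) ^ 2 = 1 := by exact_mod_cast a4
  linear_combination (2 * ((P * v).im : ℂ) * Complex.I) ^ 2 * a4'

theorem Dat.comm (k : ℤ) (h : (Ym P S v).1 * (Vm P S v k).1 = (Vm P S v k).1 * (Ym P S v).1) :
    ((v ^ (2 * k - 1) : ℂˣ) : ℂ) ^ 2 = 1 ∧ orderOf (l ^ 2) = orderOf (m ^ 2) ∧
    ((v ^ (2 * k - 1) : ℂˣ) : ℂ) * (P - S) = (P * v - S * (v : ℂ)⁻¹) := by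
  have hk : ((v ^ (2 * k - 1) : ℂˣ) : ℂ) = ((v ^ k : ℂˣ) : ℂ) * ((v ^ k : ℂˣ) : ℂ) * (v : ℂ)⁻¹ := by
    rw [zpow_sub_one, two_mul, zpow_add]; simp
  have hn := norm_zpow_one D (2 * k - 1)
  have h0 := Units.ne_zero (v ^ (2 * k - 1))
  have d11 := congrFun (congrFun h 0) 0
  have d12 := congrFun (congrFun h 0) 1
  rw [Vm_val] at d11 d12
  simp only [Matrix.mul_apply, Fin.sum_univ_two, Ym] at d11 d12
  have h2 : ((v ^ k : ℂˣ) : ℂ) ≠ 0 := Units.ne_zero _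
  have h1 : (v : ℂ) ≠ 0 := Units.ne_zero _
  have key : ((v ^ (2 * k - 1) : ℂˣ) : ℂ) * (P - S) = (P * v - S * (v : ℂ)⁻¹) := by
    rw [hk]
    generalize ((v ^ k : ℂˣ) : ℂ) = t at *
    generalize (v : ℂ) = z at *
    simp at d12
    field_simp at d12
    field_simp
    linear_combination d12
  have k2 : (P * S - 1) * ((((v ^ (2 * k - 1) : ℂˣ) : ℂ)) ^ 2 - 1) = 0 := by
    rw [hk]
    generalize ((v ^ k : ℂˣ) : ℂ) = t at *
    generalize (v : ℂ) = z at *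
    simp at d11
    field_simp at d11
    field_simp
    linear_combination -d11
  have main : ((v ^ (2 * k - 1) : ℂˣ) : ℂ) ^ 2 = 1 := by
    rcases mul_eq_zero.1 k2 with hR | hR
    · have hPS := D.PS
      have hQ := D.Q
      by_contra hc
      have him := im_ne hn hc
      rw [hPS, hQ] at key
      have := congrArg Complex.re key
      simp at this
      rcases this with h | h
      · exact him (by simpa using h)
      · rw [h] at hPS
        simp at hPS
        have e : (l - l⁻¹) ^ 2 = 0 := by
          have hi : l * l⁻¹ = 1 := mul_inv_cancel₀ D.l0
          linear_combination (P - S) * hPS + 4 * hR - (P + S + (l + l⁻¹)) * D.hX - 4 * hi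
        have e2 := pow_eq_zero_iff (two_ne_zero) |>.1 e
        apply D.l2
        have hi : l * l⁻¹ = 1 := mul_inv_cancel₀ D.l0
        linear_combination l * e2 + hi
    · exact sub_eq_zero.1 hR
  refine ⟨main, D.ord_eq ?_, key⟩
  rw [← key]
  linear_combination -(P - S) ^ 2 * main

end

theorem dat_choice (p q r : ℕ) (hp : p ≠ 1) (hq : q ≠ 1) (hr : r ≠ 1) (k : ℤ)
    (h : ¬ (p = 2 ∧ q = 2 ∧ (r : ℤ) ∣ 2 * k - 1)) : ∃ P S v l m, Dat P S v l m ∧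
      orderOf (l ^ 2) = q ∧ orderOf (m ^ 2) = p ∧ orderOf ((v : ℂ) ^ 2) = r ∧
      (Ym P S v).1 * (Vm P S v k).1 ≠ (Vm P S v k).1 * (Ym P S v).1 := by
  obtain ⟨l, nl, ol⟩ := exists_root_order q hq
  obtain ⟨m, nm, om⟩ := exists_root_order p hp
  obtain ⟨v, nv, ov⟩ := exists_root_order r hr
  have l2 : l ^ 2 ≠ 1 := by rw [Ne, ← orderOf_eq_one_iff, ol]; exact hq
  have m2 : m ^ 2 ≠ 1 := by rw [Ne, ← orderOf_eq_one_iff, om]; exact hp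
  have v2 : v ^ 2 ≠ 1 := by rw [Ne, ← orderOf_eq_one_iff, ov]; exact hr
  have v0 : v ≠ 0 := by rintro rfl; simp at nv
  by_cases h1 : p = q ∧ (r : ℤ) ∣ 2 * k - 1
  · obtain ⟨rfl, hr2⟩ := h1
    have hcop : r.Coprime 2 := by
      rw [Nat.coprime_two_right]
      by_contra hc
      rw [Nat.not_odd_iff_even] at hc
      obtain ⟨c, hc⟩ := hc
      obtain ⟨d, hd⟩ := hr2
      rw [hc] at hd
      push_cast at hd
      have : (2 : ℤ) ∣ 1 := ⟨k - c * d, by linarith⟩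
      omega
    have hw2 : (v ^ 2 : ℂ) ≠ 0 := pow_ne_zero 2 v0
    have ow : orderOf ((v ^ 2) ^ 2) = r := by
      rw [Nat.Coprime.orderOf_pow (by rw [ov]; exact hcop), ov]
    have w2 : (v ^ 2) ^ 2 ≠ 1 := by rw [Ne, ← orderOf_eq_one_iff, ow]; exact hr
    obtain ⟨P, S, D⟩ := dat_exists (v := Units.mk0 (v ^ 2) hw2) nl nl (by simp [nv]) l2 l2 (by simpa using w2)
    refine ⟨P, S, _, l, l, D, ol, ol, by simpa using ow, ?_⟩
    intro hc
    obtain ⟨-, -, h3⟩ := D.comm k hc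
    have e : ((Units.mk0 (v ^ 2) hw2) ^ (2 * k - 1) : ℂˣ) = 1 := by
      apply orderOf_dvd_iff_zpow_eq_one.1
      rw [← orderOf_units]
      simpa [ov] using hr2
    rw [e] at h3
    have h4 := D.hX
    have h5 := D.hY
    simp only [Units.val_mk0, Units.val_one] at h3 h5
    have e1 : P * (v ^ 2 - 1) = 0 := by linear_combination (h5 - h3 - h4) / 2
    have e2 : S * (v ^ 2 - 1) = 0 := by
      have : S = S * (v ^ 2)⁻¹ := by linear_combination (-h5 - h3 + h4) / 2
      have h6 : S * v ^ 2 = S := by nth_rewrite 1 [this]; field_simp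
      linear_combination h6
    have e3 := (mul_eq_zero.1 e1).resolve_right (sub_ne_zero.2 v2)
    have e4 := (mul_eq_zero.1 e2).resolve_right (sub_ne_zero.2 v2)
    rw [e3, e4] at h4
    have l0 := D.l0
    have hl : l ^ 2 = -1 := by
      have hi : l * l⁻¹ = 1 := mul_inv_cancel₀ l0
      linear_combination -l * h4 - hi
    apply h
    have : orderOf (l ^ 2) = 2 := by
      rw [hl]; exact orderOf_eq_prime (by norm_num) (by norm_num)
    exact ⟨ol.symm.trans this, ol.symm.trans this, hr2⟩
  · obtain ⟨P, S, D⟩ := dat_exists (v := Units.mk0 v v0) nl nm nv l2 m2 v2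
    refine ⟨P, S, _, l, m, D, ol, om, ov, ?_⟩
    intro hc
    obtain ⟨h2, h3, -⟩ := D.comm k hc
    apply h1
    refine ⟨by rw [← om, ← ol, h3], ?_⟩
    have : ((Units.mk0 v v0) ^ 2 : ℂˣ) ^ (2 * k - 1) = 1 := by
      apply Units.ext
      rw [← zpow_natCast, zpow_comm, zpow_natCast]
      simpa using h2
    have h5 := orderOf_dvd_iff_zpow_eq_one.2 this
    rw [← orderOf_units] at h5
    simpa [ov] using h5

end P59


namespace P59
open Function
universe u v w

/-- constructor -/
noncomputable def mk2 (a b c d : ℂ) (h : a * d - b * c = 1) : SL2 :=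
  ⟨!![a, b; c, d], by rw [Matrix.det_fin_two]; simpa using h⟩

theorem mk2_val (a b c d : ℂ) (h : a * d - b * c = 1) : (mk2 a b c d h).1 = !![a, b; c, d] := rfl

theorem diag_lem (M : SL2) (m : ℂˣ) (hb : M.1 0 1 ≠ 0) (hm : (m : ℂ) ^ 2 ≠ 1)
    (ht : M.1 0 0 + M.1 1 1 = m + (m : ℂ)⁻¹) : ∃ E : SL2, M * E = E * Zh m := by
  have hi : (m : ℂ) * (m : ℂ)⁻¹ = 1 := by simp
  have hd : (m : ℂ)⁻¹ - m ≠ 0 := by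
    intro h; apply hm; linear_combination -(m : ℂ) * h + hi
  have hdet := M.2
  rw [Matrix.det_fin_two] at hdet
  set a := M.1 0 0 with ha
  set b := M.1 0 1 with hb'
  set c := M.1 1 0 with hc
  set d := M.1 1 1 with hd'
  set s := (b * ((m : ℂ)⁻¹ - m))⁻¹ with hs
  have hsb : s * (b * ((m : ℂ)⁻¹ - m)) = 1 := inv_mul_cancel₀ (mul_ne_zero hb hd)
  refine ⟨mk2 b (b * s) (m - a) (((m : ℂ)⁻¹ - a) * s) ?_, ?_⟩
  · linear_combination hsb
  · apply Subtype.ext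
    rw [Matrix.SpecialLinearGroup.coe_mul, Matrix.SpecialLinearGroup.coe_mul, Zh_val, mk2_val]
    generalize (m : ℂ)⁻¹ = n at *
    ext i j
    fin_cases i <;> fin_cases j <;>
      simp [Matrix.mul_apply, Fin.sum_univ_two, ← ha, ← hb', ← hc, ← hd']
    · ring
    · ring
    · linear_combination m * ht - hdet + hi
    · linear_combination s * (n * ht - hdet + hi)

theorem solve_diag (μ : ℂˣ) (hμ : (μ : ℂ) ^ 2 ≠ 1) (N : SL2) (h : N.1 0 1 * N.1 1 0 ≠ 0) :
    ∃ u : SL2, u * Zh μ * u = N * u * Zh μ := by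
  have hi : (μ : ℂ) * (μ : ℂ)⁻¹ = 1 := by simp
  have hd : (μ : ℂ) - (μ : ℂ)⁻¹ ≠ 0 := by
    intro h; apply hμ; linear_combination (μ : ℂ) * h + hi
  have hdet := N.2
  rw [Matrix.det_fin_two] at hdet
  set p := N.1 0 0 with hp
  set q := N.1 0 1 with hq
  set r := N.1 1 0 with hr
  set s := N.1 1 1 with hs
  set n := (μ : ℂ)⁻¹ with hn
  set x := (μ : ℂ) with hx
  set t := p + s with ht
  have hroot : ∃ e : ℂ, e ^ 2 * (t - e) + (e * (t - e) - 1) * (n ^ 2 * (t - e) - x ^ 2 * e - (t - e)) = p := by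
    let cu : Cubic ℂ := ⟨n ^ 2 + x ^ 2 - 2, t * (3 - 2 * n ^ 2 - x ^ 2), t * (n ^ 2 * t - t) - (1 - n ^ 2 - x ^ 2), -(n ^ 2 * t - t) - p⟩
    have ha : cu.a ≠ 0 := by
      have : cu.a = (x - n) ^ 2 := by
        show n ^ 2 + x ^ 2 - 2 = _
        linear_combination 2 * hi
      rw [this]; exact pow_ne_zero 2 hd
    obtain ⟨e, he⟩ := IsAlgClosed.exists_root cu.toPoly (by rw [Cubic.degree_of_a_ne_zero ha]; norm_num)
    refine ⟨e, ?_⟩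
    simp [Polynomial.IsRoot, Cubic.toPoly, cu] at he
    linear_combination he
  obtain ⟨e, he⟩ := hroot
  obtain ⟨h1, hh1⟩ : ∃ y, y = t - e := ⟨_, rfl⟩
  obtain ⟨w, hw⟩ : ∃ y, y = e * h1 - 1 := ⟨_, rfl⟩
  obtain ⟨D, hD⟩ : ∃ y, y = -e^2 - w * n ^ 2 + e ^ 2 * x ^ 2 + e * h1 := ⟨_, rfl⟩
  obtain ⟨D', hD'⟩ : ∃ y, y = e * h1 + h1 ^ 2 * n ^ 2 - w * x ^ 2 - h1 ^ 2 := ⟨_, rfl⟩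
  rw [← hh1, ← hw] at he
  have he2 : w * (-e - h1 * n ^ 2 + e * x ^ 2) + e * h1 ^ 2 = s := by
    linear_combination -he + hh1 + ht - (e + h1) * hw
  have hi2 : x ^ 2 * n ^ 2 = 1 := by
    linear_combination (x * n + 1) * hi
  have hprod : w * D * D' = q * r := by
    have e1 : (e ^ 2 * h1 + w * (n ^ 2 * h1 - x ^ 2 * e - h1)) * (w * (-e - h1 * n ^ 2 + e * x ^ 2) + e * h1 ^ 2) - w * D * D' = (e * h1 - w) ^ 3 := by
      rw [hD, hD']
      generalize n ^ 2 = n2 at *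
      generalize x ^ 2 = x2 at *
      linear_combination (-w^3 +2 * w ^ 2 * e * h1- w * e ^ 2 * h1 ^ 2 ) * hi2 
    rw [he, he2] at e1
    have : (e * h1 - w) = 1 := by rw [hw]; ring
    rw [this] at e1
    linear_combination hdet - e1
  have hq0 : q ≠ 0 := left_ne_zero_of_mul h
  have hD0 : D ≠ 0 := by
    rintro hz; rw [hz] at hprod; apply h; rw [← hprod]; ring
  have hqi : q * q⁻¹ = 1 := mul_inv_cancel₀ hq0
  have hDi : D * D⁻¹ = 1 := mul_inv_cancel₀ hD0
  set f := q * D⁻¹ with hf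
  set g := w * D * q⁻¹ with hg
  have hfD : f * D = q := by rw [hf]; linear_combination q * hDi
  have hgD : g * D' = r := by rw [hg]; linear_combination q⁻¹ * hprod + r * hqi
  have hfg : f * g = w := by rw [hf, hg]; linear_combination w * q * q⁻¹ * hDi + w * hqi
  have hdu : e * h1 - f * g = 1 := by rw [hfg, hw]; ring
  refine ⟨mk2 e f g h1 hdu, ?_⟩
  · rw [← mul_inv_eq_iff_eq_mul, ← mul_inv_eq_iff_eq_mul, ← map_inv]
    apply Subtype.ext
    rw [Matrix.SpecialLinearGroup.coe_mul, Matrix.SpecialLinearGroup.coe_mul, Matrix.SpecialLinearGroup.coe_mul, Matrix.SpecialLinearGroup.coe_mul, Zh_val, Zh_val, Matrix.SpecialLinearGroup.coe_inv, mk2_val, Matrix.adjugate_fin_two, Units.val_inv_eq_inv_val, inv_inv, ← hx, ← hn]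
    ext i j
    fin_cases i <;> fin_cases j <;>
      simp [Matrix.mul_apply, Fin.sum_univ_two]
    · rw [← hp, ← he, ← hfg]
      linear_combination (e ^ 2 * h1 - e * f * g * 0 - f * g * h1) * hi
    · rw [← hq, ← hfD, hD, ← hfg]
      linear_combination (- e ^ 2 * f + e * f * h1) * hi
    · rw [← hr, ← hgD, hD', ← hfg]
      linear_combination (e * g * h1 - g * h1 ^ 2) * hi
    · rw [← hs, ← he2, ← hfg]
      linear_combination (-e * f * g + e * h1 ^ 2) * hi


theorem grp_solve {H : Type u} [Group H] (Y V h : H) (i j : ℤ)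
    (hh : h * h * (Y ^ j)⁻¹ * h⁻¹ = (V ^ i)⁻¹) :
    ∃ x y : H, (∃ g, x = g * V * g⁻¹) ∧ (∃ g, y = g * Y * g⁻¹) ∧ x ^ i * y * (x ^ i)⁻¹ = Y ∧
      y ^ j * x * (y ^ j)⁻¹ = V := by
  have hY : Y ^ j = h⁻¹ * V ^ i * h * h := by
    have := congrArg (fun t => t⁻¹) hh
    simp only [mul_inv_rev, inv_inv] at this
    rw [← this]; group
  have hx : (h⁻¹ * V * h) ^ i = h⁻¹ * V ^ i * h := by
    have := conj_zpow (i := i) (a := h⁻¹) (b := V)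
    simpa using this
  refine ⟨h⁻¹ * V * h, ((h⁻¹ * V * h) ^ i)⁻¹ * Y * (h⁻¹ * V * h) ^ i, ⟨h⁻¹, by group⟩, ⟨((h⁻¹ * V * h) ^ i)⁻¹, by group⟩, by group, ?_⟩
  have e : (((h⁻¹ * V * h) ^ i)⁻¹ * Y * (h⁻¹ * V * h) ^ i) ^ j = ((h⁻¹ * V * h) ^ i)⁻¹ * Y ^ j * (h⁻¹ * V * h) ^ i := by
    have := conj_zpow (i := j) (a := ((h⁻¹ * V * h) ^ i)⁻¹) (b := Y)
    simpa using this
  rw [e, hx, hY]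
  group

theorem orderOf_conj' {H : Type u} [Group H] (g x : H) : orderOf (g * x * g⁻¹) = orderOf x := by
  have := orderOf_injective (MulAut.conj g).toMonoidHom (MulAut.conj g).injective x
  simpa using this

/-- triangle groups with conditions -/
theorem tri_group (p q r : ℕ) (hp : p ≠ 1) (hq : q ≠ 1) (hr : r ≠ 1) (k : ℤ)
    (h : ¬ (p = 2 ∧ q = 2 ∧ (r : ℤ) ∣ 2 * k - 1)) : ∃ (K : Type) (_ : Group K) (X Y Z : K),
      orderOf X = q ∧ orderOf Y = p ∧ orderOf Z = r ∧ Y * X * Z = 1 ∧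
      (∀ a b : ℤ, X ^ a = Z ^ b → X ^ a = 1) ∧ (∀ a b : ℤ, Y ^ a = Z ^ b → Y ^ a = 1) ∧
      (∀ a b : ℤ, Y ^ a = (Z ^ (-k) * X * Z ^ k) ^ b → Y ^ a = 1) := by
  obtain ⟨P, S, v, l, m, D, ol, om, ov, hne⟩ := dat_choice p q r hp hq hr k h
  refine ⟨PS2, inferInstance, pr (Xm P S), pr (Ym P S v), pr (Zh v), ?_, ?_, ?_, ?_, ?_, ?_, ?_⟩
  · rw [ordX P S l D.l0 D.l2 D.hX, ol]
  · rw [ordY P S v m D.m0 D.m2 D.hY, om]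
  · rw [ordZ v D.v2, ov]
  · rw [← map_mul, ← map_mul, YXZ, map_one]
  · exact XZ_inter P S v D.v2
  · exact YZ_inter P S v D.v2
  · intro a b hab
    by_contra hc
    apply hne
    apply commute_of_pow _ _ a b _ hc
    rw [hab]
    simp [Vm]

theorem pr_zpow_span (M : SL2) (n : ℤ) (h : pr M ^ n ≠ 1) : ∃ k k' : ℂ, k ≠ 0 ∧
    (M ^ n).1 = k • M.1 + k' • (1 : Matrix (Fin 2) (Fin 2) ℂ) := by
  obtain ⟨k, k', hk⟩ := sl_span M n
  refine ⟨k, k', ?_, hk⟩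
  rintro rfl
  apply h
  rw [← map_zpow, pr_eq_one_iff, hk]
  simp

theorem diag_comm_det (μ : ℂˣ) (N : SL2) (hc : N.1 0 1 * N.1 1 0 = 0) :
    ((Zh μ).1 * N.1 - N.1 * (Zh μ).1).det = 0 := by
  rw [Matrix.det_fin_two, Zh_val]
  simp only [Matrix.sub_apply, Matrix.mul_apply, Fin.sum_univ_two]
  generalize N.1 0 1 = a at *
  generalize N.1 1 0 = b at *
  generalize N.1 0 0 = c at *
  generalize N.1 1 1 = d at *
  simp only [Matrix.cons_val', Matrix.cons_val_zero, Matrix.cons_val_one, Matrix.of_apply,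
          Matrix.cons_val_fin_one]
  linear_combination ((μ : ℂ) - (μ : ℂ)⁻¹) ^ 2 * hc

theorem two_c (p q r : ℕ) (hp : p ≠ 1) (hq : q ≠ 1) (hr : r ≠ 1) (hpq : p ≠ q) (k i j : ℤ)
    (hi : ¬ (q : ℤ) ∣ i) (hj : ¬ (p : ℤ) ∣ j) :
    ∃ (K : Type) (_ : Group K) (x y z : K),
      orderOf x = q ∧ orderOf y = p ∧ orderOf z = r ∧
      z ^ (1 - k) * (x ^ i * y * (x ^ i)⁻¹) * z ^ k * (y ^ j * x * (y ^ j)⁻¹) = 1 := by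
  obtain ⟨P, S, v, l, m, D, ol, om, ov, -⟩ := dat_choice p q r hp hq hr k (by omega)
  by_cases hR : P * S - 1 = 0
  · have hPS : P * S = 1 := sub_eq_zero.1 hR
    have P0 : P ≠ 0 := by rintro rfl; simp at hPS
    have hS : S = P⁻¹ := eq_inv_of_mul_eq_one_right hPS
    have h1 : orderOf (P ^ 2) = q := by
      rw [order_of_trace (m := l) P0 D.l0 (by rw [← D.hX, hS]), ol]
    have h2 : orderOf ((P * v) ^ 2) = p := by
      rw [order_of_trace (m := m) (mul_ne_zero P0 v.ne_zero) D.m0 (by rw [← D.hY, hS, mul_inv]), om]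
    refine ⟨ℂˣ, inferInstance, Units.mk0 P P0 ^ 2, ((Units.mk0 P P0 * v) ^ 2)⁻¹, v ^ 2, ?_, ?_, ?_, ?_⟩
    · rw [← orderOf_units]; simpa using h1
    · rw [orderOf_inv, ← orderOf_units]; simpa using h2
    · rw [← orderOf_units]; simpa using ov
    · generalize Units.mk0 P P0 = x
      rw [mul_comm (_ ^ i), mul_comm (_ ^ j), mul_inv_cancel_right, mul_inv_cancel_right, mul_right_comm (_ ^ (1 - k)), ← zpow_add]
      simp [mul_pow]
  · have hdet : ((Ym P S v).1 * (Vm P S v k).1 - (Vm P S v k).1 * (Ym P S v).1).det ≠ 0 := by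
      rw [comm_det]
      apply mul_ne_zero hR
      intro hb
      apply hpq
      rw [← om, ← ol, D.brace k hb]
    have oX := ordX P S l D.l0 D.l2 D.hX
    have oY := ordY P S v m D.m0 D.m2 D.hY
    have oZ := ordZ v D.v2
    rw [ol] at oX
    rw [om] at oY
    rw [ov] at oZ
    set Y := Ym P S v with hYd
    set V := Vm P S v k with hVd
    have hVc : pr V = pr (Zh v) ^ (-k) * pr (Xm P S) * pr (Zh v) ^ k := by
      rw [hVd]; simp [Vm]
    have oV : orderOf (pr V) = q := by
      rw [hVc, zpow_neg, ← oX]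
      have := orderOf_conj' (pr (Zh v) ^ k)⁻¹ (pr (Xm P S))
      rwa [inv_inv] at this
    have hYj : pr Y ^ j ≠ 1 := by
      rw [Ne, ← orderOf_dvd_iff_zpow_eq_one, oY]; exact hj
    have hVi : pr V ^ (-i) ≠ 1 := by
      rw [Ne, ← orderOf_dvd_iff_zpow_eq_one, oV, dvd_neg]; exact hi
    obtain ⟨E, hE⟩ := diag_lem Y (Units.mk0 m D.m0) (by simp [hYd, Ym]) (by simpa using D.m2)
      (by
        have := D.hY
        rw [add_comm] at this
        simpa [hYd, Ym] using this)
    have hE' : Y = E * Zh (Units.mk0 m D.m0) * E⁻¹ := by rw [← hE]; group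
    have hYjE : Y ^ j = E * Zh (Units.mk0 m D.m0 ^ j) * E⁻¹ := by
      rw [hE', conj_zpow, map_zpow]
    set μ := Units.mk0 m D.m0 ^ j with hμ
    have hμ2 : (μ : ℂ) ^ 2 ≠ 1 := by
      intro hc
      apply hYj
      have h1 : pr (Zh μ) = 1 := by
        rw [pr_eq_one_iff, Zh_val]
        refine ⟨rfl, rfl, ?_⟩
        simp only [Matrix.cons_val', Matrix.cons_val_zero, Matrix.cons_val_one, Matrix.of_apply,
          Matrix.cons_val_fin_one]
        exact eq_inv_of_mul_eq_one_left (by rw [← pow_two]; exact hc)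
      rw [← map_zpow, hYjE, map_mul, map_mul, h1, mul_one, ← map_mul, mul_inv_cancel, map_one]
    obtain ⟨a, a', ha, hae⟩ := pr_zpow_span Y j hYj
    obtain ⟨b, b', hb, hbe⟩ := pr_zpow_span V (-i) hVi
    set N := E⁻¹ * V ^ (-i) * E with hN
    have hq0 : N.1 0 1 * N.1 1 0 ≠ 0 := by
      intro hc
      have e1 : ((Zh μ).1 * N.1 - N.1 * (Zh μ).1).det = 0 := by
        exact diag_comm_det μ N hc
      have e2 : ((Y ^ j).1 * (V ^ (-i)).1 - (V ^ (-i)).1 * (Y ^ j).1) =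
          E.1 * ((Zh μ).1 * N.1 - N.1 * (Zh μ).1) * (E⁻¹).1 := by
        rw [mul_sub, sub_mul]
        simp only [← Matrix.SpecialLinearGroup.coe_mul]
        have w1 : Y ^ j * V ^ (-i) = E * (Zh μ * N) * E⁻¹ := by rw [hYjE, hN]; group
        have w2 : V ^ (-i) * Y ^ j = E * (N * Zh μ) * E⁻¹ := by rw [hYjE, hN]; group
        rw [w1, w2]
      have e3 : ((Y ^ j).1 * (V ^ (-i)).1 - (V ^ (-i)).1 * (Y ^ j).1) = (a * b) • (Y.1 * V.1 - V.1 * Y.1) := by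
        rw [hae, hbe]
        simp only [add_mul, mul_add, smul_mul_assoc, mul_smul_comm, one_mul, mul_one, smul_sub, smul_smul]
        ext s t
        simp only [Matrix.add_apply, Matrix.sub_apply, Matrix.smul_apply, smul_eq_mul]
        ring
      have e4 := congrArg Matrix.det (e3.symm.trans e2)
      rw [Matrix.det_mul, Matrix.det_mul, e1, Matrix.det_smul] at e4
      simp [ha, hb] at e4
      exact hdet e4
    obtain ⟨u, hu⟩ := solve_diag μ hμ2 N hq0
    have hh : (E * u * E⁻¹ * Y ^ j) * (E * u * E⁻¹ * Y ^ j) * (Y ^ j)⁻¹ * (E * u * E⁻¹ * Y ^ j)⁻¹ = (V ^ i)⁻¹ := by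
      rw [hYjE]
      have : E * (u * Zh μ * u * (Zh μ)⁻¹ * u⁻¹) * E⁻¹ = (V ^ i)⁻¹ := by
        rw [hu, hN]; group
      rw [← this]; group
    have hh' := congrArg pr hh
    simp only [map_mul, map_inv, map_zpow] at hh'
    obtain ⟨x, y, ⟨g, hg⟩, ⟨g', hg'⟩, h1, h2⟩ := grp_solve (pr Y) (pr V) (pr (E * u * E⁻¹ * Y ^ j)) i j (by
      simpa only [map_mul, map_inv, map_zpow] using hh')
    refine ⟨PS2, inferInstance, x, y, pr (Zh v), ?_, ?_, oZ, ?_⟩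
    · rw [hg, orderOf_conj', oV]
    · rw [hg', orderOf_conj', oY]
    · rw [h1, h2, hVc]
      have hyx : pr Y * pr (Xm P S) * pr (Zh v) = 1 := by
        rw [← map_mul, ← map_mul, YXZ, map_one]
      have : pr Y * pr (Xm P S) = (pr (Zh v))⁻¹ := eq_inv_of_mul_eq_one_left hyx
      calc _ = pr (Zh v) ^ (1 - k) * (pr Y * pr (Xm P S)) * pr (Zh v) ^ k := by group
        _ = 1 := by rw [this]; group

end P59


namespace P59
open Function
universe u v w

/-- A nontrivial solution. -/
def Sol {A B C : Type u} [Group A] [Group B] [Group C] (α α₁ α₂ : A) (β β₁ β₂ : B) (c₁ c₂ : C) : Prop :=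
  ∃ (K : Type u) (_ : Group K) (fA : A →* K) (fB : B →* K) (fC : C →* K),
    ((∃ a, fA a ≠ 1) ∨ (∃ b, fB b ≠ 1)) ∧
    fC c₁ * (fA α * fB β * fA α₁) * fC c₂ * (fB β₁ * fA α₂ * fB β₂) = 1

theorem Sol.swap {A B C : Type u} [Group A] [Group B] [Group C] {α α₁ α₂ : A} {β β₁ β₂ : B} {c₁ c₂ : C}
    (h : Sol β₁ β₂ β α₂ α α₁ c₂ c₁) : Sol α α₁ α₂ β β₁ β₂ c₁ c₂ := by
  obtain ⟨K, _, fB, fA, fC, hn, h⟩ := h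
  refine ⟨K, _, fA, fB, fC, hn.symm, ?_⟩
  rw [mul_assoc, mul_eq_one_comm] at h
  rw [mul_assoc]
  exact h

theorem tri_group' (p q r : ℕ) (hp : p ≠ 1) (hq : q ≠ 1) (hr : r ≠ 1) (k : ℤ)
    (h : ¬ (p = 2 ∧ q = 2 ∧ (r : ℤ) ∣ 2 * k - 1)) : ∃ (K : Type u) (_ : Group K) (X Y Z : K),
      orderOf X = q ∧ orderOf Y = p ∧ orderOf Z = r ∧ Y * X * Z = 1 ∧
      (∀ a b : ℤ, X ^ a = Z ^ b → X ^ a = 1) ∧ (∀ a b : ℤ, Y ^ a = Z ^ b → Y ^ a = 1) ∧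
      (∀ a b : ℤ, Y ^ a = (Z ^ (-k) * X * Z ^ k) ^ b → Y ^ a = 1) := by
  obtain ⟨K, _, X, Y, Z, h1, h2, h3, h4, h5, h6, h7⟩ := tri_group p q r hp hq hr k h
  let e : K ≃* ULift.{u} K := MulEquiv.ulift.symm
  have ho : ∀ x, orderOf (e x) = orderOf x := fun x => orderOf_injective e.toMonoidHom e.injective x
  refine ⟨ULift.{u} K, inferInstance, e X, e Y, e Z, by rw [ho, h1], by rw [ho, h2], by rw [ho, h3], ?_, ?_, ?_, ?_⟩
  · rw [← map_mul, ← map_mul, h4, map_one]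
  · intro a b hab
    rw [← map_zpow, ← map_zpow] at hab
    rw [← map_zpow, h5 a b (e.injective hab), map_one]
  · intro a b hab
    rw [← map_zpow, ← map_zpow] at hab
    rw [← map_zpow, h6 a b (e.injective hab), map_one]
  · intro a b hab
    rw [← map_zpow, ← map_zpow, ← map_zpow, ← map_mul, ← map_mul, ← map_zpow] at hab
    rw [← map_zpow, h7 a b (e.injective hab), map_one]

theorem two_c' (p q r : ℕ) (hp : p ≠ 1) (hq : q ≠ 1) (hr : r ≠ 1) (hpq : p ≠ q) (k i j : ℤ)
    (hi : ¬ (q : ℤ) ∣ i) (hj : ¬ (p : ℤ) ∣ j) :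
    ∃ (K : Type u) (_ : Group K) (x y z : K),
      orderOf x = q ∧ orderOf y = p ∧ orderOf z = r ∧
      z ^ (1 - k) * (x ^ i * y * (x ^ i)⁻¹) * z ^ k * (y ^ j * x * (y ^ j)⁻¹) = 1 := by
  obtain ⟨K, _, X, Y, Z, h1, h2, h3, h4⟩ := two_c p q r hp hq hr hpq k i j hi hj
  let e : K ≃* ULift.{u} K := MulEquiv.ulift.symm
  have ho : ∀ x, orderOf (e x) = orderOf x := fun x => orderOf_injective e.toMonoidHom e.injective x
  refine ⟨ULift.{u} K, inferInstance, e X, e Y, e Z, by rw [ho, h1], by rw [ho, h2], by rw [ho, h3], ?_⟩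
  have := congrArg e h4
  simpa only [map_mul, map_zpow, map_inv, map_one] using this

/-! ### The pair in a free product -/

section
variable {A B K : Type u} [Group A] [Group B] [Group K] {i1 : A →* K} {i2 : B →* K} {S1 S2 : Set K}

theorem pp_pos (h5 : ∀ k, k ≠ 1 → i2 k ∈ S2) (h4 : ∀ k, k ≠ 1 → i1 k ∈ S1)
    (h6 : ∀ k, k ≠ 1 → ∀ s ∈ S2, i1 k * s ∈ S1)
    (h7 : ∀ k, k ≠ 1 → ∀ s ∈ S1, i2 k * s ∈ S2)
    (a a' : A) (b : B) (ha : a ≠ 1) (ha' : a' ≠ 1) (hb : b ≠ 1) (haa : a' * a ≠ 1)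
    (t : K) (ht : t ∈ S2 ∨ t = 1) (n : ℕ) :
    ∃ t' ∈ S2, (i1 a * i2 b * i1 a') ^ (n + 1) * t = i1 a * t' := by
  induction n with
  | zero =>
    refine ⟨i2 b * (i1 a' * t), h7 _ hb _ ?_, by simp only [zero_add, pow_one, mul_assoc]⟩
    rcases ht with ht | rfl
    · exact h6 _ ha' _ ht
    · rw [mul_one]; exact h4 _ ha'
  | succ n ih =>
    obtain ⟨t', ht', e⟩ := ih
    refine ⟨i2 b * (i1 (a' * a) * t'), h7 _ hb _ (h6 _ haa _ ht'), ?_⟩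
    rw [pow_succ', mul_assoc, e, map_mul]
    simp only [mul_assoc]

theorem pp_UV (h5 : ∀ k, k ≠ 1 → i2 k ∈ S2) (h4 : ∀ k, k ≠ 1 → i1 k ∈ S1)
    (h6 : ∀ k, k ≠ 1 → ∀ s ∈ S2, i1 k * s ∈ S1)
    (h7 : ∀ k, k ≠ 1 → ∀ s ∈ S1, i2 k * s ∈ S2)
    (a a' : A) (b : B) (ha : a ≠ 1) (ha' : a' ≠ 1) (hb : b ≠ 1)
    (t : K) (ht : t ∈ S2 ∨ t = 1) (n : ℤ) (hn : (i1 a * i2 b * i1 a') ^ n ≠ 1) :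
    (i1 a * i2 b * i1 a') ^ n * t ∈ S1 := by
  by_cases haa : a' * a = 1
  · have hinv : a' = a⁻¹ := eq_inv_of_mul_eq_one_left haa
    subst hinv
    rw [map_inv, conj_zpow, ← map_zpow] at hn ⊢
    have hbn : b ^ n ≠ 1 := by
      intro h; apply hn; rw [h, map_one]; group
    rw [mul_assoc, mul_assoc]
    apply h6 _ ha
    apply h7 _ hbn
    rw [← map_inv]
    rcases ht with ht | rfl
    · exact h6 _ ha' _ ht
    · rw [mul_one]; exact h4 _ ha'
  · obtain ⟨m, rfl | rfl⟩ := n.eq_nat_or_neg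
    · rcases m with _ | m
      · simp at hn
      · obtain ⟨t', ht', e⟩ := pp_pos h5 h4 h6 h7 a a' b ha ha' hb haa t ht m
        rw [zpow_natCast, e]
        exact h6 _ ha _ ht'
    · rcases m with _ | m
      · simp at hn
      · obtain ⟨t', ht', e⟩ := pp_pos h5 h4 h6 h7 a'⁻¹ a⁻¹ b⁻¹ (inv_ne_one.2 ha') (inv_ne_one.2 ha) (inv_ne_one.2 hb)
          (by
            intro h; apply haa
            rw [← mul_inv_rev, inv_eq_one] at h
            exact h) t ht m
        have e2 : i1 a'⁻¹ * i2 b⁻¹ * i1 a⁻¹ = (i1 a * i2 b * i1 a')⁻¹ := by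
          simp only [map_inv, mul_inv_rev, mul_assoc]
        rw [e2] at e
        rw [zpow_neg, zpow_natCast, ← inv_pow, e]
        exact h6 _ (inv_ne_one.2 ha') _ ht'

theorem pp_inf (h5 : ∀ k, k ≠ 1 → i2 k ∈ S2) (h4 : ∀ k, k ≠ 1 → i1 k ∈ S1)
    (h6 : ∀ k, k ≠ 1 → ∀ s ∈ S2, i1 k * s ∈ S1)
    (h7 : ∀ k, k ≠ 1 → ∀ s ∈ S1, i2 k * s ∈ S2) (h8 : 1 ∉ S1)
    (a a' : A) (b : B) (ha : a ≠ 1) (ha' : a' ≠ 1) (hb : b ≠ 1) (haa : a' * a ≠ 1) :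
    orderOf (i1 a * i2 b * i1 a') = 0 := by
  rw [orderOf_eq_zero_iff']
  intro n hn h
  obtain ⟨t', ht', e⟩ := pp_pos h5 h4 h6 h7 a a' b ha ha' hb haa 1 (Or.inr rfl) (n - 1)
  rw [Nat.sub_add_cancel hn, h, mul_one] at e
  apply h8
  rw [e]
  exact h6 _ ha _ ht'

end

theorem pair_fr {K : Type u} [Group K] (U V : K) (S1 S2 : Set K) (h1 : 1 ∉ S1) (h2 : 1 ∉ S2)
    (hU : ∀ n : ℤ, U ^ n ≠ 1 → ∀ t, t ∈ S2 ∨ t = 1 → U ^ n * t ∈ S1)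
    (hV : ∀ n : ℤ, V ^ n ≠ 1 → ∀ t, t ∈ S1 ∨ t = 1 → V ^ n * t ∈ S2) :
    Fr (ι := Bool) (fun b => bif b then orderOf U else orderOf V) (fun b => bif b then U else V) := by
  apply fr_of_pingpong _ (fun b => bif b then S1 else S2)
  · intro b; cases b <;> simpa
  · intro b n hn
    cases b
    · simpa using hV n hn 1 (Or.inr rfl)
    · simpa using hU n hn 1 (Or.inr rfl)
  · intro b n hn j hj s hs
    cases b <;> cases j <;> simp at hj hs ⊢
    · exact hV n hn s (Or.inl hs)
    · exact hU n hn s (Or.inl hs)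
  · intro b; cases b <;> rfl

/-- the free pair in `A*B` -/
theorem AB_pair {A B : Type u} [Group A] [Group B] (α α₁ α₂ : A) (β β₁ β₂ : B)
    (hα : α ≠ 1) (hα₁ : α₁ ≠ 1) (hα₂ : α₂ ≠ 1) (hβ : β ≠ 1) (hβ₁ : β₁ ≠ 1) (hβ₂ : β₂ ≠ 1) :
    ∃ (K : Type u) (_ : Group K) (i1 : A →* K) (i2 : B →* K), Injective i1 ∧ Injective i2 ∧
      i1 α * i2 β * i1 α₁ ≠ 1 ∧ (β₂ * β₁ ≠ 1 → orderOf (i2 β₁ * i1 α₂ * i2 β₂) = 0) ∧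
      Fr (ι := Bool) (fun b => bif b then orderOf (i1 α * i2 β * i1 α₁) else orderOf (i2 β₁ * i1 α₂ * i2 β₂))
        (fun b => bif b then (i1 α * i2 β * i1 α₁) else (i2 β₁ * i1 α₂ * i2 β₂)) := by
  obtain ⟨K, _, i1, i2, S1, S2, j1, j2, h4, h5, h6, h7, h8, h9, h10⟩ := free_prod A B
  refine ⟨K, inferInstance, i1, i2, j1, j2, fun h => ?_, fun h => ?_, ?_⟩
  · apply h8
    rw [← h, mul_assoc]
    exact h6 _ hα _ (h7 _ hβ _ (h4 _ hα₁))
  · exact pp_inf h4 h5 h7 h6 h9 β₁ β₂ α₂ hβ₁ hβ₂ hα₂ h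
  · apply pair_fr _ _ S1 S2 h8 h9
    · intro n hn t ht
      exact pp_UV h5 h4 h6 h7 α α₁ β hα hα₁ hβ t ht n hn
    · intro n hn t ht
      exact pp_UV h4 h5 h7 h6 β₁ β₂ α₂ hβ₁ hβ₂ hα₂ t ht n hn

theorem case0 {A B C : Type u} [Group A] [Group B] [Group C] (α α₁ α₂ : A) (β β₁ β₂ : B) (c₁ c₂ : C)
    (hα : α ≠ 1) (hα₁ : α₁ ≠ 1) (hα₂ : α₂ ≠ 1) (hβ : β ≠ 1) (hβ₁ : β₁ ≠ 1) (hβ₂ : β₂ ≠ 1)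
    (hc₁ : c₁ ≠ 1) (hc₂ : c₂ ≠ 1) (hc : c₂ * c₁ ≠ 1) (hb : β₂ * β₁ ≠ 1) :
    Sol α α₁ α₂ β β₁ β₂ c₁ c₂ := by
  obtain ⟨K1, _, i1, i2, j1, j2, hU1, hinf, hFr⟩ := AB_pair α α₁ α₂ β β₁ β₂ hα hα₁ hα₂ hβ hβ₁ hβ₂
  replace hinf := hinf hb
  set U := i1 α * i2 β * i1 α₁ with hU
  set V := i2 β₁ * i1 α₂ * i2 β₂ with hV
  obtain ⟨K2, _, k1, k2, S1, S2, l1, l2, h4, h5, h6, h7, h8, h9, h10⟩ := free_prod (Subgroup.zpowers U) C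
  let u : Subgroup.zpowers U := ⟨U, Subgroup.mem_zpowers U⟩
  have ou : orderOf u = orderOf U := Subgroup.orderOf_mk _ _
  have hu1 : u ≠ 1 := by
    intro h
    exact hU1 (congrArg Subtype.val h)
  have oU : orderOf (k1 u) = orderOf U := by rw [orderOf_injective k1 l1, ou]
  have oW : orderOf (k2 c₁ * k1 u * k2 c₂) = 0 := pp_inf h4 h5 h7 h6 h9 c₁ c₂ u hc₁ hc₂ hu1 hc
  have hF2 := pair_fr (k1 u) (k2 c₁ * k1 u * k2 c₂)⁻¹ S1 S2 h8 h9
    (by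
      intro n hn t ht
      rw [← map_zpow] at hn ⊢
      have : u ^ n ≠ 1 := by intro h; rw [h, map_one] at hn; exact hn rfl
      rcases ht with ht | rfl
      · exact h6 _ this _ ht
      · rw [mul_one]; exact h4 _ this)
    (by
      intro n hn t ht
      rw [inv_zpow, ← zpow_neg] at hn ⊢
      exact pp_UV h4 h5 h7 h6 c₁ c₂ u hc₁ hc₂ hu1 t ht (-n) hn)
  rw [orderOf_inv, oW, oU] at hF2
  rw [hinf] at hFr
  obtain ⟨K, _, m1, m2, n1, n2, hm⟩ := glue_fr hFr hF2
  have e1 := hm true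
  have e2 := hm false
  simp only [cond_true, cond_false] at e1 e2
  refine ⟨K, inferInstance, m1.comp i1, m1.comp i2, m2.comp k2, Or.inl ⟨α, ?_⟩, ?_⟩
  · intro h
    exact hα (j1 (n1 (by simpa using h)))
  · simp only [MonoidHom.comp_apply, ← map_mul]
    rw [← hU, ← hV, e1, e2]
    simp only [← map_mul]
    simp

/-- case 1 -/
theorem case1 {A B C : Type u} [Group A] [Group B] [Group C] (α α₂ : A) (β β₁ : B) (c₁ c₂ : C)
    (hα : α ≠ 1) (hα₂ : α₂ ≠ 1) (hβ : β ≠ 1) (hβ₁ : β₁ ≠ 1)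
    (hc : c₂ * c₁ ≠ 1) (hcc : c₂ ∉ Subgroup.zpowers (c₂ * c₁)) :
    Sol α α⁻¹ α₂ β β₁ β₁⁻¹ c₁ c₂ := by
  obtain ⟨K1, _, i1, i2, j1, j2, -, -, hFr⟩ := AB_pair α α⁻¹ α₂ β β₁ β₁⁻¹ hα (inv_ne_one.2 hα) hα₂ hβ hβ₁ (inv_ne_one.2 hβ₁)
  have ne1 : ∀ {H : Type u} [Group H] {x : H}, x ≠ 1 → orderOf x ≠ 1 := fun h => by
    rwa [Ne, orderOf_eq_one_iff]
  obtain ⟨Δ, _, X, Y, Z, oX, oY, oZ, hYXZ, hXZ, hYZ, -⟩ := tri_group'.{u} (orderOf β) (orderOf α₂) (orderOf (c₂ * c₁))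
    (ne1 hβ) (ne1 hα₂) (ne1 hc) 0 (by
      rintro ⟨-, -, h⟩
      have h2 : (orderOf (c₂ * c₁) : ℤ) ∣ 1 := by simpa using h
      have := Int.natCast_dvd_natCast.1 (by simpa using h2 : ((orderOf (c₂ * c₁) : ℕ) : ℤ) ∣ ((1 : ℕ) : ℤ))
      exact ne1 hc (Nat.dvd_one.1 this))
  obtain ⟨K2, _, k1, k2, S1, S2, l1, l2, l3, h4, h5, h6, h7, h8, h9, h10⟩ := glue_cyclic (c₂ * c₁) Z oZ.symm
  have hci : c₂⁻¹ ∉ Subgroup.zpowers (c₂ * c₁) := by rwa [inv_mem_iff]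
  have g1 : ∀ n : ℤ, X ^ n ≠ 1 → X ^ n ∉ Subgroup.zpowers Z := by
    rintro n hn ⟨b, hb⟩
    exact hn (hXZ n b hb.symm)
  have g2 : ∀ n : ℤ, Y ^ n ≠ 1 → Y ^ n ∉ Subgroup.zpowers Z := by
    rintro n hn ⟨b, hb⟩
    exact hn (hYZ n b hb.symm)
  have hF2 := pair_fr (k2 Y) (k1 c₂⁻¹ * k2 X * k1 c₂) S2 {t | k1 c₂ * t ∈ S2} (by simpa using h9 0)
    (by
      intro h
      simp only [Set.mem_setOf_eq, mul_one] at h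
      exact h10 _ (h4 _ hcc) h)
    (by
      intro n hn t ht
      rw [← map_zpow] at hn ⊢
      have hY : Y ^ n ≠ 1 := by intro h; rw [h, map_one] at hn; exact hn rfl
      rcases ht with ht | rfl
      · apply h7 _ (g2 n hY)
        have := h6 _ hci _ ht
        rwa [map_inv, inv_mul_cancel_left] at this
      · rw [mul_one]; exact h5 _ (g2 n hY))
    (by
      intro n hn t ht
      have e : (k1 c₂⁻¹ * k2 X * k1 c₂) ^ n = k1 c₂⁻¹ * k2 (X ^ n) * k1 c₂ := by
        have := conj_zpow (i := n) (a := k1 c₂⁻¹) (b := k2 X)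
        rw [map_inv, inv_inv] at this
        rw [map_inv, this, map_zpow]
      rw [e] at hn ⊢
      have hX : X ^ n ≠ 1 := by
        intro h; apply hn; rw [h, map_one, mul_one, ← map_mul]; simp
      show k1 c₂ * _ ∈ S2
      have : k1 c₂ * (k1 c₂⁻¹ * k2 (X ^ n) * k1 c₂ * t) = k2 (X ^ n) * (k1 c₂ * t) := by
        rw [map_inv]; group
      rw [this]
      apply h7 _ (g1 n hX)
      rcases ht with ht | rfl
      · exact h6 _ hcc _ ht
      · rw [mul_one]; exact h4 _ hcc)
  have q1 : orderOf (i1 α * i2 β * i1 α⁻¹) = orderOf (k2 Y) := by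
    rw [map_inv, orderOf_conj', orderOf_injective i2 j2, orderOf_injective k2 l2, oY]
  have q2 : orderOf (i2 β₁ * i1 α₂ * i2 β₁⁻¹) = orderOf (k1 c₂⁻¹ * k2 X * k1 c₂) := by
    have : k1 c₂⁻¹ * k2 X * k1 c₂ = k1 c₂⁻¹ * k2 X * (k1 c₂⁻¹)⁻¹ := by rw [map_inv, inv_inv]
    rw [map_inv, orderOf_conj', this, orderOf_conj', orderOf_injective i1 j1, orderOf_injective k2 l2, oX]
  rw [q1, q2] at hFr
  obtain ⟨K, _, m1, m2, n1, n2, hm⟩ := glue_fr hFr hF2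
  have e1 := hm true
  have e2 := hm false
  simp only [cond_true, cond_false] at e1 e2
  refine ⟨K, inferInstance, m1.comp i1, m1.comp i2, m2.comp k1, Or.inl ⟨α, ?_⟩, ?_⟩
  · intro h
    exact hα (j1 (n1 (by simpa using h)))
  · simp only [MonoidHom.comp_apply, ← map_mul] at e1 e2 ⊢
    rw [e1, e2]
    simp only [← map_mul]
    have hz : Y * X = Z⁻¹ := eq_inv_of_mul_eq_one_left hYXZ
    have : k1 c₁ * k2 Y * k1 c₂ * (k1 c₂⁻¹ * k2 X * k1 c₂) = 1 := by
      calc _ = k1 c₁ * (k2 (Y * X)) * k1 c₂ := by rw [map_inv, map_mul]; group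
        _ = 1 := by rw [hz, map_inv, ← l3, map_mul]; group
    rw [this, map_one]

end P59


namespace P59
open Function
universe u v w

/-- the set `X_t` of lemma T -/
def XT {H K : Type u} [Group H] [Group K] (i : H →* K) (t g : H) (S : Set K) : Set K :=
  {z | ∃ n : ℤ, t ^ n ≠ 1 ∧ ∃ y, (y ∈ S ∨ (i g)⁻¹ * y ∈ S ∨ y = 1) ∧ z = i (t ^ n) * y}

theorem lemT {H : Type u} [Group H] (t g : H) (hg : g ∉ Subgroup.zpowers t) :
    ∃ (K : Type u) (_ : Group K) (i : H →* K) (s : K), Injective i ∧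
      ∀ σ : Equiv.Perm (Fin 3), Fr (fun _ : Fin 3 => orderOf t)
        (fun j => ![s, i t, i g * s * (i g)⁻¹] (σ j)) := by
  obtain ⟨K, _, i1, i2, S1, S2, j1, j2, h4, h5, h6, h7, h8, h9, h10⟩ := free_prod H (Subgroup.zpowers t)
  let s0 : Subgroup.zpowers t := ⟨t, Subgroup.mem_zpowers t⟩
  have os : orderOf s0 = orderOf t := Subgroup.orderOf_mk _ _
  have oS : orderOf (i2 s0) = orderOf t := by rw [orderOf_injective i2 j2, os]
  have hg1 : g ≠ 1 := by rintro rfl; exact hg (one_mem _)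
  have hg1' : g⁻¹ ≠ 1 := inv_ne_one.2 hg1
  have htg : ∀ n : ℤ, t ^ n * g ≠ 1 := by
    intro n h
    apply hg
    rw [eq_inv_of_mul_eq_one_right h]
    exact inv_mem (Subgroup.zpow_mem_zpowers t n)
  have hgt : ∀ n : ℤ, g⁻¹ * t ^ n ≠ 1 := by
    intro n h
    apply hg
    rw [← inv_inv g, eq_inv_of_mul_eq_one_left h, inv_inv]
    exact (Subgroup.zpow_mem_zpowers t n)
  have hgtg : ∀ n : ℤ, t ^ n ≠ 1 → g⁻¹ * t ^ n * g ≠ 1 := by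
    intro n hn h
    apply hn
    have : t ^ n = g * (g⁻¹ * t ^ n * g) * g⁻¹ := by group
    rw [this, h]; group
  have ez : ∀ n : ℤ, (i1 g * i2 s0 * (i1 g)⁻¹) ^ n = i1 g * i2 (s0 ^ n) * (i1 g)⁻¹ := by
    intro n; rw [conj_zpow, map_zpow]
  refine ⟨K, inferInstance, i1, i2 s0, j1, fun σ => ?_⟩
  -- sets
  set X : Fin 3 → Set K := ![S2, XT i1 t g S2, {z | (i1 g)⁻¹ * z ∈ S2}] with hX
  have key0 : ∀ z, (z ∈ XT i1 t g S2 ∨ (i1 g)⁻¹ * z ∈ S2) → z ∈ S1 := by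
    rintro z (⟨n, hn, y, hy, rfl⟩ | hz)
    · rcases hy with hy | hy | rfl
      · exact h6 _ hn _ hy
      · have := h6 _ (htg n) _ hy
        rwa [map_mul, mul_assoc, mul_inv_cancel_left] at this
      · rw [mul_one]; exact h4 _ hn
    · have := h6 _ hg1 _ hz
      rwa [mul_inv_cancel_left] at this
  have key2 : ∀ z, (z ∈ XT i1 t g S2 ∨ z ∈ S2) → (i1 g)⁻¹ * z ∈ S1 := by
    rintro z (⟨n, hn, y, hy, rfl⟩ | hz)
    · rw [← mul_assoc, ← map_inv, ← map_mul]
      rcases hy with hy | hy | rfl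
      · exact h6 _ (hgt n) _ hy
      · have := h6 _ (hgtg n hn) _ hy
        rwa [map_mul, mul_assoc, mul_inv_cancel_left] at this
      · rw [mul_one]; exact h4 _ (hgt n)
    · rw [← map_inv]; exact h6 _ hg1' _ hz
  have base : (∀ i, (1 : K) ∉ X i) ∧
      (∀ (i : Fin 3) (n : ℤ), (![i2 s0, i1 t, i1 g * i2 s0 * (i1 g)⁻¹] i) ^ n ≠ 1 → (![i2 s0, i1 t, i1 g * i2 s0 * (i1 g)⁻¹] i) ^ n ∈ X i) ∧
      (∀ (i : Fin 3) (n : ℤ), (![i2 s0, i1 t, i1 g * i2 s0 * (i1 g)⁻¹] i) ^ n ≠ 1 → ∀ j, j ≠ i → ∀ s ∈ X j, (![i2 s0, i1 t, i1 g * i2 s0 * (i1 g)⁻¹] i) ^ n * s ∈ X i) := by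
    refine ⟨?_, ?_, ?_⟩
    · intro i
      fin_cases i
      · exact h9
      · intro h
        exact h8 (key0 1 (Or.inl h))
      · intro h
        exact h8 (key0 1 (Or.inr h))
    · intro i n hn
      fin_cases i
      · change i2 s0 ^ n ≠ 1 at hn
        change i2 s0 ^ n ∈ S2
        rw [← map_zpow] at hn ⊢
        exact h5 _ (fun h => hn (by rw [h, map_one]))
      · change i1 t ^ n ≠ 1 at hn
        change i1 t ^ n ∈ XT i1 t g S2
        rw [← map_zpow] at hn ⊢
        exact ⟨n, (fun h => hn (by rw [h, map_one])), 1, Or.inr (Or.inr rfl), (mul_one _).symm⟩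
      · change (i1 g * i2 s0 * (i1 g)⁻¹) ^ n ≠ 1 at hn
        change (i1 g)⁻¹ * (i1 g * i2 s0 * (i1 g)⁻¹) ^ n ∈ S2
        rw [ez] at hn ⊢
        rw [mul_assoc, inv_mul_cancel_left, ← map_inv]
        exact h7 _ (fun h => hn (by rw [h, map_one]; simp)) _ (h4 _ hg1')
    · intro i n hn j hj z hz
      fin_cases i
      · change i2 s0 ^ n ≠ 1 at hn
        change i2 s0 ^ n * z ∈ S2
        rw [← map_zpow] at hn ⊢
        apply h7 _ (fun h => hn (by rw [h, map_one]))
        apply key0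
        fin_cases j
        · exact absurd rfl hj
        · exact Or.inl hz
        · exact Or.inr hz
      · change i1 t ^ n ≠ 1 at hn
        change i1 t ^ n * z ∈ XT i1 t g S2
        rw [← map_zpow] at hn ⊢
        refine ⟨n, (fun h => hn (by rw [h, map_one])), z, ?_, rfl⟩
        fin_cases j
        · exact Or.inl hz
        · exact absurd rfl hj
        · exact Or.inr (Or.inl hz)
      · change (i1 g * i2 s0 * (i1 g)⁻¹) ^ n ≠ 1 at hn
        change (i1 g)⁻¹ * ((i1 g * i2 s0 * (i1 g)⁻¹) ^ n * z) ∈ S2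
        rw [ez] at hn ⊢
        rw [mul_assoc, mul_assoc, inv_mul_cancel_left]
        apply h7 _ (fun h => hn (by rw [h, map_one]; simp))
        apply key2
        fin_cases j
        · exact Or.inr hz
        · exact Or.inl hz
        · exact absurd rfl hj
  obtain ⟨b1, b2, b3⟩ := base
  apply fr_of_pingpong _ (fun j => X (σ j)) (fun j => b1 _) (fun j => b2 _)
    (fun j n hn k hk => b3 _ n hn _ (fun h => hk (σ.injective h)))
  intro j
  generalize σ j = j
  fin_cases j
  · exact oS
  · exact orderOf_injective i1 j1 t
  · exact (orderOf_conj' _ _).trans oS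

/-- case 2a -/
theorem case2a {A B C : Type u} [Group A] [Group B] [Group C] (a x : A) (y b : B) (c : C) (k k0 : ℤ)
    (hx : x ≠ 1) (hy : y ≠ 1) (hc : c ≠ 1) (hb : b ≠ 1) (ha : a ∉ Subgroup.zpowers x)
    (hk : ¬ (orderOf y = 2 ∧ orderOf x = 2 ∧ (orderOf c : ℤ) ∣ 2 * k0 - 1))
    (hk0 : b ∉ Subgroup.zpowers y ∨ k0 = k) :
    Sol a a⁻¹ x y b b⁻¹ (c ^ (1 - k)) (c ^ k) := by
  have ne1 : ∀ {H : Type u} [Group H] {x : H}, x ≠ 1 → orderOf x ≠ 1 := fun h => by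
    rwa [Ne, orderOf_eq_one_iff]
  obtain ⟨Δ, _, X, Y, Z, oX, oY, oZ, hYXZ, -, -, hYV⟩ := tri_group'.{u} (orderOf y) (orderOf x) (orderOf c)
    (ne1 hy) (ne1 hx) (ne1 hc) k0 hk
  obtain ⟨Δ', _, k1, k2, S1, S2, l1, l2, l3, h4, h5, h6, h7, h8, h9, h10⟩ := glue_cyclic Y y oY
  set V := Z ^ (-k) * X * Z ^ k with hV
  have oV : orderOf V = orderOf x := by
    have := orderOf_conj' (Z ^ (-k)) X
    rw [zpow_neg, inv_inv] at this
    rw [hV, zpow_neg, this, oX]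
  have hbV : k2 b ∉ Subgroup.zpowers (k1 V) := by
    rintro ⟨n, hn⟩
    simp only [← map_zpow] at hn
    by_cases hby : b ∈ Subgroup.zpowers y
    · have hkk := hk0.resolve_left (not_not.2 hby)
      subst hkk
      obtain ⟨j, rfl⟩ := hby
      simp only [map_zpow, ← l3] at hn
      simp only [← map_zpow] at hn
      have h1 := l1 hn
      have h2 := hYV j n h1.symm
      apply hb
      simp only
      rw [← orderOf_dvd_iff_zpow_eq_one] at h2 ⊢
      rwa [oY] at h2
    · have q1 := h5 b hby
      rw [← hn] at q1
      by_cases hVY : V ^ n ∈ Subgroup.zpowers Y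
      · obtain ⟨j, hj⟩ := hVY
        simp only at hj
        rw [← hj] at q1
        exact h9 _ q1
      · exact h10 _ (h4 _ hVY) q1
  have haA : a ∉ Subgroup.zpowers (a * x * a⁻¹) := by
    rintro ⟨n, hn⟩
    apply ha
    refine ⟨n, ?_⟩
    simp only [conj_zpow] at hn ⊢
    have : x ^ n = a⁻¹ * (a * x ^ n * a⁻¹) * a := by group
    rw [this, hn]; group
  obtain ⟨K1, _, i1, s, j1, F1⟩ := lemT (a * x * a⁻¹) a haA
  obtain ⟨K2, _, i2, s', j2, F2⟩ := lemT (k1 V) (k2 b) hbV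
  have G1 := F1 1
  have G2 := F2 (Equiv.swap 0 1)
  rw [orderOf_conj'] at G1
  rw [orderOf_injective k1 l1, oV] at G2
  obtain ⟨K, _, m1, m2, n1, n2, hm⟩ := glue_fr G1 G2
  have e0 : m1 s = m2 (i2 (k1 V)) := hm 0
  have e1 : m1 (i1 (a * x * a⁻¹)) = m2 s' := hm 1
  have e2 : m1 (i1 a * s * (i1 a)⁻¹) = m2 (i2 (k2 b) * s' * (i2 (k2 b))⁻¹) := hm 2
  have oZ' : orderOf (m2 (i2 (k1 Z))) = orderOf c := by
    rw [orderOf_injective m2 n2, orderOf_injective i2 j2, orderOf_injective k1 l1, oZ]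
  obtain ⟨L, _, t1, t2, _, _, r1, r2, r3, -⟩ := glue_cyclic (m2 (i2 (k1 Z))) c oZ'
  set fA := t1.comp (m1.comp i1) with hfA
  set fB0 := t1.comp (m2.comp (i2.comp k2)) with hfB0
  set fB := (MulAut.conj (fA a)⁻¹).toMonoidHom.comp fB0 with hfB
  have hB : ∀ z, fB z = (fA a)⁻¹ * fB0 z * fA a := by
    intro z; simp [hfB]
  have w1 : fA a * fB y * fA a⁻¹ = t1 (m2 (i2 (k1 Y))) := by
    rw [hB, map_inv]
    have : fB0 y = t1 (m2 (i2 (k1 Y))) := by rw [l3]; rfl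
    rw [this]; group
  have w2 : fB b * fA x * fB b⁻¹ = t1 (m2 (i2 (k1 V))) := by
    rw [hB, hB, map_inv fB0]
    have h1 : fA a * fA x * (fA a)⁻¹ = t1 (m2 s') := by
      rw [← e1, ← map_inv, ← map_mul, ← map_mul]; rfl
    have h2 : fB0 b * t1 (m2 s') * (fB0 b)⁻¹ = fA a * t1 (m1 s) * (fA a)⁻¹ := by
      have := congrArg t1 e2
      simp only [map_mul, map_inv] at this
      exact this.symm
    calc _ = (fA a)⁻¹ * (fB0 b * (fA a * fA x * (fA a)⁻¹) * (fB0 b)⁻¹) * fA a := by group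
      _ = t1 (m1 s) := by rw [h1, h2]; group
      _ = _ := by rw [e0]
  refine ⟨L, inferInstance, fA, fB, t2, Or.inl ⟨x, ?_⟩, ?_⟩
  · intro h
    have h' : t1 (m1 (i1 x)) = 1 := h
    exact hx (j1 (n1 (r1 (by simp only [map_one]; exact h'))))
  · rw [w1, w2, map_zpow, map_zpow, ← r3]
    simp only [← map_zpow, ← map_mul]
    have hz : Y * X = Z⁻¹ := eq_inv_of_mul_eq_one_left hYXZ
    have : Z ^ (1 - k) * Y * Z ^ k * V = 1 := by
      calc _ = Z ^ (1 - k) * (Y * X) * Z ^ k := by rw [hV]; group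
        _ = 1 := by rw [hz]; group
    rw [this]; simp

/-- the exceptional case -/
theorem caseE {A B C : Type u} [Group A] [Group B] [Group C] (a x : A) (y : B) (d : C)
    (hx : orderOf x = 2) (hy : orderOf y = 2) (ha : a ≠ 1) :
    Sol a a⁻¹ x y y y⁻¹ d d := by
  have hx1 : x ≠ 1 := by rintro rfl; simp at hx
  have hxx : x * x = 1 := by rw [← pow_two, ← hx]; exact pow_orderOf_eq_one x
  obtain ⟨K, _, i, Y, j, hYY, hE⟩ := thmE x a hxx hx1 ha
  have hY1 : Y ≠ 1 := by
    rintro rfl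
    apply hx1
    apply j
    simpa using hE
  have oY : orderOf Y = 2 := orderOf_eq_prime (by rw [pow_two, hYY]) hY1
  obtain ⟨K1, _, i1, i2, _, _, j1, j2, j3, -⟩ := glue_cyclic Y y (oY.trans hy.symm)
  let e : DihedralGroup (orderOf d) ≃* ULift.{u} (DihedralGroup (orderOf d)) := MulEquiv.ulift.symm
  have ho : ∀ x, orderOf (e x) = orderOf x := fun x => orderOf_injective e.toMonoidHom e.injective x
  have oW : orderOf (i1 (i a * Y * (i a)⁻¹)) = orderOf (e (DihedralGroup.sr 0)) := by
    rw [orderOf_injective i1 j1, orderOf_conj', oY, ho, DihedralGroup.orderOf_sr]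
  obtain ⟨K2, _, k1, k2, _, _, l1, l2, l3, -⟩ := glue_cyclic _ _ oW
  have oR : orderOf (k2 (e (DihedralGroup.r 1))) = orderOf d := by
    rw [orderOf_injective k2 l2, ho, DihedralGroup.orderOf_r_one]
  obtain ⟨L, _, m1, m2, _, _, n1, n2, n3, -⟩ := glue_cyclic _ _ oR
  refine ⟨L, inferInstance, m1.comp (k1.comp (i1.comp i)), m1.comp (k1.comp i2), m2, Or.inl ⟨x, ?_⟩, ?_⟩
  · intro h
    exact hx1 (j (j1 (l1 (n1 (by simpa using h)))))
  · simp only [MonoidHom.comp_apply]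
    rw [← n3, map_inv i2, ← j3]
    simp only [← map_mul, ← map_inv]
    have hYi : Y⁻¹ = Y := inv_eq_of_mul_eq_one_right hYY
    rw [hYi, hE, map_inv i, l3]
    simp only [← map_mul]
    simp

/-- case 2c -/
theorem case2c {A B C : Type u} [Group A] [Group B] [Group C] (a x : A) (y b : B) (c : C) (k : ℤ)
    (hx : x ≠ 1) (hy : y ≠ 1) (hc : c ≠ 1) (ha1 : a ≠ 1) (hb1 : b ≠ 1) (ha : a ∈ Subgroup.zpowers x)
    (hb : b ∈ Subgroup.zpowers y) : Sol a a⁻¹ x y b b⁻¹ (c ^ (1 - k)) (c ^ k) := by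
  have ne1 : ∀ {H : Type u} [Group H] {x : H}, x ≠ 1 → orderOf x ≠ 1 := fun h => by
    rwa [Ne, orderOf_eq_one_iff]
  obtain ⟨i, hi⟩ := ha
  obtain ⟨j, hj⟩ := hb
  simp only at hi hj
  subst hi hj
  by_cases hpq : orderOf y = orderOf x
  · obtain ⟨K, _, i1, i2, _, _, j1, j2, j3, -⟩ := glue_cyclic x y⁻¹ (by rw [orderOf_inv, hpq])
    refine ⟨K, inferInstance, i1, i2, 1, Or.inl ⟨x, ?_⟩, ?_⟩
    · intro h
      exact hx (j1 (by simpa using h))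
    · simp only [map_inv, map_zpow, j3, MonoidHom.one_apply]
      group
  · rw [Ne, ← orderOf_dvd_iff_zpow_eq_one] at ha1 hb1
    obtain ⟨K, _, X, Y, Z, h1, h2, h3, h4⟩ := two_c'.{u} (orderOf y) (orderOf x) (orderOf c) (ne1 hy) (ne1 hx) (ne1 hc)
      hpq k i j ha1 hb1
    obtain ⟨K1, _, i1, i2, _, _, j1, j2, j3, -⟩ := glue_cyclic X x h1
    obtain ⟨K2, _, k1, k2, _, _, l1, l2, l3, -⟩ := glue_cyclic (i1 Y) y (by rw [orderOf_injective i1 j1, h2])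
    obtain ⟨K3, _, m1, m2, _, _, n1, n2, n3, -⟩ := glue_cyclic (k1 (i1 Z)) c (by
      rw [orderOf_injective k1 l1, orderOf_injective i1 j1, h3])
    refine ⟨K3, inferInstance, m1.comp (k1.comp i2), m1.comp k2, m2, Or.inl ⟨x, ?_⟩, ?_⟩
    · intro h
      exact hx (j2 (l1 (n1 (by simpa using h))))
    · simp only [map_inv, map_zpow, MonoidHom.comp_apply, ← j3, ← l3, ← n3]
      have := congrArg (fun t => m1 (k1 (i1 t))) h4
      simpa only [map_mul, map_zpow, map_inv, map_one] using this

theorem main_sol {A B C : Type u} [Group A] [Group B] [Group C] (α α₁ α₂ : A) (β β₁ β₂ : B) (c₁ c₂ : C)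
    (hα : α ≠ 1) (hα₁ : α₁ ≠ 1) (hα₂ : α₂ ≠ 1) (hβ : β ≠ 1) (hβ₁ : β₁ ≠ 1) (hβ₂ : β₂ ≠ 1)
    (hc₁ : c₁ ≠ 1) (hc₂ : c₂ ≠ 1) (hc : c₁ * c₂ ≠ 1) :
    Sol α α₁ α₂ β β₁ β₂ c₁ c₂ := by
  have hc' : c₂ * c₁ ≠ 1 := by rwa [Ne, mul_eq_one_comm]
  by_cases hb : β₂ * β₁ = 1
  swap
  · exact case0 α α₁ α₂ β β₁ β₂ c₁ c₂ hα hα₁ hα₂ hβ hβ₁ hβ₂ hc₁ hc₂ hc' hb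
  by_cases ha : α₁ * α = 1
  swap
  · exact (case0 β₁ β₂ β α₂ α α₁ c₂ c₁ hβ₁ hβ₂ hβ hα₂ hα hα₁ hc₂ hc₁ hc ha).swap
  rw [eq_inv_of_mul_eq_one_left hb, eq_inv_of_mul_eq_one_left ha]
  by_cases hcc : c₂ ∈ Subgroup.zpowers (c₂ * c₁)
  swap
  · exact case1 α α₂ β β₁ c₁ c₂ hα hα₂ hβ hβ₁ hc' hcc
  obtain ⟨k, hk⟩ := hcc
  simp only at hk
  have hk1 : (c₂ * c₁) ^ (1 - k) = c₁ := by
    rw [sub_eq_neg_add, zpow_add, zpow_neg, hk, zpow_one, inv_mul_cancel_left]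
  generalize c₂ * c₁ = c at *
  subst hk hk1
  by_cases hex : orderOf β = 2 ∧ orderOf α₂ = 2 ∧ (orderOf c : ℤ) ∣ 2 * k - 1
  · have hcd : c ^ (1 - k) = c ^ k := by
      have := orderOf_dvd_iff_zpow_eq_one.1 hex.2.2
      rw [← mul_one (c ^ (1 - k)), ← this, ← zpow_add]
      congr 1; ring
    have inv_only : ∀ {H : Type u} [Group H] {t s : H}, orderOf t = 2 → s ∈ Subgroup.zpowers t → s ≠ 1 → s = t := by
      rintro H _ t s ht ⟨n, rfl⟩ hs
      simp only at hs ⊢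
      have htt : t ^ (2 : ℤ) = 1 := by
        have := pow_orderOf_eq_one t
        rw [ht] at this
        exact_mod_cast this
      rcases Int.even_or_odd' n with ⟨w, rfl | rfl⟩
      · rw [zpow_mul, htt, one_zpow] at hs
        exact absurd rfl hs
      · rw [zpow_add, zpow_mul, htt, one_zpow, one_mul, zpow_one]
    by_cases hby : β₁ ∈ Subgroup.zpowers β
    · rw [inv_only hex.1 hby hβ₁, hcd]
      exact caseE α α₂ β _ hex.2.1 hex.1 hα
    by_cases hax : α ∈ Subgroup.zpowers α₂
    · rw [inv_only hex.2.1 hax hα, hcd]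
      exact (caseE β₁ β α₂ _ hex.1 hex.2.1 hβ₁).swap
    refine case2a α α₂ β β₁ c k 0 hα₂ hβ hc' hβ₁ hax ?_ (Or.inl hby)
    rintro ⟨-, -, h⟩
    rw [orderOf_dvd_iff_zpow_eq_one] at h
    apply hc'
    simpa using h
  · by_cases hax : α ∈ Subgroup.zpowers α₂
    · by_cases hby : β₁ ∈ Subgroup.zpowers β
      · exact case2c α α₂ β β₁ c k hα₂ hβ hc' hα hβ₁ hax hby
      · apply Sol.swap
        have := case2a β₁ β α₂ α c (1 - k) (1 - k) hβ hα₂ hc' hα hby (by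
          rintro ⟨h1, h2, h3⟩
          apply hex
          refine ⟨h2, h1, ?_⟩
          have e : 2 * k - 1 = -(2 * (1 - k) - 1) := by ring
          rw [e, dvd_neg]
          exact h3) (Or.inr rfl)
        rwa [sub_sub_cancel] at this
    · exact case2a α α₂ β β₁ c k k hα₂ hβ hc' hβ₁ hax hex (Or.inr rfl)

end P59

/-- **Proposition 5.9 (Chinyere–Howie).** Standing assumptions as in Lemma 5.3.  If
`U = αβα₁` and `V = β₁α₂β₂`, with `α, α₁, α₂` nontrivial in `A` and
`β, β₁, β₂` nontrivial in `B`, then `G` is nontrivial. -/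
theorem prop_5_9
    {G : Fin 3 → Type*} [∀ i, Group (G i)] [∀ i, Nontrivial (G i)]
    (c₁ c₂ : G 2) (hc₁ : c₁ ≠ 1) (hc₂ : c₂ ≠ 1) (hc₁c₂ : c₁ * c₂ ≠ 1)
    (U V : Monoid.CoprodI (subFamily G))
    (hlen : CoprodI.length U + CoprodI.length V ≤ 6)
    (hUVA : U * V ∉ Subgroup.normalClosure
      (Set.range (Monoid.CoprodI.of : subFamily G 0 →* Monoid.CoprodI (subFamily G))))
    (hUVB : U * V ∉ Subgroup.normalClosure
      (Set.range (Monoid.CoprodI.of : subFamily G 1 →* Monoid.CoprodI (subFamily G))))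
    (α α₁ α₂ : subFamily G 0) (β β₁ β₂ : subFamily G 1)
    (hα : α ≠ 1) (hα₁ : α₁ ≠ 1) (hα₂ : α₂ ≠ 1)
    (hβ : β ≠ 1) (hβ₁ : β₁ ≠ 1) (hβ₂ : β₂ ≠ 1)
    (hU : U = (Monoid.CoprodI.of : subFamily G 0 →* Monoid.CoprodI (subFamily G)) α * (Monoid.CoprodI.of : subFamily G 1 →* Monoid.CoprodI (subFamily G)) β * (Monoid.CoprodI.of : subFamily G 0 →* Monoid.CoprodI (subFamily G)) α₁)
    (hV : V = (Monoid.CoprodI.of : subFamily G 1 →* Monoid.CoprodI (subFamily G)) β₁ * (Monoid.CoprodI.of : subFamily G 0 →* Monoid.CoprodI (subFamily G)) α₂ * (Monoid.CoprodI.of : subFamily G 1 →* Monoid.CoprodI (subFamily G)) β₂)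
    :
    Nontrivial (Monoid.CoprodI G ⧸ Subgroup.normalClosure
      {(Monoid.CoprodI.of : G 2 →* Monoid.CoprodI G) c₁ * CoprodI.embed G U *
        (Monoid.CoprodI.of : G 2 →* Monoid.CoprodI G) c₂ * CoprodI.embed G V}) := by
  obtain ⟨K, _, fA, fB, fC, hne, hrel⟩ := P59.main_sol (A := G 0) (B := G 1) (C := G 2)
    α α₁ α₂ β β₁ β₂ c₁ c₂ hα hα₁ hα₂ hβ hβ₁ hβ₂ hc₁ hc₂ hc₁c₂
  let F : ∀ i : Fin 3, G i →* K := fun i => match i with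
    | 0 => fA
    | 1 => fB
    | 2 => fC
  let f : Monoid.CoprodI G →* K := Monoid.CoprodI.lift F
  have f0 : ∀ a : G 0, f (Monoid.CoprodI.of (i := (0 : Fin 3)) a) = fA a := fun a =>
    Monoid.CoprodI.lift_of F a
  have f1 : ∀ b : G 1, f (Monoid.CoprodI.of (i := (1 : Fin 3)) b) = fB b := fun b =>
    Monoid.CoprodI.lift_of F b
  have f2 : ∀ c : G 2, f (Monoid.CoprodI.of (i := (2 : Fin 3)) c) = fC c := fun c =>
    Monoid.CoprodI.lift_of F c
  have g0 : ∀ a : subFamily G 0,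
      f (CoprodI.embed G (Monoid.CoprodI.of (i := (0 : Fin 2)) a)) = fA a := fun a =>
    (congrArg f (Monoid.CoprodI.lift_of (M := subFamily G)
      (fun i => (Monoid.CoprodI.of : G i.castSucc →* Monoid.CoprodI G)) a)).trans (f0 a)
  have g1 : ∀ b : subFamily G 1,
      f (CoprodI.embed G (Monoid.CoprodI.of (i := (1 : Fin 2)) b)) = fB b := fun b =>
    (congrArg f (Monoid.CoprodI.lift_of (M := subFamily G)
      (fun i => (Monoid.CoprodI.of : G i.castSucc →* Monoid.CoprodI G)) b)).trans (f1 b)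
  have hle : Subgroup.normalClosure
      {(Monoid.CoprodI.of : G 2 →* Monoid.CoprodI G) c₁ * CoprodI.embed G U *
        (Monoid.CoprodI.of : G 2 →* Monoid.CoprodI G) c₂ * CoprodI.embed G V} ≤ f.ker := by
    apply Subgroup.normalClosure_le_normal
    rw [Set.singleton_subset_iff, SetLike.mem_coe, MonoidHom.mem_ker, hU, hV]
    simp only [map_mul, g0, g1, f2]
    exact hrel
  by_contra hcon
  rw [not_nontrivial_iff_subsingleton] at hcon
  have hall : ∀ x : Monoid.CoprodI G, f x = 1 := fun x =>
    MonoidHom.mem_ker.1 (hle ((QuotientGroup.eq_one_iff x).1 (Subsingleton.elim _ _)))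
  rcases hne with ⟨a, ha⟩ | ⟨b, hb⟩
  · exact ha ((f0 a).symm.trans (hall _))
  · exact hb ((f1 b).symm.trans (hall _))
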